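/- arXiv:2104.15138 — 4 statements merged into one kernel-verified Lean document; each statement's English description precedes it below -/
import Mathlib

section
/- Under assumptions A1–A3, the function f(θ) = T_c(ρ(·,θ), ρ*) is directionally differentiable at every θ₀ ∈ Θ, with directional derivative f'(θ₀, Δθ) = sup over Kantorovich potential pairs (φ, φ^c) ∈ S(θ₀) of (∫_Ω φ(x) ∇_θ ρ(x,θ₀) dx) · Δθ. -/
open MeasureTheory Set Filter

/-- The Kantorovich optimal transport cost between two measures. -/
noncomputable def Tc {X : Type*} [MeasurableSpace X] (c : X × X → ℝ)
    (μ ν : Measure X) : ℝ :=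
  sInf {r : ℝ | ∃ π : Measure (X × X),
    π.map Prod.fst = μ ∧ π.map Prod.snd = ν ∧ r = ∫ z, c z ∂π}

/-- Admissible Kantorovich dual pairs `(φ, ψ)` on `Ω` for the cost `c`. -/
def dualPairs {X : Type*} [TopologicalSpace X] (Ω : Set X) (c : X × X → ℝ) :
    Set ((X → ℝ) × (X → ℝ)) :=
  {p | ContinuousOn p.1 Ω ∧ ContinuousOn p.2 Ω ∧
    ∀ x ∈ Ω, ∀ y ∈ Ω, p.1 x + p.2 y ≤ c (x, y)}

open scoped Topology CompactlySupported

section duality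
variable {X Y : Type*} [MetricSpace X] [CompactSpace X] [MeasurableSpace X] [BorelSpace X]
  [MetricSpace Y] [CompactSpace Y] [MeasurableSpace Y] [BorelSpace Y]

lemma kd_integrable (μ : Measure X) [IsFiniteMeasure μ] (φ : C(X, ℝ)) : Integrable φ μ :=
  φ.continuous.integrable_of_hasCompactSupport (HasCompactSupport.of_compactSpace _)

/-- The sublinear functional of the dual problem. -/
noncomputable def kdP (μ : Measure X) (ν : Measure Y) (h : C(X × Y, ℝ)) : ℝ :=
  sInf {r : ℝ | ∃ φ : C(X, ℝ), ∃ ψ : C(Y, ℝ), (∀ x y, h (x, y) ≤ φ x + ψ y) ∧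
    r = ∫ x, φ x ∂μ + ∫ y, ψ y ∂ν}

lemma kd_mono (μ : Measure X) (ν : Measure Y) [IsProbabilityMeasure μ] [IsProbabilityMeasure ν]
    (a : ℝ) (φ : C(X, ℝ)) (ψ : C(Y, ℝ)) (h : ∀ x y, a ≤ φ x + ψ y) :
    a ≤ ∫ x, φ x ∂μ + ∫ y, ψ y ∂ν := by
  have h1 : ∫ x, φ x ∂μ = ∫ z, φ z.1 ∂(μ.prod ν) := by
    rw [integral_fun_fst]; simp
  have h2 : ∫ x, ψ x ∂ν = ∫ z, ψ z.2 ∂(μ.prod ν) := by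
    rw [integral_fun_snd]; simp
  have i1 : Integrable (fun z : X × Y => φ z.1) (μ.prod ν) := 
    kd_integrable (μ.prod ν) (φ.comp ⟨Prod.fst, continuous_fst⟩)
  have i2 : Integrable (fun z : X × Y => ψ z.2) (μ.prod ν) := 
    kd_integrable (μ.prod ν) (ψ.comp ⟨Prod.snd, continuous_snd⟩)
  rw [h1, h2, ← integral_add i1 i2]
  have : a = ∫ z, a ∂(μ.prod ν) := by simp
  rw [this]
  exact integral_mono (integrable_const _) (i1.add i2) (fun z => h z.1 z.2)

lemma kdP_le (μ : Measure X) (ν : Measure Y) [IsProbabilityMeasure μ] [IsProbabilityMeasure ν]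
    (h : C(X × Y, ℝ)) (φ : C(X, ℝ)) (ψ : C(Y, ℝ)) (hh : ∀ x y, h (x, y) ≤ φ x + ψ y) :
    kdP μ ν h ≤ ∫ x, φ x ∂μ + ∫ y, ψ y ∂ν := by
  refine csInf_le ⟨-‖h‖, ?_⟩ ⟨φ, ψ, hh, rfl⟩
  rintro r ⟨φ, ψ, hh, rfl⟩
  apply kd_mono
  intro x y
  have := h.norm_coe_le_norm (x, y)
  rw [Real.norm_eq_abs] at this
  linarith [neg_abs_le (h (x, y)), hh x y]

lemma kdP_nonempty (μ : Measure X) (ν : Measure Y) (h : C(X × Y, ℝ)) :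
    {r : ℝ | ∃ φ : C(X, ℝ), ∃ ψ : C(Y, ℝ), (∀ x y, h (x, y) ≤ φ x + ψ y) ∧
    r = ∫ x, φ x ∂μ + ∫ y, ψ y ∂ν}.Nonempty := by
  refine ⟨_, ContinuousMap.const _ ‖h‖, 0, ?_, rfl⟩
  intro x y
  have := h.norm_coe_le_norm (x, y)
  rw [Real.norm_eq_abs] at this
  simp
  linarith [le_abs_self (h (x, y))]

lemma le_kdP (μ : Measure X) (ν : Measure Y)
    (h : C(X × Y, ℝ)) (b : ℝ) (hb : ∀ (φ : C(X, ℝ)) (ψ : C(Y, ℝ)), (∀ x y, h (x, y) ≤ φ x + ψ y) →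
    b ≤ ∫ x, φ x ∂μ + ∫ y, ψ y ∂ν) : b ≤ kdP μ ν h := by
  refine le_csInf (kdP_nonempty μ ν h) ?_
  rintro r ⟨φ, ψ, hh, rfl⟩
  exact hb φ ψ hh

lemma exists_kdP (μ : Measure X) (ν : Measure Y) (h : C(X × Y, ℝ)) (ε : ℝ) (hε : 0 < ε) :
    ∃ (φ : C(X, ℝ)) (ψ : C(Y, ℝ)), (∀ x y, h (x, y) ≤ φ x + ψ y) ∧
      ∫ x, φ x ∂μ + ∫ y, ψ y ∂ν < kdP μ ν h + ε := by
  obtain ⟨r, ⟨φ, ψ, hh, rfl⟩, hr⟩ := exists_lt_of_csInf_lt (kdP_nonempty μ ν h)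
    (lt_add_of_pos_right (kdP μ ν h) hε)
  exact ⟨φ, ψ, hh, hr⟩

variable (μ : Measure X) (ν : Measure Y) [IsProbabilityMeasure μ] [IsProbabilityMeasure ν]

lemma kdP_smul_le (a : ℝ) (ha : 0 < a) (h : C(X × Y, ℝ)) : kdP μ ν (a • h) ≤ a * kdP μ ν h := by
  have : kdP μ ν (a • h) / a ≤ kdP μ ν h := by
    apply le_kdP
    intro φ ψ hh
    rw [div_le_iff₀' ha]
    refine (kdP_le μ ν (a • h) (a • φ) (a • ψ) ?_).trans ?_
    · intro x y
      have := mul_le_mul_of_nonneg_left (hh x y) ha.le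
      simp; linarith
    · simp [integral_const_mul, mul_add]
  rwa [div_le_iff₀' ha] at this

lemma kdP_smul (a : ℝ) (ha : 0 < a) (h : C(X × Y, ℝ)) : kdP μ ν (a • h) = a * kdP μ ν h := by
  apply le_antisymm (kdP_smul_le μ ν a ha h)
  have := kdP_smul_le μ ν a⁻¹ (inv_pos.2 ha) (a • h)
  rw [smul_smul, inv_mul_cancel₀ ha.ne', one_smul] at this
  rwa [← div_eq_inv_mul, le_div_iff₀' ha] at this

lemma kdP_add (g h : C(X × Y, ℝ)) : kdP μ ν (g + h) ≤ kdP μ ν g + kdP μ ν h := by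
  apply le_of_forall_pos_le_add
  intro ε hε
  obtain ⟨φ, ψ, h1, h2⟩ := exists_kdP μ ν g (ε/2) (by positivity)
  obtain ⟨φ', ψ', h1', h2'⟩ := exists_kdP μ ν h (ε/2) (by positivity)
  have := kdP_le μ ν (g + h) (φ + φ') (ψ + ψ') (fun x y => by simp; linarith [h1 x y, h1' x y])
  simp only [ContinuousMap.add_apply] at this
  rw [integral_add (kd_integrable μ φ) (kd_integrable μ φ'),
    integral_add (kd_integrable ν ψ) (kd_integrable ν ψ')] at this
  linarith

theorem kant_dual (c : C(X × Y, ℝ)) : ∃ π : Measure (X × Y), π.map Prod.fst = μ ∧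
    π.map Prod.snd = ν ∧ ∀ ε > 0, ∃ (φ : C(X, ℝ)) (ψ : C(Y, ℝ)),
      (∀ x y, φ x + ψ y ≤ c (x, y)) ∧ ∫ z, c z ∂π ≤ ∫ x, φ x ∂μ + ∫ y, ψ y ∂ν + ε := by
  set P := kdP μ ν with hP
  have P0 : P 0 = 0 := by
    have := kdP_smul μ ν 2 (by norm_num) 0
    rw [smul_zero] at this
    change P 0 = 2 * P 0 at this
    linarith
  have hH : ∀ a : ℝ, a • (-c) = 0 → a • P (-c) = 0 := by
    intro a ha
    rcases smul_eq_zero.1 ha with h | h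
    · simp [h]
    · rw [h, P0, smul_zero]
  obtain ⟨L, hL1, hL2⟩ := exists_extension_of_le_sublinear
    (LinearPMap.mkSpanSingleton' (-c) (P (-c)) hH) P (kdP_smul μ ν) (kdP_add μ ν) (by
      rintro ⟨x, hx⟩
      obtain ⟨a, rfl⟩ := Submodule.mem_span_singleton.1 hx
      rw [LinearPMap.mkSpanSingleton'_apply]
      rcases lt_trichotomy a 0 with h | h | h
      · have h1 := kdP_add μ ν (a • (-c)) ((-a) • (-c))
        rw [kdP_smul μ ν (-a) (by linarith) (-c)] at h1
        rw [← add_smul, add_neg_cancel, zero_smul] at h1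
        change P 0 ≤ P (a • (-c)) + -a * P (-c) at h1
        change a * P (-c) ≤ P (a • (-c))
        linarith
      · subst h; simp [P0]
      · exact (kdP_smul μ ν a h _).ge)
  have hLc : L c = - P (-c) := by
    have := hL1 ⟨-c, Submodule.mem_span_singleton_self _⟩
    have h2 := LinearPMap.mkSpanSingleton'_apply_self (σ := RingHom.id ℝ) (-c) (P (-c)) hH (Submodule.mem_span_singleton_self _)
    rw [h2] at this
    simp at this
    linarith
  have hpos : ∀ h : C(X × Y, ℝ), (∀ z, 0 ≤ h z) → 0 ≤ L h := by
    intro h hh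
    have h1 := hL2 (-h)
    have h2 := kdP_le μ ν (-h) 0 0 (fun x y => by simpa using hh (x, y))
    simp at h1 h2
    linarith
  have hsum : ∀ (φ : C(X, ℝ)) (ψ : C(Y, ℝ)), L (φ.comp ⟨Prod.fst, continuous_fst⟩ +
      ψ.comp ⟨Prod.snd, continuous_snd⟩) ≤ ∫ x, φ x ∂μ + ∫ y, ψ y ∂ν := by
    intro φ ψ
    exact (hL2 _).trans (kdP_le μ ν _ φ ψ (fun x y => by simp))
  have hfst : ∀ (φ : C(X, ℝ)), L (φ.comp ⟨Prod.fst, continuous_fst⟩) = ∫ x, φ x ∂μ := by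
    intro φ
    have h1 := hsum φ 0
    have h2 := hsum (-φ) 0
    simp [integral_neg] at h1 h2
    linarith
  have hsnd : ∀ (ψ : C(Y, ℝ)), L (ψ.comp ⟨Prod.snd, continuous_snd⟩) = ∫ x, ψ x ∂ν := by
    intro φ
    have h1 := hsum 0 φ
    have h2 := hsum 0 (-φ)
    simp [integral_neg] at h1 h2
    linarith
  let Λ : C_c(X × Y, ℝ) →ₚ[ℝ] ℝ := PositiveLinearMap.mk₀
    { toFun := fun h => L h.toContinuousMap
      map_add' := fun a b => L.map_add a.toContinuousMap b.toContinuousMap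
      map_smul' := fun a b => L.map_smul a b.toContinuousMap }
    (fun h hh => hpos h.toContinuousMap hh)
  let π := RealRMK.rieszMeasure Λ
  have hπ : ∀ h : C(X × Y, ℝ), ∫ z, h z ∂π = L h := fun h =>
    RealRMK.integral_rieszMeasure Λ (CompactlySupportedContinuousMap.continuousMapEquiv h)
  have : IsFiniteMeasureOnCompacts π := inferInstanceAs (IsFiniteMeasureOnCompacts (RealRMK.rieszMeasure Λ))
  have : IsFiniteMeasure π := inferInstance
  refine ⟨π, ?_, ?_, ?_⟩
  · apply ext_of_forall_integral_eq_of_IsFiniteMeasure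
    intro f
    rw [integral_map measurable_fst.aemeasurable f.continuous.aestronglyMeasurable]
    exact (hπ _).trans (hfst f.toContinuousMap)
  · apply ext_of_forall_integral_eq_of_IsFiniteMeasure
    intro f
    rw [integral_map measurable_snd.aemeasurable f.continuous.aestronglyMeasurable]
    exact (hπ _).trans (hsnd f.toContinuousMap)
  · intro ε hε
    obtain ⟨φ, ψ, h1, h2⟩ := exists_kdP μ ν (-c) ε hε
    refine ⟨-φ, -ψ, fun x y => ?_, ?_⟩
    · have := h1 x y
      simp at this ⊢
      linarith
    · rw [hπ, hLc]
      simp [integral_neg]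
      change _ < P (-c) + ε at h2
      linarith

end duality
section ctrans
variable {X Y : Type*} [MetricSpace X] [CompactSpace X] [MetricSpace Y] [CompactSpace Y]

lemma ctrans_exists [Nonempty Y] (c : C(X × Y, ℝ)) (g : Y → ℝ) (x₀ : X) (b₀ : ℝ)
    (hb₀ : ∀ y, b₀ ≤ c (x₀, y) - g y) :
    ∃ φ : C(X, ℝ), (∀ x y, φ x ≤ c (x, y) - g y) ∧
      (∀ x b, (∀ y, b ≤ c (x, y) - g y) → b ≤ φ x) ∧
      ∀ x x', |φ x - φ x'| ≤ dist (c.curry x) (c.curry x') := by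
  let F : X → ℝ := fun x => ⨅ y, (c (x, y) - g y)
  have hd : ∀ x x' y, c (x, y) ≤ c (x', y) + dist (c.curry x) (c.curry x') := by
    intro x x' y
    have := ContinuousMap.dist_apply_le_dist (f := c.curry x) (g := c.curry x') y
    rw [Real.dist_eq] at this
    have h2 := le_abs_self (c.curry x y - c.curry x' y)
    simp only [ContinuousMap.curry_apply] at this h2
    linarith
  have hbdd : ∀ x, BddBelow (range fun y => c (x, y) - g y) := by
    intro x
    refine ⟨b₀ - dist (c.curry x₀) (c.curry x), ?_⟩
    rintro _ ⟨y, rfl⟩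
    have := hd x₀ x y
    have := hb₀ y
    simp only
    linarith
  have h1 : ∀ x y, F x ≤ c (x, y) - g y := fun x y => ciInf_le (hbdd x) y
  have h2 : ∀ x b, (∀ y, b ≤ c (x, y) - g y) → b ≤ F x := fun x b h => le_ciInf h
  have h3 : ∀ x x', F x - dist (c.curry x) (c.curry x') ≤ F x' := by
    intro x x'
    apply h2
    intro y
    linarith [h1 x y, hd x x' y]
  have h4 : ∀ x x', |F x - F x'| ≤ dist (c.curry x) (c.curry x') := by
    intro x x'
    rw [abs_le]
    have := h3 x x'
    have h5 := h3 x' x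
    rw [dist_comm] at h5
    constructor <;> linarith
  have hcont : Continuous F := by
    rw [continuous_iff_continuousAt]
    intro x
    rw [ContinuousAt, tendsto_iff_dist_tendsto_zero]
    refine squeeze_zero (fun _ => dist_nonneg) (fun x' => ?_)
      (tendsto_iff_dist_tendsto_zero.1 (c.curry.continuous.tendsto x))
    exact h4 x' x
  exact ⟨⟨F, hcont⟩, h1, h2, h4⟩

/-- Equicontinuous bounded set. -/
def ctK (c : C(X × Y, ℝ)) (M : ℝ) : Set C(X, ℝ) :=
  {φ | (∀ x, |φ x| ≤ M) ∧ ∀ x x', |φ x - φ x'| ≤ dist (c.curry x) (c.curry x')}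

lemma ctK_closed (c : C(X × Y, ℝ)) (M : ℝ) : IsClosed (ctK c M) := by
  have : ctK c M = (⋂ x, {φ : C(X, ℝ) | |φ x| ≤ M}) ∩
      ⋂ x, ⋂ x', {φ : C(X, ℝ) | |φ x - φ x'| ≤ dist (c.curry x) (c.curry x')} := by
    ext φ; simp [ctK]
  rw [this]
  refine (isClosed_iInter fun x => ?_).inter (isClosed_iInter fun x => isClosed_iInter fun x' => ?_)
  · exact isClosed_le (by fun_prop) (by fun_prop)
  · exact isClosed_le (by fun_prop) (by fun_prop)

lemma ctK_compact (c : C(X × Y, ℝ)) (M : ℝ) : IsCompact (ctK c M) := by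
  let e := ContinuousMap.equivBoundedOfCompact X ℝ
  let e' := (ContinuousMap.isometryEquivBoundedOfCompact X ℝ).toHomeomorph
  have : IsCompact (e' '' ctK c M) := by
    apply BoundedContinuousFunction.arzela_ascoli₂ (Icc (-M) M) isCompact_Icc
    · exact e'.isClosed_image.2 (ctK_closed c M)
    · rintro f x ⟨φ, hφ, rfl⟩
      exact abs_le.1 (hφ.1 x)
    · intro x
      rw [Metric.equicontinuousAt_iff_right]
      intro ε hε
      have := Metric.tendsto_nhds.1 (c.curry.continuous.tendsto x) ε hε
      filter_upwards [this] with x' hx'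
      rintro ⟨_, φ, hφ, rfl⟩
      refine lt_of_le_of_lt ?_ hx'
      rw [dist_comm]
      exact hφ.2 x' x
  exact e'.isCompact_image.1 this

/-- compact set of dual pairs -/
lemma exists_K [Nonempty X] [Nonempty Y] (c : C(X × Y, ℝ)) :
    ∃ K : Set (C(X, ℝ) × C(Y, ℝ)), IsCompact K ∧
      (∀ p ∈ K, ∀ x y, p.1 x + p.2 y ≤ c (x, y)) ∧
      ∀ (φ : C(X, ℝ)) (ψ : C(Y, ℝ)), (∀ x y, φ x + ψ y ≤ c (x, y)) →
        ∃ p ∈ K, ∃ a : ℝ, ∀ x y, φ x ≤ p.1 x + a ∧ ψ y ≤ p.2 y - a := by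
  let c' : C(Y × X, ℝ) := c.comp ⟨Prod.swap, continuous_swap⟩
  let M := 2 * ‖c‖
  have hcn : ∀ x y, |c (x, y)| ≤ ‖c‖ := fun x y => c.norm_coe_le_norm (x, y)
  let D : Set (C(X, ℝ) × C(Y, ℝ)) := {p | ∀ x y, p.1 x + p.2 y ≤ c (x, y)}
  have hD : IsClosed D := by
    have : D = ⋂ x, ⋂ y, {p : C(X, ℝ) × C(Y, ℝ) | p.1 x + p.2 y ≤ c (x, y)} := by
      ext p; simp [D]
    rw [this]
    exact isClosed_iInter fun x => isClosed_iInter fun y => isClosed_le (by fun_prop) (by fun_prop)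
  refine ⟨(ctK c M ×ˢ ctK c' (M + ‖c‖)) ∩ D, ((ctK_compact c M).prod (ctK_compact c' _)).inter_right hD,
    fun p hp => hp.2, ?_⟩
  intro φ ψ h
  obtain ⟨x₀⟩ := ‹Nonempty X›
  obtain ⟨y₀⟩ := ‹Nonempty Y›
  have : Nonempty X := ⟨x₀⟩
  have : Nonempty Y := ⟨y₀⟩
  obtain ⟨φ₁, h1, h2, h3⟩ := ctrans_exists c ψ x₀ (φ x₀) (fun y => by linarith [h x₀ y])
  let a := φ₁ x₀
  let φ₂ : C(X, ℝ) := φ₁ - ContinuousMap.const X a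
  have e2 : ∀ x, φ₂ x = φ₁ x - a := fun x => rfl
  have hφ₂ : ∀ x, |φ₂ x| ≤ M := by
    intro x
    refine (h3 x x₀).trans ?_
    rw [ContinuousMap.dist_le (by positivity)]
    intro y
    rw [Real.dist_eq]
    have h5 := hcn x y
    have h6 := hcn x₀ y
    simp only [ContinuousMap.curry_apply, M]
    rw [abs_le] at *
    constructor <;> linarith
  have hψa : ∀ x y, ψ y + a ≤ c (x, y) - φ₂ x := by
    intro x y
    rw [e2]; linarith [h1 x y]
  obtain ⟨ψ₁, g1, g2, g3⟩ := ctrans_exists c' φ₂ y₀ (ψ y₀ + a) (fun x => hψa x y₀)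
  have g1' : ∀ x y, ψ₁ y ≤ c (x, y) - φ₂ x := fun x y => g1 y x
  refine ⟨(φ₂, ψ₁), ⟨⟨⟨hφ₂, ?_⟩, ⟨?_, g3⟩⟩, ?_⟩, a, ?_⟩
  · intro x x'
    simp only [e2]
    simpa using h3 x x'
  · intro y
    rw [abs_le]
    constructor
    · apply g2
      intro x
      change _ ≤ c (x, y) - φ₂ x
      linarith [abs_le.1 (hφ₂ x), abs_le.1 (hcn x y)]
    · have := g1' x₀ y
      linarith [abs_le.1 (hφ₂ x₀), abs_le.1 (hcn x₀ y)]
  · intro x y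
    linarith [g1' x y]
  · intro x y
    constructor
    · simp only [e2]
      have := h2 x (φ x) (fun y => by linarith [h x y])
      linarith
    · have := g2 y (ψ y + a) (fun x => hψa x y)
      simp only
      linarith
end ctrans
section whole
variable {E : Type*} [MetricSpace E] [MeasurableSpace E] [BorelSpace E]

/-- Extension by zero of a function on a subset. -/
noncomputable def ext0 {Ω : Set E} (φ : C(Ω, ℝ)) : E → ℝ :=
  Function.extend Subtype.val φ 0

lemma ext0_apply {Ω : Set E} (φ : C(Ω, ℝ)) (x : Ω) : ext0 φ x = φ x :=
  Subtype.val_injective.extend_apply _ _ _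

lemma ext0_off {Ω : Set E} (φ : C(Ω, ℝ)) (x : E) (hx : x ∉ Ω) : ext0 φ x = 0 := by
  rw [ext0, Function.extend_apply']
  · rfl
  · rintro ⟨y, rfl⟩; exact hx y.2

lemma ext0_continuousOn {Ω : Set E} (φ : C(Ω, ℝ)) : ContinuousOn (ext0 φ) Ω := by
  rw [continuousOn_iff_continuous_restrict]
  convert φ.continuous using 1
  ext x
  exact ext0_apply φ x

lemma ext0_measurable {Ω : Set E} (hΩ : MeasurableSet Ω) (φ : C(Ω, ℝ)) : Measurable (ext0 φ) :=
  (MeasurableEmbedding.subtype_coe hΩ).measurable_extend φ.continuous.measurable measurable_const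

lemma integral_ext0 {Ω : Set E} (hΩ : MeasurableSet Ω) (φ : C(Ω, ℝ)) (μ : Measure E)
    (hμ : μ Ωᶜ = 0) : ∫ x, ext0 φ x ∂μ = ∫ x, φ x ∂(μ.comap ((↑) : Ω → E)) := by
  have h1 : μ.restrict Ω = μ := Measure.restrict_eq_self_of_ae_mem (by
    rw [ae_iff]; exact hμ)
  have h2 := integral_subtype_comap hΩ (μ := μ) (ext0 φ)
  rw [h1] at h2
  rw [← h2]
  simp only [ext0_apply]

lemma comap_map {Ω : Set E} (hΩ : MeasurableSet Ω) (μ : Measure E)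
    (hμ : μ Ωᶜ = 0) : (μ.comap ((↑) : Ω → E)).map (↑) = μ := by
  rw [map_comap_subtype_coe hΩ]
  exact Measure.restrict_eq_self_of_ae_mem (by rw [ae_iff]; exact hμ)

lemma comap_prob {Ω : Set E} (hΩ : MeasurableSet Ω) (μ : Measure E) [IsProbabilityMeasure μ]
    (hμ : μ Ωᶜ = 0) : IsProbabilityMeasure (μ.comap ((↑) : Ω → E)) := by
  have h := comap_map hΩ μ hμ
  constructor
  have h2 : (μ.comap ((↑) : Ω → E)).map ((↑) : Ω → E) univ = 1 := by rw [h]; exact measure_univ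
  rwa [Measure.map_apply measurable_subtype_coe MeasurableSet.univ, preimage_univ] at h2

lemma continuousOn_bdd {Ω : Set E} (hΩ : IsCompact Ω) {φ : E → ℝ} (hφ : ContinuousOn φ Ω) :
    ∃ C, ∀ x ∈ Ω, ‖φ x‖ ≤ C := hΩ.exists_bound_of_continuousOn hφ

lemma aesm_of_continuousOn {Ω : Set E} (hΩ : IsCompact Ω) {φ : E → ℝ} (hφ : ContinuousOn φ Ω)
    (μ : Measure E) (hμ : μ Ωᶜ = 0) : AEStronglyMeasurable φ μ := by
  have h1 : μ.restrict Ω = μ := Measure.restrict_eq_self_of_ae_mem (by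
    rw [ae_iff]; exact hμ)
  rw [← h1]
  exact hφ.aestronglyMeasurable_of_isCompact hΩ hΩ.measurableSet

lemma integrable_of_continuousOn {Ω : Set E} (hΩ : IsCompact Ω) {φ : E → ℝ}
    (hφ : ContinuousOn φ Ω)
    (μ : Measure E) [IsFiniteMeasure μ] (hμ : μ Ωᶜ = 0) : Integrable φ μ := by
  obtain ⟨C, hC⟩ := continuousOn_bdd hΩ hφ
  refine Integrable.of_bound (aesm_of_continuousOn hΩ hφ μ hμ) C ?_
  have : ∀ᵐ x ∂μ, x ∈ Ω := by rw [ae_iff]; exact hμ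
  filter_upwards [this] with x hx using hC x hx

variable [SecondCountableTopology E]

/-- weak duality -/
lemma weak_dual {Ω : Set E} (hΩ : IsCompact Ω) (c : E × E → ℝ) (hc : Continuous c)
    (μ ν : Measure E) [IsProbabilityMeasure μ] [IsProbabilityMeasure ν]
    (hμ : μ Ωᶜ = 0) (hν : ν Ωᶜ = 0) (p : (E → ℝ) × (E → ℝ)) (hp : p ∈ dualPairs Ω c)
    (π : Measure (E × E)) (h1 : π.map Prod.fst = μ) (h2 : π.map Prod.snd = ν) :
    ∫ x, p.1 x ∂μ + ∫ y, p.2 y ∂ν ≤ ∫ z, c z ∂π := by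
  obtain ⟨hp1, hp2, hp3⟩ := hp
  have i1 := integrable_of_continuousOn hΩ hp1 μ hμ
  have i2 := integrable_of_continuousOn hΩ hp2 ν hν
  have a1 : ∀ᵐ x ∂μ, x ∈ Ω := by rw [ae_iff]; exact hμ
  have a2 : ∀ᵐ x ∂ν, x ∈ Ω := by rw [ae_iff]; exact hν
  have hfin : IsFiniteMeasure π := by
    constructor
    have : π.map Prod.fst univ = 1 := by rw [h1]; exact measure_univ
    rw [Measure.map_apply measurable_fst MeasurableSet.univ, preimage_univ] at this
    rw [this]; exact ENNReal.one_lt_top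
  have b1 : ∀ᵐ z ∂π, z.1 ∈ Ω := by
    rw [← h1] at a1
    exact ae_of_ae_map measurable_fst.aemeasurable a1
  have b2 : ∀ᵐ z ∂π, z.2 ∈ Ω := by
    rw [← h2] at a2
    exact ae_of_ae_map measurable_snd.aemeasurable a2
  have j1 : Integrable (fun z : E × E => p.1 z.1) π := by
    rw [← h1] at i1
    exact i1.comp_measurable measurable_fst
  have j2 : Integrable (fun z : E × E => p.2 z.2) π := by
    rw [← h2] at i2
    exact i2.comp_measurable measurable_snd
  have e1 : ∫ x, p.1 x ∂μ = ∫ z, p.1 z.1 ∂π := by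
    rw [← h1] at i1 ⊢
    exact integral_map measurable_fst.aemeasurable i1.aestronglyMeasurable
  have e2 : ∫ x, p.2 x ∂ν = ∫ z, p.2 z.2 ∂π := by
    rw [← h2] at i2 ⊢
    exact integral_map measurable_snd.aemeasurable i2.aestronglyMeasurable
  have jc : Integrable c π := by
    obtain ⟨C, hC⟩ := (hΩ.prod hΩ).exists_bound_of_continuousOn hc.continuousOn
    refine Integrable.of_bound hc.aestronglyMeasurable C ?_
    filter_upwards [b1, b2] with z hz1 hz2 using hC z ⟨hz1, hz2⟩
  rw [e1, e2, ← integral_add j1 j2]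
  refine integral_mono_ae (j1.add j2) jc ?_
  filter_upwards [b1, b2] with z hz1 hz2 using hp3 z.1 hz1 z.2 hz2

lemma weak_dual_Tc {Ω : Set E} (hΩ : IsCompact Ω) (c : E × E → ℝ) (hc : Continuous c)
    (μ ν : Measure E) [IsProbabilityMeasure μ] [IsProbabilityMeasure ν]
    (hμ : μ Ωᶜ = 0) (hν : ν Ωᶜ = 0) (p : (E → ℝ) × (E → ℝ)) (hp : p ∈ dualPairs Ω c) :
    ∫ x, p.1 x ∂μ + ∫ y, p.2 y ∂ν ≤ Tc c μ ν := by
  refine le_csInf ⟨_, μ.prod ν, ?_, ?_, rfl⟩ ?_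
  · simp
  · simp
  · rintro r ⟨π, h1, h2, rfl⟩
    exact weak_dual hΩ c hc μ ν hμ hν p hp π h1 h2

lemma Tc_le {c : E × E → ℝ} (hcn : ∀ z, 0 ≤ c z) (μ ν : Measure E) (π : Measure (E × E))
    (h1 : π.map Prod.fst = μ) (h2 : π.map Prod.snd = ν) : Tc c μ ν ≤ ∫ z, c z ∂π := by
  refine csInf_le ⟨0, ?_⟩ ⟨π, h1, h2, rfl⟩
  rintro r ⟨π, -, -, rfl⟩
  exact integral_nonneg hcn

lemma continuous_integral_C {X : Type*} [MetricSpace X] [CompactSpace X] [MeasurableSpace X]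
    [BorelSpace X] (μ : Measure X) [IsProbabilityMeasure μ] :
    Continuous (fun φ : C(X, ℝ) => ∫ x, φ x ∂μ) := by
  apply LipschitzWith.continuous (K := 1)
  apply LipschitzWith.of_dist_le_mul
  intro φ ψ
  rw [Real.dist_eq, ← integral_sub (kd_integrable μ φ) (kd_integrable μ ψ)]
  have := norm_integral_le_of_norm_le_const (μ := μ) (f := fun x => φ x - ψ x) (C := dist φ ψ)
    (Eventually.of_forall fun x => ContinuousMap.dist_apply_le_dist (f := φ) (g := ψ) x)
  simpa using this

/-- Compact set of dual pairs, with attainment. -/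
lemma strong_dual {Ω : Set E} (hΩ : IsCompact Ω) (hne : Ω.Nonempty) (c : E × E → ℝ)
    (hc : Continuous c) (hcn : ∀ z, 0 ≤ c z) :
    ∃ K : Set (C(Ω, ℝ) × C(Ω, ℝ)), IsCompact K ∧
      (∀ p ∈ K, (ext0 p.1, ext0 p.2) ∈ dualPairs Ω c) ∧
      ∀ (μ ν : Measure E) [IsProbabilityMeasure μ] [IsProbabilityMeasure ν],
        μ Ωᶜ = 0 → ν Ωᶜ = 0 → ∃ p ∈ K, Tc c μ ν = ∫ x, ext0 p.1 x ∂μ + ∫ y, ext0 p.2 y ∂ν := by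
  have : CompactSpace Ω := isCompact_iff_compactSpace.1 hΩ
  have : Nonempty Ω := hne.to_subtype
  let c' : C(Ω × Ω, ℝ) := ⟨fun z => c (z.1, z.2), by fun_prop⟩
  obtain ⟨K, hK, hK1, hK2⟩ := exists_K c'
  have hKd : ∀ p ∈ K, (ext0 p.1, ext0 p.2) ∈ dualPairs Ω c := by
    intro p hp
    refine ⟨ext0_continuousOn _, ext0_continuousOn _, fun x hx y hy => ?_⟩
    have := hK1 p hp ⟨x, hx⟩ ⟨y, hy⟩
    rw [← ext0_apply, ← ext0_apply] at this
    exact this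
  refine ⟨K, hK, hKd, ?_⟩
  intro μ ν _ _ hμ hν
  have hm := hΩ.measurableSet
  let μ' := μ.comap ((↑) : Ω → E)
  let ν' := ν.comap ((↑) : Ω → E)
  have : IsProbabilityMeasure μ' := comap_prob hm μ hμ
  have : IsProbabilityMeasure ν' := comap_prob hm ν hν
  obtain ⟨π, hπ1, hπ2, hπ3⟩ := kant_dual μ' ν' c'
  let π' : Measure (E × E) := π.map (Prod.map (↑) (↑))
  have hmm : Measurable (Prod.map ((↑) : Ω → E) ((↑) : Ω → E)) :=
    measurable_subtype_coe.prodMap measurable_subtype_coe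
  have k1 : π'.map Prod.fst = μ := by
    rw [← comap_map hm μ hμ, Measure.map_map measurable_fst hmm]
    change _ = μ'.map _
    rw [← hπ1, Measure.map_map measurable_subtype_coe measurable_fst]
    rfl
  have k2 : π'.map Prod.snd = ν := by
    rw [← comap_map hm ν hν, Measure.map_map measurable_snd hmm]
    change _ = ν'.map _
    rw [← hπ2, Measure.map_map measurable_subtype_coe measurable_snd]
    rfl
  have k3 : ∫ z, c z ∂π' = ∫ z, c' z ∂π := by
    rw [integral_map hmm.aemeasurable hc.aestronglyMeasurable]
    rfl
  have hT := Tc_le hcn μ ν π' k1 k2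
  have hKne : K.Nonempty := by
    obtain ⟨p, hp, -⟩ := hK2 0 0 (fun x y => by
      change (0 : ℝ) + 0 ≤ c (x, y)
      rw [add_zero]; exact hcn _)
    exact ⟨p, hp⟩
  obtain ⟨p, hp, hmax⟩ := hK.exists_isMaxOn hKne
    (f := fun p : C(Ω, ℝ) × C(Ω, ℝ) => ∫ x, p.1 x ∂μ' + ∫ y, p.2 y ∂ν')
    (((continuous_integral_C μ').comp continuous_fst).add
      ((continuous_integral_C ν').comp continuous_snd)).continuousOn
  refine ⟨p, hp, le_antisymm ?_ (weak_dual_Tc hΩ c hc μ ν hμ hν _ (hKd p hp))⟩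
  rw [integral_ext0 hm _ μ hμ, integral_ext0 hm _ ν hν]
  apply le_of_forall_pos_le_add
  intro ε hε
  obtain ⟨φ, ψ, h1, h2⟩ := hπ3 ε hε
  obtain ⟨q, hq, a, hqa⟩ := hK2 φ ψ h1
  have h3 : ∫ x, q.1 x ∂μ' + ∫ y, q.2 y ∂ν' ≤ ∫ x, p.1 x ∂μ' + ∫ y, p.2 y ∂ν' := hmax hq
  obtain ⟨x₀⟩ := ‹Nonempty Ω›
  have h4 : ∫ x, φ x ∂μ' ≤ ∫ x, q.1 x ∂μ' + a := by
    have := integral_mono (kd_integrable μ' φ) ((kd_integrable μ' q.1).add (integrable_const a))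
      (fun x => (hqa x x₀).1)
    simp only [Pi.add_apply] at this
    rw [integral_add (kd_integrable μ' q.1) (integrable_const a)] at this
    simpa using this
  have h5 : ∫ x, ψ x ∂ν' ≤ ∫ x, q.2 x ∂ν' - a := by
    have := integral_mono (kd_integrable ν' ψ) ((kd_integrable ν' q.2).sub (integrable_const a))
      (fun x => (hqa x₀ x).2)
    simp only [Pi.sub_apply] at this
    rw [integral_sub (kd_integrable ν' q.2) (integrable_const a)] at this
    simpa using this
  change _ ≤ ∫ x, p.1 x ∂μ' + ∫ y, p.2 y ∂ν' + ε
  linarith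

end whole
section deriv
variable {E : Type*} [MetricSpace E] [MeasurableSpace E] [BorelSpace E]

lemma integral_wd {vol : Measure E} (r : E → ℝ) (hr : Integrable r vol) (h0 : ∀ x, 0 ≤ r x)
    (g : E → ℝ) : ∫ x, g x ∂(vol.withDensity fun x => ENNReal.ofReal (r x)) = ∫ x, g x * r x ∂vol := by
  rw [integral_withDensity_eq_integral_toReal_smul₀ hr.aestronglyMeasurable.aemeasurable.ennreal_ofReal
    (Eventually.of_forall fun x => ENNReal.ofReal_lt_top)]
  congr 1
  ext x
  rw [ENNReal.toReal_ofReal (h0 x), smul_eq_mul, mul_comm]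

lemma wd_prob {vol : Measure E} (r : E → ℝ) (hr : Integrable r vol) (h0 : ∀ x, 0 ≤ r x)
    (h1 : ∫ x, r x ∂vol = 1) :
    IsProbabilityMeasure (vol.withDensity fun x => ENNReal.ofReal (r x)) := by
  constructor
  rw [withDensity_apply _ MeasurableSet.univ, Measure.restrict_univ,
    ← ofReal_integral_eq_lintegral_ofReal hr (Eventually.of_forall h0), h1, ENNReal.ofReal_one]

lemma wd_supp {vol : Measure E} (r : E → ℝ) {Ω : Set E} (hΩ : MeasurableSet Ω)
    (h1 : ∀ x ∉ Ω, r x = 0) :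
    (vol.withDensity fun x => ENNReal.ofReal (r x)) Ωᶜ = 0 := by
  rw [withDensity_apply _ hΩ.compl]
  rw [setLIntegral_congr_fun hΩ.compl (g := fun _ => 0)]
  · simp
  · intro x hx
    simp [h1 x hx]

lemma ext0_bound {Ω : Set E} [CompactSpace Ω] (φ : C(Ω, ℝ)) (x : E) : ‖ext0 φ x‖ ≤ ‖φ‖ := by
  by_cases hx : x ∈ Ω
  · rw [show x = ((⟨x, hx⟩ : Ω) : E) from rfl, ext0_apply]
    exact φ.norm_coe_le_norm _
  · rw [ext0_off φ x hx]; simp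

lemma ext0_sub {Ω : Set E} (φ ψ : C(Ω, ℝ)) (x : E) : ext0 (φ - ψ) x = ext0 φ x - ext0 ψ x := by
  by_cases hx : x ∈ Ω
  · have h : ∀ θ : C(Ω, ℝ), ext0 θ x = θ ⟨x, hx⟩ := fun θ => ext0_apply θ ⟨x, hx⟩
    rw [h, h, h]; rfl
  · simp only [ext0_off _ x hx]; simp

lemma ext0_mul_integrable {vol : Measure E} {Ω : Set E} [CompactSpace Ω] (hΩ : MeasurableSet Ω)
    (φ : C(Ω, ℝ)) (w : E → ℝ) (hw : Integrable w vol) :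
    Integrable (fun x => ext0 φ x * w x) vol :=
  hw.bdd_mul (ext0_measurable hΩ φ).aestronglyMeasurable
    (Eventually.of_forall (ext0_bound φ))

lemma ext0_mul_bound {vol : Measure E} {Ω : Set E} [CompactSpace Ω]
    (φ : C(Ω, ℝ)) (w : E → ℝ) (hw : Integrable w vol) :
    ‖∫ x, ext0 φ x * w x ∂vol‖ ≤ ‖φ‖ * ∫ x, ‖w x‖ ∂vol := by
  rw [← integral_const_mul]
  apply norm_integral_le_of_norm_le (hw.norm.const_mul _)
  refine Eventually.of_forall fun x => ?_
  rw [norm_mul]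
  exact mul_le_mul_of_nonneg_right (ext0_bound φ x) (norm_nonneg _)

lemma tendsto_pairing {vol : Measure E} {Ω : Set E} [CompactSpace Ω] (hΩ : MeasurableSet Ω)
    {U : Filter ℝ} (φ : ℝ → C(Ω, ℝ)) (φ₀ : C(Ω, ℝ)) (hφ : Tendsto φ U (𝓝 φ₀))
    (w : ℝ → E → ℝ) (D : E → ℝ) (hD : Integrable D vol) (hw : ∀ᶠ t in U, Integrable (w t) vol)
    (hwD : Tendsto (fun t => ∫ x, ‖w t x - D x‖ ∂vol) U (𝓝 0)) :
    Tendsto (fun t => ∫ x, ext0 (φ t) x * w t x ∂vol) U (𝓝 (∫ x, ext0 φ₀ x * D x ∂vol)) := by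
  rw [tendsto_iff_dist_tendsto_zero]
  have hlim : Tendsto (fun t => ‖φ t‖ * (∫ x, ‖w t x - D x‖ ∂vol) +
      dist (φ t) φ₀ * ∫ x, ‖D x‖ ∂vol) U (𝓝 0) := by
    have := (hφ.norm.mul hwD).add ((tendsto_iff_dist_tendsto_zero.1 hφ).mul_const (∫ x, ‖D x‖ ∂vol))
    simpa using this
  refine squeeze_zero' (Eventually.of_forall fun _ => dist_nonneg) ?_ hlim
  filter_upwards [hw] with t ht
  have e : ∫ x, ext0 (φ t) x * w t x ∂vol - ∫ x, ext0 φ₀ x * D x ∂vol =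
      ∫ x, ext0 (φ t) x * (w t x - D x) ∂vol + ∫ x, ext0 (φ t - φ₀) x * D x ∂vol := by
    rw [← integral_sub (ext0_mul_integrable hΩ _ _ ht) (ext0_mul_integrable hΩ _ _ hD),
      ← integral_add (ext0_mul_integrable hΩ _ (fun x => w t x - D x) (ht.sub hD)) (ext0_mul_integrable hΩ _ _ hD)]
    congr 1
    ext x
    rw [ext0_sub]; ring
  rw [Real.dist_eq, e, dist_eq_norm]
  exact (norm_add_le _ _).trans (add_le_add (ext0_mul_bound _ _ (ht.sub hD))
    (ext0_mul_bound _ _ hD))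

lemma quotient_L1 {vol : Measure E} {m : ℕ} {Θ : Set (Fin m → ℝ)} (hΘ : IsOpen Θ)
    (ρ : E → (Fin m → ℝ) → ℝ)
    (hρint : ∀ θ ∈ Θ, Integrable (fun x => ρ x θ) vol)
    (η : E → ℝ) (hη : Integrable η vol)
    (hρdiff : ∀ x, ∀ θ ∈ Θ, DifferentiableAt ℝ (ρ x) θ ∧ ‖fderiv ℝ (ρ x) θ‖ ≤ η x)
    (θ₀ : Fin m → ℝ) (hθ₀ : θ₀ ∈ Θ) (Δ : Fin m → ℝ) :
    Integrable (fun x => fderiv ℝ (ρ x) θ₀ Δ) vol ∧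
    (∀ᶠ t in 𝓝[>] (0 : ℝ), Integrable (fun x => (ρ x (θ₀ + t • Δ) - ρ x θ₀) / t) vol) ∧
    Tendsto (fun t : ℝ => ∫ x, ‖(ρ x (θ₀ + t • Δ) - ρ x θ₀) / t - fderiv ℝ (ρ x) θ₀ Δ‖ ∂vol)
      (𝓝[>] 0) (𝓝 0) := by
  obtain ⟨ε, hε, hball⟩ := Metric.isOpen_iff.1 hΘ θ₀ hθ₀
  have hev : ∀ᶠ t in 𝓝[>] (0 : ℝ), θ₀ + t • Δ ∈ Metric.ball θ₀ ε := by
    have : Tendsto (fun t : ℝ => θ₀ + t • Δ) (𝓝 0) (𝓝 θ₀) := by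
      have h : Continuous (fun t : ℝ => θ₀ + t • Δ) := by fun_prop
      simpa using h.tendsto 0
    exact (this.mono_left nhdsWithin_le_nhds).eventually (Metric.ball_mem_nhds θ₀ hε)
  have hint : ∀ᶠ t in 𝓝[>] (0 : ℝ), Integrable (fun x => (ρ x (θ₀ + t • Δ) - ρ x θ₀) / t) vol := by
    filter_upwards [hev] with t ht
    exact ((hρint _ (hball ht)).sub (hρint _ hθ₀)).div_const t
  have hlim : ∀ x, Tendsto (fun t : ℝ => (ρ x (θ₀ + t • Δ) - ρ x θ₀) / t) (𝓝[>] 0)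
      (𝓝 (fderiv ℝ (ρ x) θ₀ Δ)) := by
    intro x
    have h := (hρdiff x θ₀ hθ₀).1.hasFDerivAt.hasLineDerivAt Δ
    have h2 := h.tendsto_slope_zero_right
    refine h2.congr fun t => ?_
    simp [div_eq_inv_mul]
  have hbound : ∀ᶠ t in 𝓝[>] (0 : ℝ), ∀ x, ‖(ρ x (θ₀ + t • Δ) - ρ x θ₀) / t‖ ≤ η x * ‖Δ‖ := by
    filter_upwards [hev, self_mem_nhdsWithin] with t ht ht0 x
    have ht0 : 0 < t := ht0
    have := (convex_ball θ₀ ε).norm_image_sub_le_of_norm_fderiv_le (𝕜 := ℝ) (f := ρ x) (C := η x)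
      (fun y hy => (hρdiff x y (hball hy)).1) (fun y hy => (hρdiff x y (hball hy)).2)
      (Metric.mem_ball_self hε) ht
    rw [add_sub_cancel_left, norm_smul, Real.norm_of_nonneg ht0.le] at this
    rw [norm_div, Real.norm_of_nonneg ht0.le, div_le_iff₀ ht0]
    linarith
  have hDm : AEStronglyMeasurable (fun x => fderiv ℝ (ρ x) θ₀ Δ) vol := by
    obtain ⟨u, hu⟩ := (𝓝[>] (0 : ℝ)).exists_seq_tendsto
    obtain ⟨N, hN⟩ := eventually_atTop.1 (hu.eventually hint)
    have hu' : Tendsto (fun n => u (n + N)) atTop (𝓝[>] 0) := hu.comp (tendsto_add_atTop_nat N)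
    exact aestronglyMeasurable_of_tendsto_ae atTop
      (f := fun n x => (ρ x (θ₀ + u (n + N) • Δ) - ρ x θ₀) / u (n + N))
      (fun n => (hN (n + N) (by omega)).aestronglyMeasurable)
      (Eventually.of_forall fun x => (hlim x).comp hu')
  have hDb : ∀ x, ‖fderiv ℝ (ρ x) θ₀ Δ‖ ≤ η x * ‖Δ‖ := fun x =>
    (ContinuousLinearMap.le_opNorm _ _).trans
      (mul_le_mul_of_nonneg_right (hρdiff x θ₀ hθ₀).2 (norm_nonneg _))
  have hDi : Integrable (fun x => fderiv ℝ (ρ x) θ₀ Δ) vol :=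
    (hη.mul_const ‖Δ‖).mono' hDm (Eventually.of_forall hDb)
  refine ⟨hDi, hint, ?_⟩
  have := tendsto_integral_filter_of_dominated_convergence (μ := vol) (l := 𝓝[>] (0 : ℝ))
    (F := fun t x => ‖(ρ x (θ₀ + t • Δ) - ρ x θ₀) / t - fderiv ℝ (ρ x) θ₀ Δ‖) (f := fun _ => 0)
    (fun x => 2 * (η x * ‖Δ‖)) ?_ ?_ ?_ ?_
  · simpa using this
  · filter_upwards [hint] with t ht
    exact (ht.sub hDi).norm.aestronglyMeasurable
  · filter_upwards [hbound] with t ht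
    refine Eventually.of_forall fun x => ?_
    rw [norm_norm]
    refine (norm_sub_le _ _).trans ?_
    linarith [ht x, hDb x]
  · exact (hη.mul_const ‖Δ‖).const_mul 2
  · refine Eventually.of_forall fun x => ?_
    have := ((hlim x).sub_const (fderiv ℝ (ρ x) θ₀ Δ)).norm
    simpa using this

end deriv

/-- Under A1–A3, `f(θ) = T_c(ρ(·,θ), ρ*)` is directionally
differentiable at every `θ₀ ∈ Θ`, with directional derivative
`f'(θ₀,Δθ) = sup_{(φ,φ^c) ∈ S(θ₀)} (∫_Ω φ ∇_θρ(·,θ₀)) · Δθ`, the supremum ranging over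
optimal Kantorovich potential pairs for the transport from `ρ(·,θ₀)` to `ρ*`. -/
theorem stmt10 (d m : ℕ)
    (Ω : Set (EuclideanSpace ℝ (Fin d))) (hΩ : IsCompact Ω)
    -- A1
    (Θ : Set (Fin m → ℝ)) (hΘ : IsOpen Θ)
    (ρ : EuclideanSpace ℝ (Fin d) → (Fin m → ℝ) → ℝ)
    (hρint : ∀ θ ∈ Θ, Integrable (fun x => ρ x θ))
    (hρprob : ∀ θ ∈ Θ, (∀ x, 0 ≤ ρ x θ) ∧ (∫ x, ρ x θ) = 1 ∧ ∀ x ∉ Ω, ρ x θ = 0)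
    -- A2
    (η : EuclideanSpace ℝ (Fin d) → ℝ) (hη : Integrable η)
    (hρdiff : ∀ x, ∀ θ ∈ Θ, DifferentiableAt ℝ (ρ x) θ ∧ ‖fderiv ℝ (ρ x) θ‖ ≤ η x)
    -- A3
    (c : EuclideanSpace ℝ (Fin d) × EuclideanSpace ℝ (Fin d) → ℝ)
    (hc : Continuous c) (hcnonneg : ∀ z, 0 ≤ c z)
    -- reference measure
    (ρstar : Measure (EuclideanSpace ℝ (Fin d)))
    (hρstar : IsProbabilityMeasure ρstar) (hρstarsupp : ρstar Ωᶜ = 0)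
    -- objective function
    (f : (Fin m → ℝ) → ℝ)
    (hf : ∀ θ, f θ = Tc c (volume.withDensity fun x => ENNReal.ofReal (ρ x θ)) ρstar) :
    ∀ θ₀ ∈ Θ, ∀ Δθ : Fin m → ℝ,
      Tendsto (fun t : ℝ => (f (θ₀ + t • Δθ) - f θ₀) / t) (nhdsWithin 0 (Ioi 0))
        (nhds (sSup {r : ℝ | ∃ p ∈ dualPairs Ω c,
          ((∫ x, p.1 x * ρ x θ₀) + ∫ y, p.2 y ∂ρstar) = f θ₀ ∧
          r = ∫ x, p.1 x * (fderiv ℝ (ρ x) θ₀) Δθ})) := by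
  intro θ₀ hθ₀ Δ
  have hm := hΩ.measurableSet
  have hcs : CompactSpace Ω := isCompact_iff_compactSpace.1 hΩ
  have hne : Ω.Nonempty := by
    rw [nonempty_iff_ne_empty]
    rintro rfl
    simp at hρstarsupp
  obtain ⟨hDi, hint, hL1⟩ := quotient_L1 hΘ ρ hρint η hη hρdiff θ₀ hθ₀ Δ
  obtain ⟨K, hK, hKd, hKs⟩ := strong_dual hΩ hne c hc hcnonneg
  -- value of the dual functional
  have hweak : ∀ θ ∈ Θ, ∀ p ∈ dualPairs Ω c,
      (∫ x, p.1 x * ρ x θ) + ∫ y, p.2 y ∂ρstar ≤ f θ := by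
    intro θ hθ p hp
    have := wd_prob (fun x => ρ x θ) (hρint θ hθ) (hρprob θ hθ).1 (hρprob θ hθ).2.1
    rw [hf, ← integral_wd (fun x => ρ x θ) (hρint θ hθ) (hρprob θ hθ).1]
    exact weak_dual_Tc hΩ c hc _ ρstar (wd_supp _ hm (hρprob θ hθ).2.2) hρstarsupp p hp
  have hstrong : ∀ θ, ∃ p : C(Ω, ℝ) × C(Ω, ℝ), θ ∈ Θ → p ∈ K ∧
      f θ = (∫ x, ext0 p.1 x * ρ x θ) + ∫ y, ext0 p.2 y ∂ρstar := by
    intro θ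
    by_cases hθ : θ ∈ Θ
    · have := wd_prob (fun x => ρ x θ) (hρint θ hθ) (hρprob θ hθ).1 (hρprob θ hθ).2.1
      obtain ⟨p, hp, h⟩ := hKs (volume.withDensity fun x => ENNReal.ofReal (ρ x θ)) ρstar
        (wd_supp _ hm (hρprob θ hθ).2.2) hρstarsupp
      refine ⟨p, fun _ => ⟨hp, ?_⟩⟩
      rw [hf, h, integral_wd (fun x => ρ x θ) (hρint θ hθ) (hρprob θ hθ).1]
    · exact ⟨0, fun h => absurd h hθ⟩
  choose P hP using hstrong
  have hev : ∀ᶠ t in 𝓝[>] (0 : ℝ), θ₀ + t • Δ ∈ Θ := by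
    have : Tendsto (fun t : ℝ => θ₀ + t • Δ) (𝓝 0) (𝓝 θ₀) := by
      have h : Continuous (fun t : ℝ => θ₀ + t • Δ) := by fun_prop
      simpa using h.tendsto 0
    exact (this.mono_left nhdsWithin_le_nhds).eventually (hΘ.mem_nhds hθ₀)
  have hDoff : ∀ x ∉ Ω, fderiv ℝ (ρ x) θ₀ = 0 := by
    intro x hx
    have : ρ x =ᶠ[𝓝 θ₀] fun _ => (0 : ℝ) := by
      filter_upwards [hΘ.mem_nhds hθ₀] with θ hθ using (hρprob θ hθ).2.2 x hx
    rw [this.fderiv_eq]; simp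
  rw [tendsto_iff_ultrafilter]
  intro U hU
  have hUev : ∀ᶠ t in (U : Filter ℝ), θ₀ + t • Δ ∈ Θ := hU hev
  have hUint := hint.filter_mono hU
  have hUL1 := hL1.mono_left hU
  have hUpos : ∀ᶠ t in (U : Filter ℝ), 0 < t := hU self_mem_nhdsWithin
  have hU0 : Tendsto (fun t : ℝ => t) U (𝓝 0) := tendsto_id.mono_left (hU.trans nhdsWithin_le_nhds)
  set p : ℝ → C(Ω, ℝ) × C(Ω, ℝ) := fun t => P (θ₀ + t • Δ) with hpdef
  obtain ⟨p₀, hp₀K, hp₀⟩ := hK.ultrafilter_le_nhds (U.map p) (by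
    rw [le_principal_iff]
    change ∀ᶠ t in (U : Filter ℝ), p t ∈ K
    filter_upwards [hUev] with t ht using (hP _ ht).1)
  have hp₀ : Tendsto p U (𝓝 p₀) := hp₀
  have hp1 : Tendsto (fun t => (p t).1) U (𝓝 p₀.1) := (continuous_fst.tendsto p₀).comp hp₀
  have hp2 : Tendsto (fun t => (p t).2) U (𝓝 p₀.2) := (continuous_snd.tendsto p₀).comp hp₀
  set D : EuclideanSpace ℝ (Fin d) → ℝ := fun x => fderiv ℝ (ρ x) θ₀ Δ with hD
  set w : ℝ → EuclideanSpace ℝ (Fin d) → ℝ := fun t x => (ρ x (θ₀ + t • Δ) - ρ x θ₀) / t with hw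
  have hr := tendsto_pairing hm (fun t => (p t).1) p₀.1 hp1 w D hDi hUint hUL1
  -- expansion of the dual functional
  have hexp : ∀ (φ : C(Ω, ℝ)) (t : ℝ), 0 < t → θ₀ + t • Δ ∈ Θ →
      ∫ x, ext0 φ x * ρ x (θ₀ + t • Δ) =
        (∫ x, ext0 φ x * ρ x θ₀) + t * ∫ x, ext0 φ x * w t x := by
    intro φ t ht hθ
    have hwi : Integrable (w t) := ((hρint _ hθ).sub (hρint _ hθ₀)).div_const t
    rw [← integral_const_mul, ← integral_add (ext0_mul_integrable hm φ _ (hρint _ hθ₀))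
      ((ext0_mul_integrable hm φ _ hwi).const_mul t)]
    congr 1
    ext x
    simp only [hw]
    field_simp
    ring
  -- upper bound
  have hupper : ∀ᶠ t in (U : Filter ℝ), (f (θ₀ + t • Δ) - f θ₀) / t ≤
      ∫ x, ext0 (p t).1 x * w t x := by
    filter_upwards [hUev, hUpos] with t ht ht0
    rw [div_le_iff₀ ht0, (hP _ ht).2]
    have h1 := hweak θ₀ hθ₀ _ (hKd _ (hP _ ht).1)
    have h2 := hexp (p t).1 t ht0 ht
    simp only [hpdef] at h1 h2 ⊢
    linarith
  -- lower bound
  have hlower : ∀ q ∈ dualPairs Ω c, ((∫ x, q.1 x * ρ x θ₀) + ∫ y, q.2 y ∂ρstar) = f θ₀ →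
      ∃ φ : C(Ω, ℝ), (∫ x, q.1 x * D x) = (∫ x, ext0 φ x * D x) ∧
      ∀ᶠ t in (U : Filter ℝ), ∫ x, ext0 φ x * w t x ≤ (f (θ₀ + t • Δ) - f θ₀) / t := by
    intro q hq hqo
    let φ : C(Ω, ℝ) := ⟨Ω.restrict q.1, continuousOn_iff_continuous_restrict.1 hq.1⟩
    have hφ : ∀ x ∈ Ω, ext0 φ x = q.1 x := fun x hx => ext0_apply φ ⟨x, hx⟩
    have hρφ : ∀ θ ∈ Θ, ∫ x, q.1 x * ρ x θ = ∫ x, ext0 φ x * ρ x θ := by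
      intro θ hθ
      congr 1
      ext x
      by_cases hx : x ∈ Ω
      · rw [hφ x hx]
      · rw [(hρprob θ hθ).2.2 x hx]; simp
    refine ⟨φ, ?_, ?_⟩
    · congr 1
      ext x
      by_cases hx : x ∈ Ω
      · rw [hφ x hx]
      · simp [hD, hDoff x hx]
    · filter_upwards [hUev, hUpos] with t ht ht0
      rw [le_div_iff₀ ht0]
      have h1 := hweak _ ht q hq
      rw [hρφ _ ht, hexp φ t ht0 ht] at h1
      rw [hρφ _ hθ₀] at hqo
      linarith
  -- the limit pair is optimal
  have hopt : ((∫ x, ext0 p₀.1 x * ρ x θ₀) + ∫ y, ext0 p₀.2 y ∂ρstar) = f θ₀ := by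
    apply le_antisymm (hweak θ₀ hθ₀ _ (hKd _ hp₀K))
    have l1 : Tendsto (fun t => ∫ x, ext0 (p t).1 x * ρ x θ₀) U
        (𝓝 (∫ x, ext0 p₀.1 x * ρ x θ₀)) :=
      tendsto_pairing hm (fun t => (p t).1) p₀.1 hp1 (fun _ x => ρ x θ₀) (fun x => ρ x θ₀)
        (hρint _ hθ₀) (Eventually.of_forall fun _ => hρint _ hθ₀) (by simp)
    have l2 : Tendsto (fun t => ∫ y, ext0 (p t).2 y ∂ρstar) U
        (𝓝 (∫ y, ext0 p₀.2 y ∂ρstar)) := by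
      have := tendsto_pairing hm (vol := ρstar) (fun t => (p t).2) p₀.2 hp2 (fun _ _ => 1)
        (fun _ => 1) (integrable_const _) (Eventually.of_forall fun _ => integrable_const _)
        (by simp)
      simpa using this
    have l3 := (l1.add (hU0.mul hr)).add l2
    rw [zero_mul, add_zero] at l3
    -- lower bound through a fixed optimal pair
    obtain ⟨hPK, hPo⟩ := hP θ₀ hθ₀
    have l4 := tendsto_pairing hm (fun _ => (P θ₀).1) (P θ₀).1 tendsto_const_nhds w D hDi hUint hUL1
    have l5 := (hU0.mul l4).const_add (f θ₀)
    rw [zero_mul, add_zero] at l5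
    refine le_of_tendsto_of_tendsto l5 l3 ?_
    filter_upwards [hUev, hUpos] with t ht ht0
    have h1 := hweak _ ht _ (hKd _ hPK)
    have h2 := hexp (P θ₀).1 t ht0 ht
    have h3 := hexp (p t).1 t ht0 ht
    have h4 := (hP _ ht).2
    simp only [hpdef] at h1 h2 h3 h4 ⊢
    linarith
  have hgreat : IsGreatest {r : ℝ | ∃ p ∈ dualPairs Ω c,
          ((∫ x, p.1 x * ρ x θ₀) + ∫ y, p.2 y ∂ρstar) = f θ₀ ∧
          r = ∫ x, p.1 x * (fderiv ℝ (ρ x) θ₀) Δ} (∫ x, ext0 p₀.1 x * D x) := by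
    refine ⟨⟨_, hKd _ hp₀K, hopt, rfl⟩, ?_⟩
    rintro r ⟨q, hq, hqo, rfl⟩
    obtain ⟨φ, h1, h2⟩ := hlower q hq hqo
    have l4 := tendsto_pairing hm (fun _ => φ) φ tendsto_const_nhds w D hDi hUint hUL1
    change ∫ x, q.1 x * D x ≤ _
    rw [h1]
    refine le_of_tendsto_of_tendsto l4 hr ?_
    filter_upwards [h2, hupper] with t h3 h4 using h3.trans h4
  rw [hgreat.csSup_eq]
  obtain ⟨φ, h1, h2⟩ := hlower _ (hKd _ hp₀K) hopt
  have l4 := tendsto_pairing hm (fun _ => φ) φ tendsto_const_nhds w D hDi hUint hUL1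
  rw [← h1] at l4
  exact tendsto_of_tendsto_of_tendsto_of_le_of_le' l4 hr h2 hupper
end

section
/- Under assumptions A1–A3, f(θ) = T_c(ρ(·,θ), ρ*) is Gâteaux differentiable at θ₀ if and only if ∫_Ω φ₁ ∇_θ ρ(·,θ₀) dx = ∫_Ω φ₂ ∇_θ ρ(·,θ₀) dx for all optimal potential pairs (φ₁,φ₁^c), (φ₂,φ₂^c) ∈ S(θ₀); in that case ∇f(θ₀) = ∫_Ω φ(x) ∇_θ ρ(x,θ₀) dx for an arbitrary pair of Kantorovich potentials (φ,ψ) ∈ Φ_c(ρ(·,θ₀), ρ*). -/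
open MeasureTheory Set Filter

/-- Hahn-Banach: a sublinear function is touched at any point by a dominated linear form. -/
lemma ot_hb {E : Type*} [AddCommGroup E] [Module ℝ E] (N : E → ℝ)
    (Nh : ∀ c : ℝ, 0 < c → ∀ x, N (c • x) = c * N x) (Na : ∀ x y, N (x + y) ≤ N x + N y)
    (x₀ : E) : ∃ L : E →ₗ[ℝ] ℝ, (∀ x, L x ≤ N x) ∧ L x₀ = N x₀ := by
  have N0 : N 0 = 0 := by
    have := Nh 2 (by norm_num) 0
    rw [smul_zero] at this; linarith
  have H : ∀ a : ℝ, a • x₀ = 0 → (RingHom.id ℝ a) • (N x₀) = 0 := by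
    intro a ha
    rcases smul_eq_zero.1 ha with h | h
    · simp [h]
    · simp [h, N0]
  obtain ⟨L, h1, h2⟩ := exists_extension_of_le_sublinear
    (LinearPMap.mkSpanSingleton' (σ := RingHom.id ℝ) x₀ (N x₀) H) N Nh Na (by
      rintro ⟨x, hx⟩
      obtain ⟨a, rfl⟩ := Submodule.mem_span_singleton.1 hx
      rw [LinearPMap.mkSpanSingleton'_apply]
      simp only [RingHom.id_apply, smul_eq_mul]
      rcases lt_trichotomy a 0 with h | h | h
      · have e1 := Nh (-a) (by linarith) x₀
        have e2 := Na (a • x₀) ((-a) • x₀)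
        rw [← add_smul, add_neg_cancel, zero_smul, N0, e1] at e2
        linarith
      · simp [h, N0]
      · rw [Nh a h])
  refine ⟨L, h2, ?_⟩
  have := h1 ⟨x₀, Submodule.mem_span_singleton_self x₀⟩
  exact this.trans (LinearPMap.mkSpanSingleton'_apply_self x₀ (N x₀) H _)

/-- Riesz representation on a compact space. -/
lemma ot_riesz {Y : Type*} [TopologicalSpace Y] [CompactSpace Y] [T2Space Y] [MeasurableSpace Y]
    [BorelSpace Y] (L : C(Y, ℝ) →ₗ[ℝ] ℝ) (hL : ∀ h : C(Y, ℝ), (∀ y, 0 ≤ h y) → 0 ≤ L h) :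
    ∃ π : Measure Y, IsFiniteMeasure π ∧ ∀ h : C(Y, ℝ), ∫ y, h y ∂π = L h := by
  let T : CompactlySupportedContinuousMap Y ℝ →ₗ[ℝ] ℝ :=
    { toFun := fun g => L (g.toContinuousMap)
      map_add' := fun a b => by rw [← map_add]; rfl
      map_smul' := fun a b => by rw [← map_smul]; rfl }
  let Λ := PositiveLinearMap.mk₀ T (fun g hg => hL _ (fun y => CompactlySupportedContinuousMap.le_def.1 hg y))
  refine ⟨RealRMK.rieszMeasure Λ, inferInstance, fun h => ?_⟩
  let g : CompactlySupportedContinuousMap Y ℝ :=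
    { toFun := h
      hasCompactSupport' := HasCompactSupport.of_compactSpace _ }
  exact RealRMK.integral_rieszMeasure Λ g

/-- Superhedging functional. -/
def otSet {K : Type*} [TopologicalSpace K] [MeasurableSpace K] (μ ν : Measure K)
    (h : C(K × K, ℝ)) : Set ℝ :=
  {r | ∃ φ ψ : C(K, ℝ), (∀ x y, h (x, y) ≤ φ x + ψ y) ∧ r = ∫ x, φ x ∂μ + ∫ y, ψ y ∂ν}

lemma ot_integrable {K : Type*} [TopologicalSpace K] [CompactSpace K] [MeasurableSpace K]
    [BorelSpace K] (μ : Measure K) [IsFiniteMeasure μ] (φ : C(K, ℝ)) :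
    Integrable (fun x => φ x) μ :=
  φ.continuous.integrable_of_hasCompactSupport (HasCompactSupport.of_compactSpace _)

/-- Kantorovich duality on a compact metric space. -/
lemma ot_duality {K : Type*} [MetricSpace K] [CompactSpace K] [MeasurableSpace K]
    [BorelSpace K] (μ ν : Measure K) [IsProbabilityMeasure μ] [IsProbabilityMeasure ν]
    (c : C(K × K, ℝ)) :
    ∃ π : Measure (K × K), π.map Prod.fst = μ ∧ π.map Prod.snd = ν ∧
      ∀ ε > 0, ∃ φ ψ : C(K, ℝ), (∀ x y, φ x + ψ y ≤ c (x, y)) ∧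
        ∫ z, c z ∂π ≤ ∫ x, φ x ∂μ + ∫ y, ψ y ∂ν + ε := by
  have hμ := ot_integrable μ
  have hν := ot_integrable ν
  have lower : ∀ h : C(K × K, ℝ), ∀ b : ℝ, (∀ z, b ≤ h z) → ∀ r ∈ otSet μ ν h, b ≤ r := by
    rintro h b hb r ⟨φ, ψ, h1, rfl⟩
    have key : ∀ x, ∀ y, b ≤ φ x + ψ y := fun x y => (hb _).trans (h1 x y)
    have k2 : ∀ x, b ≤ φ x + ∫ y, ψ y ∂ν := by
      intro x
      have := integral_mono (μ := ν) (integrable_const (b - φ x)) (hν ψ)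
        (fun y => by show b - φ x ≤ ψ y; linarith [key x y])
      simp at this; linarith
    have := integral_mono (μ := μ) (integrable_const (b - ∫ y, ψ y ∂ν)) (hμ φ)
        (fun y => by show b - _ ≤ φ y; linarith [k2 y])
    simp at this; linarith
  have ne : ∀ h, (otSet μ ν h).Nonempty := by
    intro h
    refine ⟨_, ContinuousMap.const K ‖h‖, 0, fun x y => ?_, rfl⟩
    simpa using (le_abs_self _).trans (h.norm_coe_le_norm (x, y))
  have bdd : ∀ h, BddBelow (otSet μ ν h) := fun h =>
    ⟨-‖h‖, fun r hr => lower h (-‖h‖)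
      (fun z => (abs_le.1 (h.norm_coe_le_norm z)).1) r hr⟩
  let N : C(K × K, ℝ) → ℝ := fun h => sInf (otSet μ ν h)
  have Na : ∀ x y, N (x + y) ≤ N x + N y := by
    intro x y
    refine le_of_forall_pos_le_add fun ε hε => ?_
    obtain ⟨r, ⟨φ, ψ, h1, rfl⟩, h2⟩ := exists_lt_of_csInf_lt (ne x)
      (show sInf (otSet μ ν x) < N x + ε / 2 by show N x < _; linarith)
    obtain ⟨r, ⟨φ', ψ', h1', rfl⟩, h2'⟩ := exists_lt_of_csInf_lt (ne y)
      (show sInf (otSet μ ν y) < N y + ε / 2 by show N y < _; linarith)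
    have : N (x + y) ≤ _ := csInf_le (bdd (x + y)) ⟨φ + φ', ψ + ψ', fun a b => by
      have := h1 a b; have := h1' a b; simp only [ContinuousMap.add_apply]; linarith, rfl⟩
    simp only [ContinuousMap.add_apply] at this
    rw [integral_add (hμ φ) (hμ φ'), integral_add (hν ψ) (hν ψ')] at this
    linarith
  have Nle : ∀ a : ℝ, 0 < a → ∀ x, N (a • x) ≤ a * N x := by
    intro a ha x
    rw [← div_le_iff₀' ha]
    refine le_csInf (ne x) ?_
    rintro r ⟨φ, ψ, h1, rfl⟩
    rw [div_le_iff₀' ha]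
    refine csInf_le (bdd _) ⟨a • φ, a • ψ, fun u v => ?_, ?_⟩
    · simp only [ContinuousMap.smul_apply, smul_eq_mul]
      have := mul_le_mul_of_nonneg_left (h1 u v) ha.le
      linarith
    · simp only [ContinuousMap.smul_apply, smul_eq_mul, integral_const_mul]; ring
  have Nh : ∀ a : ℝ, 0 < a → ∀ x, N (a • x) = a * N x := by
    intro a ha x
    refine le_antisymm (Nle a ha x) ?_
    have := Nle a⁻¹ (inv_pos.2 ha) (a • x)
    rw [smul_smul, inv_mul_cancel₀ ha.ne', one_smul] at this
    calc a * N x ≤ a * (a⁻¹ * N (a • x)) := mul_le_mul_of_nonneg_left this ha.le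
      _ = N (a • x) := by field_simp
  obtain ⟨L, hL, hLc⟩ := ot_hb N Nh Na (-c)
  have hpos : ∀ h : C(K × K, ℝ), (∀ y, 0 ≤ h y) → 0 ≤ L h := by
    intro h hh
    have h1 := hL (-h)
    have h2 : N (-h) ≤ 0 := csInf_le (bdd _) ⟨0, 0, fun x y => by simpa using hh (x, y), by simp⟩
    rw [map_neg] at h1; linarith
  obtain ⟨π, hπ, hint⟩ := ot_riesz L hpos
  have Lle : ∀ φ ψ : C(K, ℝ), ∀ h : C(K × K, ℝ), (∀ x y, h (x, y) = φ x + ψ y) →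
      L h ≤ ∫ x, φ x ∂μ + ∫ y, ψ y ∂ν := fun φ ψ h hh =>
    (hL h).trans (csInf_le (bdd _) ⟨φ, ψ, fun x y => (hh x y).le, rfl⟩)
  have Leq : ∀ φ ψ : C(K, ℝ), ∀ h : C(K × K, ℝ), (∀ x y, h (x, y) = φ x + ψ y) →
      L h = ∫ x, φ x ∂μ + ∫ y, ψ y ∂ν := by
    intro φ ψ h hh
    refine le_antisymm (Lle φ ψ h hh) ?_
    have := Lle (-φ) (-ψ) (-h) (fun x y => by
      simp only [ContinuousMap.neg_apply, hh]; ring)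
    simp only [ContinuousMap.neg_apply, integral_neg, map_neg] at this
    linarith
  refine ⟨π, ?_, ?_, ?_⟩
  · refine ext_of_forall_integral_eq_of_IsFiniteMeasure fun g => ?_
    rw [integral_map (by fun_prop) (by fun_prop)]
    have := hint (g.toContinuousMap.comp ⟨Prod.fst, continuous_fst⟩)
    rw [Leq g.toContinuousMap 0 _ (fun x y => by simp)] at this
    simpa using this
  · refine ext_of_forall_integral_eq_of_IsFiniteMeasure fun g => ?_
    rw [integral_map (by fun_prop) (by fun_prop)]
    have := hint (g.toContinuousMap.comp ⟨Prod.snd, continuous_snd⟩)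
    rw [Leq 0 g.toContinuousMap _ (fun x y => by simp)] at this
    simpa using this
  · intro ε hε
    obtain ⟨r, ⟨φ, ψ, h1, rfl⟩, h2⟩ := exists_lt_of_csInf_lt (ne (-c))
      (show sInf (otSet μ ν (-c)) < N (-c) + ε by show N (-c) < _; linarith)
    refine ⟨-φ, -ψ, fun x y => ?_, ?_⟩
    · have := h1 x y
      simp only [ContinuousMap.neg_apply] at *; linarith
    · rw [hint c]
      rw [map_neg] at hLc
      simp only [ContinuousMap.neg_apply, integral_neg]
      linarith

/-- The c-transform. -/
lemma ot_ctrans {K : Type*} [TopologicalSpace K] [CompactSpace K] [Nonempty K]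
    (c : C(K × K, ℝ)) (ψ : C(K, ℝ)) :
    ∃ φ : C(K, ℝ), (∀ x x', |φ x - φ x'| ≤ dist (c.curry x) (c.curry x')) ∧
      (∀ x y, φ x + ψ y ≤ c (x, y)) ∧
      (∀ x a, (∀ y, a + ψ y ≤ c (x, y)) → a ≤ φ x) := by
  let φ : K → ℝ := fun x => ⨅ y, (c (x, y) - ψ y)
  have bdd : ∀ x, BddBelow (range fun y => c (x, y) - ψ y) := fun x =>
    (isCompact_range (by fun_prop)).bddBelow
  have h2 : ∀ x y, φ x + ψ y ≤ c (x, y) := fun x y => by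
    have := ciInf_le (bdd x) y
    simp only [φ]; linarith
  have h3 : ∀ x a, (∀ y, a + ψ y ≤ c (x, y)) → a ≤ φ x := fun x a h =>
    le_ciInf fun y => by linarith [h y]
  have hle : ∀ x x', φ x - dist (c.curry x) (c.curry x') ≤ φ x' := by
    intro x x'
    refine h3 _ _ fun y => ?_
    have e := ContinuousMap.dist_apply_le_dist (f := c.curry x) (g := c.curry x') y
    rw [Real.dist_eq] at e
    have e2 := (abs_le.1 e).2
    simp only [ContinuousMap.curry_apply] at e2
    linarith [h2 x y]
  have h1 : ∀ x x', |φ x - φ x'| ≤ dist (c.curry x) (c.curry x') := by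
    intro x x'
    rw [abs_le]
    have a := hle x x'
    have b := hle x' x
    rw [dist_comm] at b
    constructor <;> linarith
  have hcont : Continuous φ := by
    rw [continuous_iff_continuousAt]
    intro x
    rw [ContinuousAt, tendsto_iff_dist_tendsto_zero]
    refine squeeze_zero (fun _ => dist_nonneg) (fun y => h1 y x) ?_
    have := (c.curry.continuous.dist (continuous_const (y := c.curry x))).tendsto x
    simpa using this
  exact ⟨⟨φ, hcont⟩, h1, h2, h3⟩

/-- Equicontinuous bounded families are compact. -/
lemma ot_ascoli {K : Type*} [TopologicalSpace K] [CompactSpace K] {E : Type*}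
    [PseudoMetricSpace E] (C : C(K, E)) (M : ℝ) :
    IsCompact {φ : C(K, ℝ) | (∀ x x', |φ x - φ x'| ≤ dist (C x) (C x')) ∧ ∀ x, |φ x| ≤ M} := by
  refine ArzelaAscoli.isCompact_of_equicontinuous _ ?_ ?_
  · have : (ContinuousMap.toFun '' {φ : C(K, ℝ) | (∀ x x', |φ x - φ x'| ≤ dist (C x) (C x')) ∧
        ∀ x, |φ x| ≤ M}) =
        {φ : K → ℝ | (∀ x x', |φ x - φ x'| ≤ dist (C x) (C x')) ∧ ∀ x, |φ x| ≤ M} := by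
      ext φ
      constructor
      · rintro ⟨g, hg, rfl⟩; exact hg
      · intro h
        refine ⟨⟨φ, ?_⟩, h, rfl⟩
        rw [continuous_iff_continuousAt]
        intro x
        rw [ContinuousAt, tendsto_iff_dist_tendsto_zero]
        refine squeeze_zero (fun _ => dist_nonneg) (fun y => h.1 y x) ?_
        have := (C.continuous.dist (continuous_const (y := C x))).tendsto x
        simpa using this
    rw [this]
    refine IsCompact.of_isClosed_subset (isCompact_univ_pi fun _ : K => isCompact_Icc (a := -M) (b := M)) ?_ ?_
    · simp only [ofPred_and, ofPred_forall]
      refine IsClosed.inter (isClosed_iInter fun x => isClosed_iInter fun x' => ?_)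
        (isClosed_iInter fun x => ?_)
      · exact isClosed_le (by fun_prop) (by fun_prop)
      · exact isClosed_le (by fun_prop) (by fun_prop)
    · intro φ h x _
      exact abs_le.1 (h.2 x)
  · intro x
    rw [Metric.equicontinuousAt_iff_right]
    intro ε hε
    have := (C.continuous.dist (continuous_const (y := C x))).tendsto x
    rw [dist_self] at this
    filter_upwards [this.eventually (gt_mem_nhds hε)] with y hy i
    refine lt_of_le_of_lt ?_ hy
    rw [dist_comm]
    exact i.2.1 y x

/-- The compact set of normalized potentials. -/
def otA {K : Type*} [TopologicalSpace K] [CompactSpace K] (c : C(K × K, ℝ)) :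
    Set (C(K, ℝ) × C(K, ℝ)) :=
  ({φ : C(K, ℝ) | (∀ x x', |φ x - φ x'| ≤ dist (c.curry x) (c.curry x')) ∧
      ∀ x, |φ x| ≤ 3 * ‖c‖} ×ˢ
    {ψ : C(K, ℝ) | (∀ x x', |ψ x - ψ x'| ≤ dist ((c.comp ContinuousMap.prodSwap).curry x)
      ((c.comp ContinuousMap.prodSwap).curry x')) ∧ ∀ x, |ψ x| ≤ 3 * ‖c‖}) ∩
  {p | ∀ x y, p.1 x + p.2 y ≤ c (x, y)}

lemma otA_compact {K : Type*} [TopologicalSpace K] [CompactSpace K] (c : C(K × K, ℝ)) :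
    IsCompact (otA c) := by
  refine ((ot_ascoli _ _).prod (ot_ascoli _ _)).inter_right ?_
  simp only [ofPred_forall]
  refine isClosed_iInter fun x => isClosed_iInter fun y => isClosed_le ?_ continuous_const
  exact ((continuous_eval_const x).comp continuous_fst).add
    ((continuous_eval_const y).comp continuous_snd)

lemma otA_improve {K : Type*} [TopologicalSpace K] [CompactSpace K] [Nonempty K]
    [MeasurableSpace K] [BorelSpace K] (c : C(K × K, ℝ)) (φ ψ : C(K, ℝ))
    (h : ∀ x y, φ x + ψ y ≤ c (x, y)) (μ ν : Measure K)
    [IsProbabilityMeasure μ] [IsProbabilityMeasure ν] :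
    ∃ p ∈ otA c, ∫ x, φ x ∂μ + ∫ y, ψ y ∂ν ≤ ∫ x, p.1 x ∂μ + ∫ y, p.2 y ∂ν := by
  obtain ⟨φ₁, a1, a2, a3⟩ := ot_ctrans c ψ
  obtain ⟨x₀⟩ := ‹Nonempty K›
  let φ₂ : C(K, ℝ) := φ₁ - ContinuousMap.const K (φ₁ x₀)
  have e₂ : ∀ x, φ₂ x = φ₁ x - φ₁ x₀ := fun x => rfl
  have : Nonempty K := ⟨x₀⟩
  obtain ⟨ψ₂, b1, b2, b3⟩ := ot_ctrans (c.comp ContinuousMap.prodSwap) φ₂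
  have hc : ∀ z, |c z| ≤ ‖c‖ := fun z => c.norm_coe_le_norm z
  have b2' : ∀ x y, φ₂ x + ψ₂ y ≤ c (x, y) := fun x y => by
    have := b2 y x
    simp only [ContinuousMap.comp_apply, ContinuousMap.prodSwap_apply] at this
    linarith
  have b3' : ∀ y a, (∀ x, a + φ₂ x ≤ c (x, y)) → a ≤ ψ₂ y := fun y a h => b3 y a h
  have bφ : ∀ x, |φ₂ x| ≤ 2 * ‖c‖ := by
    intro x
    rw [e₂]
    refine (a1 x x₀).trans ?_
    rw [ContinuousMap.dist_le (by positivity)]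
    intro y
    rw [Real.dist_eq]
    simp only [ContinuousMap.curry_apply]
    refine (abs_sub _ _).trans ?_
    linarith [hc (x, y), hc (x₀, y)]
  have nn : 0 ≤ ‖c‖ := norm_nonneg c
  refine ⟨(φ₂, ψ₂), ⟨⟨⟨fun x x' => ?_, fun x => (bφ x).trans (by linarith)⟩, b1, fun y => ?_⟩, b2'⟩, ?_⟩
  · show |φ₂ x - φ₂ x'| ≤ _
    rw [e₂, e₂, sub_sub_sub_cancel_right]; exact a1 x x'
  · show |ψ₂ y| ≤ _
    rw [abs_le]
    constructor
    · refine b3' y _ fun x => ?_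
      have := (abs_le.1 (bφ x)).2
      have := (abs_le.1 (hc (x, y))).1
      linarith
    · have := b2' x₀ y
      rw [e₂, sub_self] at this
      have := (abs_le.1 (hc (x₀, y))).2
      linarith
  · have i1 : ∫ x, φ x ∂μ - φ₁ x₀ ≤ ∫ x, φ₂ x ∂μ := by
      have := integral_mono (μ := μ) ((ot_integrable μ φ).sub (integrable_const (φ₁ x₀)))
        (ot_integrable μ φ₂) (fun x => by
          show φ x - φ₁ x₀ ≤ φ₂ x
          rw [e₂]; linarith [a3 x (φ x) (h x)])
      rw [integral_sub' (ot_integrable μ φ) (integrable_const _)] at this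
      simpa using this
    have i2 : ∫ x, ψ x ∂ν + φ₁ x₀ ≤ ∫ x, ψ₂ x ∂ν := by
      have := integral_mono (μ := ν) ((ot_integrable ν ψ).add (integrable_const (φ₁ x₀)))
        (ot_integrable ν ψ₂) (fun y => by
          show ψ y + φ₁ x₀ ≤ ψ₂ y
          refine b3' y _ fun x => ?_
          rw [e₂]; linarith [a2 x y])
      rw [integral_add' (ot_integrable ν ψ) (integrable_const _)] at this
      simpa using this
    show _ ≤ ∫ x, φ₂ x ∂μ + ∫ x, ψ₂ x ∂ν
    linarith

lemma ot_cont {K : Type*} [TopologicalSpace K] [CompactSpace K]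
    [MeasurableSpace K] [BorelSpace K] (μ : Measure K) [IsFiniteMeasure μ] :
    Continuous fun φ : C(K, ℝ) => ∫ x, φ x ∂μ := by
  refine LipschitzWith.continuous (K := ⟨μ.real univ, measureReal_nonneg⟩) ?_
  refine LipschitzWith.of_dist_le_mul fun φ ψ => ?_
  rw [dist_eq_norm, ← integral_sub (ot_integrable μ φ) (ot_integrable μ ψ)]
  refine (norm_integral_le_of_norm_le_const (C := dist φ ψ) (ae_of_all _ fun x => ?_)).trans
    (by rw [mul_comm]; rfl)
  rw [← dist_eq_norm]; exact ContinuousMap.dist_apply_le_dist x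

/-- Attainment in the dual problem by normalized potentials. -/
lemma ot_attain {K : Type*} [MetricSpace K] [CompactSpace K] [Nonempty K] [MeasurableSpace K]
    [BorelSpace K] (μ ν : Measure K) [IsProbabilityMeasure μ] [IsProbabilityMeasure ν]
    (c : C(K × K, ℝ)) :
    ∃ π : Measure (K × K), π.map Prod.fst = μ ∧ π.map Prod.snd = ν ∧
      ∃ p ∈ otA c, ∫ z, c z ∂π ≤ ∫ x, p.1 x ∂μ + ∫ y, p.2 y ∂ν := by
  obtain ⟨π, h1, h2, h3⟩ := ot_duality μ ν c
  refine ⟨π, h1, h2, ?_⟩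
  have ne : (otA c).Nonempty := by
    obtain ⟨φ, ψ, h, -⟩ := h3 1 one_pos
    obtain ⟨p, hp, -⟩ := otA_improve c φ ψ h μ ν
    exact ⟨p, hp⟩
  obtain ⟨p, hp, hmax⟩ := (otA_compact c).exists_isMaxOn ne
    (f := fun p => ∫ x, p.1 x ∂μ + ∫ y, p.2 y ∂ν)
    (((ot_cont μ).comp continuous_fst).add ((ot_cont ν).comp continuous_snd)).continuousOn
  refine ⟨p, hp, le_of_forall_pos_le_add fun ε hε => ?_⟩
  obtain ⟨φ, ψ, h, hh⟩ := h3 ε hε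
  obtain ⟨q, hq, hqq⟩ := otA_improve c φ ψ h μ ν
  have := hmax hq
  simp only [mem_ofPred_eq] at this
  linarith

/-- An abstract Danskin theorem. -/
lemma ot_danskin {P : Type*} [TopologicalSpace P] (A : Set P) (hA : IsCompact A) (J₀ l : P → ℝ)
    (hJ₀ : Continuous J₀) (hl : Continuous l) (J : ℝ → P → ℝ) (F e : ℝ → ℝ) (f₀ M L : ℝ)
    (h1 : ∀ᶠ t in nhdsWithin (0 : ℝ) (Ioi 0), ∀ p ∈ A, |J t p - J₀ p - t * l p| ≤ t * (M * e t))
    (h2 : ∀ᶠ t in nhdsWithin (0 : ℝ) (Ioi 0), ∃ p ∈ A, F t ≤ J t p)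
    (h3 : ∀ᶠ t in nhdsWithin (0 : ℝ) (Ioi 0), ∀ p ∈ A, J t p ≤ F t)
    (h4 : ∀ p ∈ A, J₀ p ≤ f₀) (h5 : ∃ q ∈ A, J₀ q = f₀)
    (h6 : ∀ p ∈ A, J₀ p = f₀ → l p = L)
    (he : Tendsto e (nhdsWithin (0 : ℝ) (Ioi 0)) (nhds 0)) :
    Tendsto (fun t => (F t - f₀) / t) (nhdsWithin (0 : ℝ) (Ioi 0)) (nhds L) := by
  obtain ⟨q, hq, hq0⟩ := h5
  have hqL := h6 q hq hq0
  have ht : Tendsto (fun t : ℝ => t) (nhdsWithin (0 : ℝ) (Ioi 0)) (nhds 0) :=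
    tendsto_id.mono_left nhdsWithin_le_nhds
  have hpos : ∀ᶠ t in nhdsWithin (0 : ℝ) (Ioi 0), (0 : ℝ) < t := self_mem_nhdsWithin
  have hMe : Tendsto (fun t => M * e t) (nhdsWithin (0 : ℝ) (Ioi 0)) (nhds 0) := by
    simpa using he.const_mul M
  have low : ∀ᶠ t in nhdsWithin (0 : ℝ) (Ioi 0), f₀ + t * L - t * (M * e t) ≤ F t := by
    filter_upwards [h1, h3] with t a b
    have a' := (abs_le.1 (a q hq)).1
    have b' := b q hq
    rw [hq0, hqL] at a'
    linarith
  rw [Metric.tendsto_nhds]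
  intro ε hε
  have hG : ∃ δ > 0, ∀ p ∈ A ∩ l ⁻¹' (Ici (L + ε / 2)), J₀ p ≤ f₀ - δ := by
    rcases (A ∩ l ⁻¹' (Ici (L + ε / 2))).eq_empty_or_nonempty with h | h
    · exact ⟨1, one_pos, by rw [h]; simp⟩
    · obtain ⟨p, hp, hmax⟩ := (hA.inter_right (isClosed_Ici.preimage hl)).exists_isMaxOn h
        hJ₀.continuousOn
      refine ⟨f₀ - J₀ p, ?_, fun p' hp' => ?_⟩
      · have := lt_of_le_of_ne (h4 p hp.1) (fun hh => by
          have e1 := h6 p hp.1 hh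
          have e2 : L + ε / 2 ≤ l p := hp.2
          linarith)
        linarith
      · have := hmax hp'
        simp only [mem_ofPred_eq] at this
        linarith
  obtain ⟨δ, hδ, hG⟩ := hG
  obtain ⟨B, hB⟩ := (hA.image hl).bddAbove
  have lim : Tendsto (fun t => t * B + t * (M * e t) - t * L + t * (M * e t))
      (nhdsWithin (0 : ℝ) (Ioi 0)) (nhds 0) := by
    have := (((ht.mul_const B).add (ht.mul hMe)).sub (ht.mul_const L)).add (ht.mul hMe)
    simpa using this
  filter_upwards [h1, h2, low, hpos, lim.eventually (gt_mem_nhds hδ),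
    hMe.eventually (gt_mem_nhds (half_pos hε))] with t a1 ⟨p, hp, a2⟩ a3 a4 a5 a6
  have b := (abs_le.1 (a1 p hp)).2
  have hlp : l p < L + ε / 2 := by
    by_contra hcon
    push Not at hcon
    have := hG p ⟨hp, hcon⟩
    have b2 : t * l p ≤ t * B := mul_le_mul_of_nonneg_left (hB ⟨p, hp, rfl⟩) a4.le
    linarith
  have hf := h4 p hp
  have up : F t - f₀ < t * (L + ε) := by
    have : t * l p < t * (L + ε / 2) := mul_lt_mul_of_pos_left hlp a4
    have : t * (M * e t) < t * (ε / 2) := mul_lt_mul_of_pos_left a6 a4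
    nlinarith
  have dn : t * (L - ε) < F t - f₀ := by
    have : t * (M * e t) < t * ε := mul_lt_mul_of_pos_left (by linarith) a4
    nlinarith
  rw [Real.dist_eq, abs_lt]
  constructor
  · have : L - ε < (F t - f₀) / t := by rw [lt_div_iff₀' a4]; exact dn
    linarith
  · have : (F t - f₀) / t < L + ε := by rw [div_lt_iff₀' a4]; exact up
    linarith

/-- Extension by zero. -/
noncomputable def otExt {X : Type*} [TopologicalSpace X] {Ω : Set X} (φ : C(Ω, ℝ)) : X → ℝ :=
  Function.extend Subtype.val φ 0

lemma otExt_apply {X : Type*} [TopologicalSpace X] {Ω : Set X} (φ : C(Ω, ℝ)) (x : Ω) :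
    otExt φ x = φ x := Subtype.val_injective.extend_apply _ _ _

lemma otExt_contOn {X : Type*} [TopologicalSpace X] {Ω : Set X} (φ : C(Ω, ℝ)) :
    ContinuousOn (otExt φ) Ω := by
  rw [continuousOn_iff_continuous_domRestrict]
  convert φ.continuous using 1
  ext x
  exact otExt_apply φ x

section duality
variable {X : Type*} [MetricSpace X] [SecondCountableTopology X] [MeasurableSpace X] [BorelSpace X]

lemma ot_restrict {Y : Type*} [MeasurableSpace Y] {Ω : Set Y} {μ : Measure Y} (h : μ Ωᶜ = 0) :
    μ.restrict Ω = μ :=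
  Measure.restrict_eq_self_of_ae_mem (by rw [ae_iff]; exact h)

lemma ot_intOn {Ω : Set X} (hΩ : IsCompact Ω) {μ : Measure X} [IsFiniteMeasure μ]
    (h : μ Ωᶜ = 0) {φ : X → ℝ} (hφ : ContinuousOn φ Ω) : Integrable φ μ := by
  have := hφ.integrableOn_compact (μ := μ) hΩ
  rwa [IntegrableOn, ot_restrict h] at this

lemma ot_integral_comap {Ω : Set X} (hΩ : IsCompact Ω) {μ : Measure X}
    (h : μ Ωᶜ = 0) (φ : C(Ω, ℝ)) :
    ∫ x, φ x ∂(μ.comap Subtype.val) = ∫ x, otExt φ x ∂μ := by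
  have := integral_subtype_comap (μ := μ) hΩ.measurableSet (otExt φ)
  rw [ot_restrict h] at this
  rw [← this]
  exact integral_congr_ae (ae_of_all _ fun x => (otExt_apply φ x).symm)

lemma ot_weak {Ω : Set X} (hΩ : IsCompact Ω) (c : X × X → ℝ) (hc : Continuous c)
    (μ ν : Measure X) [IsProbabilityMeasure μ] [IsProbabilityMeasure ν]
    (hμ : μ Ωᶜ = 0) (hν : ν Ωᶜ = 0) (p : (X → ℝ) × (X → ℝ)) (hp : p ∈ dualPairs Ω c) :
    ∫ x, p.1 x ∂μ + ∫ y, p.2 y ∂ν ≤ Tc c μ ν := by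
  obtain ⟨hp1, hp2, hp3⟩ := hp
  refine le_csInf ⟨_, μ.prod ν, by simp, by simp, rfl⟩ ?_
  rintro r ⟨π, rfl, rfl, rfl⟩
  have hπ : IsProbabilityMeasure π :=
    Measure.isProbabilityMeasure_of_map Prod.fst
  have i1 := ot_intOn hΩ hμ hp1
  have i2 := ot_intOn hΩ hν hp2
  have a1 : ∀ᵐ z ∂π, z.1 ∈ Ω := by
    rw [Measure.map_apply measurable_fst hΩ.measurableSet.compl] at hμ
    exact hμ
  have a2 : ∀ᵐ z ∂π, z.2 ∈ Ω := by
    rw [Measure.map_apply measurable_snd hΩ.measurableSet.compl] at hν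
    exact hν
  have a3 : ∀ᵐ z ∂π, z ∈ Ω ×ˢ Ω := by
    filter_upwards [a1, a2] with z h1 h2 using ⟨h1, h2⟩
  have i3 : Integrable c π := by
    have := hc.continuousOn.integrableOn_compact (μ := π) (hΩ.prod hΩ)
    rwa [IntegrableOn, Measure.restrict_eq_self_of_ae_mem a3] at this
  rw [integral_map (by fun_prop) i1.aestronglyMeasurable,
    integral_map (by fun_prop) i2.aestronglyMeasurable]
  have j1 : Integrable (fun z : X × X => p.1 z.1) π := i1.comp_measurable measurable_fst
  have j2 : Integrable (fun z : X × X => p.2 z.2) π := i2.comp_measurable measurable_snd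
  rw [← integral_add j1 j2]
  refine integral_mono_ae (j1.add j2) i3 ?_
  filter_upwards [a3] with z hz using hp3 _ hz.1 _ hz.2

/-- The cost restricted to `Ω`. -/
def otC (Ω : Set X) (c : X × X → ℝ) (hc : Continuous c) : C(Ω × Ω, ℝ) :=
  ⟨fun z => c (z.1, z.2), by fun_prop⟩

lemma ot_ext_mem {Ω : Set X} [CompactSpace Ω] (c : X × X → ℝ) (hc : Continuous c)
    (q : C(Ω, ℝ) × C(Ω, ℝ)) (hq : q ∈ otA (otC Ω c hc)) :
    (otExt q.1, otExt q.2) ∈ dualPairs Ω c := by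
  refine ⟨otExt_contOn _, otExt_contOn _, fun x hx y hy => ?_⟩
  have e1 := otExt_apply q.1 ⟨x, hx⟩
  have e2 := otExt_apply q.2 ⟨y, hy⟩
  simp only at e1 e2 ⊢
  rw [e1, e2]
  exact hq.2 ⟨x, hx⟩ ⟨y, hy⟩

lemma ot_strong {Ω : Set X} (hΩ : IsCompact Ω) [CompactSpace Ω] (c : X × X → ℝ) (hc : Continuous c)
    (hc0 : ∀ z, 0 ≤ c z)
    (μ ν : Measure X) [IsProbabilityMeasure μ] [IsProbabilityMeasure ν]
    (hμ : μ Ωᶜ = 0) (hν : ν Ωᶜ = 0) :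
    ∃ q ∈ otA (otC Ω c hc), Tc c μ ν ≤ ∫ x, otExt q.1 x ∂μ + ∫ y, otExt q.2 y ∂ν := by
  have hm : ∀ μ : Measure X, μ Ωᶜ = 0 → (μ.comap (Subtype.val : Ω → X)).map Subtype.val = μ := by
    intro μ h
    rw [map_comap_subtype_coe hΩ.measurableSet, ot_restrict h]
  have pμ : IsProbabilityMeasure (μ.comap (Subtype.val : Ω → X)) := by
    have : IsProbabilityMeasure ((μ.comap (Subtype.val : Ω → X)).map Subtype.val) := by
      rw [hm μ hμ]; infer_instance
    exact Measure.isProbabilityMeasure_of_map Subtype.val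
  have pν : IsProbabilityMeasure (ν.comap (Subtype.val : Ω → X)) := by
    have : IsProbabilityMeasure ((ν.comap (Subtype.val : Ω → X)).map Subtype.val) := by
      rw [hm ν hν]; infer_instance
    exact Measure.isProbabilityMeasure_of_map Subtype.val
  have : Nonempty Ω := by
    have := IsProbabilityMeasure.neZero (μ.comap (Subtype.val : Ω → X))
    by_contra hne
    rw [not_nonempty_iff] at hne
    exact NeZero.ne (μ.comap (Subtype.val : Ω → X)) (Measure.eq_zero_of_isEmpty _)
  obtain ⟨π, h1, h2, q, hq, hle⟩ := ot_attain (μ.comap (Subtype.val : Ω → X))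
    (ν.comap (Subtype.val : Ω → X)) (otC Ω c hc)
  refine ⟨q, hq, ?_⟩
  rw [ot_integral_comap hΩ hμ, ot_integral_comap hΩ hν] at hle
  refine le_trans ?_ hle
  have mv : Measurable (Prod.map (Subtype.val : Ω → X) (Subtype.val : Ω → X)) := by fun_prop
  refine csInf_le ⟨0, ?_⟩ ⟨π.map (Prod.map Subtype.val Subtype.val), ?_, ?_, ?_⟩
  · rintro r ⟨π, -, -, rfl⟩
    exact integral_nonneg hc0
  · rw [Measure.map_map measurable_fst mv, Prod.map_fst',
      ← Measure.map_map measurable_subtype_coe measurable_fst, h1, hm μ hμ]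
  · rw [Measure.map_map measurable_snd mv, Prod.map_snd',
      ← Measure.map_map measurable_subtype_coe measurable_snd, h2, hm ν hν]
  · rw [integral_map mv.aemeasurable hc.aestronglyMeasurable]
    rfl

lemma ot_mul_int {Ω : Set X} (hΩ : IsCompact Ω) {μ : Measure X}
    {φ h : X → ℝ} (hφ : ContinuousOn φ Ω) (hh : Integrable h μ) (h0 : ∀ x ∉ Ω, h x = 0) :
    Integrable (fun x => φ x * h x) μ := by
  have := (hh.integrableOn (s := Ω)).continuousOn_mul hφ hΩ
  refine (integrableOn_iff_integrable_of_support_subset fun x hx => ?_).1 this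
  by_contra hcon
  exact hx (by simp [h0 x hcon])

lemma ot_mul_bound {Ω : Set X} {μ : Measure X} {φ h : X → ℝ} {M : ℝ} (hM : ∀ x ∈ Ω, |φ x| ≤ M)
    (hh : Integrable h μ) (h0 : ∀ x ∉ Ω, h x = 0) :
    |∫ x, φ x * h x ∂μ| ≤ M * ∫ x, |h x| ∂μ := by
  rw [← integral_const_mul, ← Real.norm_eq_abs]
  refine norm_integral_le_of_norm_le (hh.abs.const_mul M) (ae_of_all _ fun x => ?_)
  rw [Real.norm_eq_abs, abs_mul]
  by_cases hx : x ∈ Ω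
  · exact mul_le_mul_of_nonneg_right (hM x hx) (abs_nonneg _)
  · simp [h0 x hx]

lemma ot_mul_cont {Ω : Set X} (hΩ : IsCompact Ω) [CompactSpace Ω] {μ : Measure X} {h : X → ℝ}
    (hh : Integrable h μ) (h0 : ∀ x ∉ Ω, h x = 0) :
    Continuous fun φ : C(Ω, ℝ) => ∫ x, otExt φ x * h x ∂μ := by
  refine LipschitzWith.continuous (K := ⟨∫ x, |h x| ∂μ, integral_nonneg fun _ => abs_nonneg _⟩) ?_
  refine LipschitzWith.of_dist_le_mul fun φ ψ => ?_
  rw [Real.dist_eq, ← integral_sub (ot_mul_int hΩ (otExt_contOn φ) hh h0)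
    (ot_mul_int hΩ (otExt_contOn ψ) hh h0)]
  simp only [← sub_mul]
  rw [mul_comm]
  refine ot_mul_bound (Ω := Ω) (φ := fun x => otExt φ x - otExt ψ x) (fun x hx => ?_) hh h0
  have e1 := otExt_apply φ ⟨x, hx⟩
  have e2 := otExt_apply ψ ⟨x, hx⟩
  simp only at e1 e2 ⊢
  rw [e1, e2, ← Real.dist_eq]
  exact ContinuousMap.dist_apply_le_dist _

lemma ot_quot {Ω : Set X} (hΩ : IsCompact Ω) {μ : Measure X} {φ a b D : X → ℝ} {M t : ℝ}
    (ht : 0 < t) (hφ : ContinuousOn φ Ω) (hM : ∀ x ∈ Ω, |φ x| ≤ M)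
    (ha : Integrable a μ) (hb : Integrable b μ) (hD : Integrable D μ)
    (a0 : ∀ x ∉ Ω, a x = 0) (b0 : ∀ x ∉ Ω, b x = 0) (D0 : ∀ x ∉ Ω, D x = 0) :
    |∫ x, φ x * a x ∂μ - ∫ x, φ x * b x ∂μ - t * ∫ x, φ x * D x ∂μ| ≤
      t * (M * ∫ x, |(a x - b x) / t - D x| ∂μ) := by
  have ia := ot_mul_int hΩ hφ ha a0
  have ib := ot_mul_int hΩ hφ hb b0
  have iD := ot_mul_int hΩ hφ hD D0
  have ih : Integrable (fun x => (a x - b x) / t - D x) μ := ((ha.sub hb).div_const t).sub hD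
  have key := ot_mul_bound (μ := μ) hM ih (fun x hx => by simp [a0 x hx, b0 x hx, D0 x hx])
  have e : ∫ x, φ x * a x ∂μ - ∫ x, φ x * b x ∂μ - t * ∫ x, φ x * D x ∂μ
      = t * ∫ x, φ x * ((a x - b x) / t - D x) ∂μ := by
    rw [← integral_sub ia ib, ← integral_const_mul, ← integral_const_mul,
      ← integral_sub (f := fun x => φ x * a x - φ x * b x) (ia.sub ib) (iD.const_mul t)]
    refine integral_congr_ae (ae_of_all _ fun x => ?_)
    simp only
    field_simp
  rw [e, abs_mul, abs_of_pos ht]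
  exact mul_le_mul_of_nonneg_left key ht.le

end duality

/-- Directional derivatives of the density in L1. -/
lemma ot_deriv {X : Type*} [MeasurableSpace X] {μ : Measure X} {E : Type*} [NormedAddCommGroup E]
    [NormedSpace ℝ E] (Θ : Set E) (hΘ : IsOpen Θ) (ρ : X → E → ℝ)
    (hρint : ∀ θ ∈ Θ, Integrable (fun x => ρ x θ) μ)
    (η : X → ℝ) (hη : Integrable η μ)
    (hρdiff : ∀ x, ∀ θ ∈ Θ, DifferentiableAt ℝ (ρ x) θ ∧ ‖fderiv ℝ (ρ x) θ‖ ≤ η x)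
    (θ₀ : E) (hθ₀ : θ₀ ∈ Θ) (v : E) :
    Integrable (fun x => fderiv ℝ (ρ x) θ₀ v) μ ∧
    Tendsto (fun t : ℝ => ∫ x, |(ρ x (θ₀ + t • v) - ρ x θ₀) / t - fderiv ℝ (ρ x) θ₀ v| ∂μ)
      (nhdsWithin 0 (Ioi 0)) (nhds 0) ∧
    ∀ᶠ t : ℝ in nhdsWithin 0 (Ioi 0), θ₀ + t • v ∈ Θ := by
  have lim : Tendsto (fun t : ℝ => θ₀ + t • v) (nhdsWithin 0 (Ioi 0)) (nhds θ₀) := by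
    have : Continuous (fun t : ℝ => θ₀ + t • v) := by fun_prop
    have := this.tendsto 0
    rw [zero_smul, add_zero] at this
    exact this.mono_left nhdsWithin_le_nhds
  have hin : ∀ᶠ t : ℝ in nhdsWithin 0 (Ioi 0), θ₀ + t • v ∈ Θ :=
    lim.eventually (hΘ.mem_nhds hθ₀)
  obtain ⟨r, hr, hball⟩ := Metric.isOpen_iff.1 hΘ θ₀ hθ₀
  have hinb : ∀ᶠ t : ℝ in nhdsWithin 0 (Ioi 0), θ₀ + t • v ∈ Metric.ball θ₀ r :=
    lim.eventually (Metric.ball_mem_nhds _ hr)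
  have hpos : ∀ᶠ t : ℝ in nhdsWithin 0 (Ioi 0), (0 : ℝ) < t := self_mem_nhdsWithin
  have hpt : ∀ x, Tendsto (fun t : ℝ => (ρ x (θ₀ + t • v) - ρ x θ₀) / t)
      (nhdsWithin 0 (Ioi 0)) (nhds (fderiv ℝ (ρ x) θ₀ v)) := by
    intro x
    have h := ((hρdiff x θ₀ hθ₀).1.hasFDerivAt.hasLineDerivAt v).tendsto_slope_zero_right
    refine h.congr fun t => ?_
    simp [smul_eq_mul, div_eq_inv_mul]
  have hbd : ∀ᶠ t : ℝ in nhdsWithin 0 (Ioi 0), ∀ x,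
      |(ρ x (θ₀ + t • v) - ρ x θ₀) / t| ≤ η x * ‖v‖ := by
    filter_upwards [hinb, hpos] with t ht ht0 x
    have := (convex_ball θ₀ r).norm_image_sub_le_of_norm_fderiv_le (𝕜 := ℝ) (f := ρ x) (C := η x)
      (fun y hy => (hρdiff x y (hball hy)).1) (fun y hy => (hρdiff x y (hball hy)).2)
      (Metric.mem_ball_self hr) ht
    rw [add_sub_cancel_left, norm_smul, Real.norm_eq_abs, Real.norm_eq_abs, abs_of_pos ht0] at this
    rw [abs_div, abs_of_pos ht0, div_le_iff₀ ht0]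
    linarith
  have hbD : ∀ x, |fderiv ℝ (ρ x) θ₀ v| ≤ η x * ‖v‖ := fun x =>
    ((fderiv ℝ (ρ x) θ₀).le_opNorm v).trans
      (mul_le_mul_of_nonneg_right (hρdiff x θ₀ hθ₀).2 (norm_nonneg _))
  obtain ⟨u, hu⟩ := exists_seq_tendsto (nhdsWithin (0 : ℝ) (Ioi 0))
  have hmeasD : AEStronglyMeasurable (fun x => fderiv ℝ (ρ x) θ₀ v) μ := by
    obtain ⟨n₀, hn₀⟩ := eventually_atTop.1 (hu.eventually hin)
    refine aestronglyMeasurable_of_tendsto_ae (u := atTop)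
      (f := fun (n : ℕ) x => (ρ x (θ₀ + u (n + n₀) • v) - ρ x θ₀) / u (n + n₀)) (fun n => ?_)
      (ae_of_all _ fun x => (hpt x).comp (hu.comp (tendsto_add_atTop_nat n₀)))
    exact (((hρint _ (hn₀ (n + n₀) (by omega))).sub (hρint _ hθ₀)).div_const _).aestronglyMeasurable
  have hintD : Integrable (fun x => fderiv ℝ (ρ x) θ₀ v) μ :=
    (hη.mul_const ‖v‖).mono' hmeasD (ae_of_all _ hbD)
  refine ⟨hintD, ?_, hin⟩
  have := tendsto_integral_filter_of_dominated_convergence (μ := μ)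
    (l := nhdsWithin (0 : ℝ) (Ioi 0))
    (F := fun t x => |(ρ x (θ₀ + t • v) - ρ x θ₀) / t - fderiv ℝ (ρ x) θ₀ v|)
    (f := fun _ => (0 : ℝ)) (fun x => η x * ‖v‖ + η x * ‖v‖) ?_ ?_
    ((hη.mul_const ‖v‖).add (hη.mul_const ‖v‖)) ?_
  · simpa using this
  · filter_upwards [hin] with t ht
    exact ((((hρint _ ht).sub (hρint _ hθ₀)).div_const _).sub hintD).abs.aestronglyMeasurable
  · filter_upwards [hbd] with t ht
    refine ae_of_all _ fun x => ?_
    rw [Real.norm_eq_abs, abs_abs]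
    exact (abs_sub _ _).trans (add_le_add (ht x) (hbD x))
  · refine ae_of_all _ fun x => ?_
    have := ((hpt x).sub_const (fderiv ℝ (ρ x) θ₀ v)).abs
    simpa using this

/-- Under A1–A3, `f(θ) = T_c(ρ(·,θ), ρ*)` is Gâteaux differentiable
at `θ₀` if and only if `∫ φ₁ ∇_θρ(·,θ₀) = ∫ φ₂ ∇_θρ(·,θ₀)` for all optimal potential
pairs; in that case `∇f(θ₀) = ∫ φ ∇_θρ(·,θ₀)` for an arbitrary pair of Kantorovich
potentials. -/
theorem stmt11 (d m : ℕ)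
    (Ω : Set (EuclideanSpace ℝ (Fin d))) (hΩ : IsCompact Ω)
    (Θ : Set (Fin m → ℝ)) (hΘ : IsOpen Θ)
    (ρ : EuclideanSpace ℝ (Fin d) → (Fin m → ℝ) → ℝ)
    (hρint : ∀ θ ∈ Θ, Integrable (fun x => ρ x θ))
    (hρprob : ∀ θ ∈ Θ, (∀ x, 0 ≤ ρ x θ) ∧ (∫ x, ρ x θ) = 1 ∧ ∀ x ∉ Ω, ρ x θ = 0)
    (η : EuclideanSpace ℝ (Fin d) → ℝ) (hη : Integrable η)
    (hρdiff : ∀ x, ∀ θ ∈ Θ, DifferentiableAt ℝ (ρ x) θ ∧ ‖fderiv ℝ (ρ x) θ‖ ≤ η x)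
    (c : EuclideanSpace ℝ (Fin d) × EuclideanSpace ℝ (Fin d) → ℝ)
    (hc : Continuous c) (hcnonneg : ∀ z, 0 ≤ c z)
    (ρstar : Measure (EuclideanSpace ℝ (Fin d)))
    (hρstar : IsProbabilityMeasure ρstar) (hρstarsupp : ρstar Ωᶜ = 0)
    (f : (Fin m → ℝ) → ℝ)
    (hf : ∀ θ, f θ = Tc c (volume.withDensity fun x => ENNReal.ofReal (ρ x θ)) ρstar)
    (θ₀ : Fin m → ℝ) (hθ₀ : θ₀ ∈ Θ) :
    ((∃ g : (Fin m → ℝ) →ₗ[ℝ] ℝ, ∀ v : Fin m → ℝ,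
        Tendsto (fun t : ℝ => (f (θ₀ + t • v) - f θ₀) / t) (nhdsWithin 0 (Ioi 0))
          (nhds (g v))) ↔
      (∀ p₁ ∈ dualPairs Ω c, ∀ p₂ ∈ dualPairs Ω c,
        ((∫ x, p₁.1 x * ρ x θ₀) + ∫ y, p₁.2 y ∂ρstar) = f θ₀ →
        ((∫ x, p₂.1 x * ρ x θ₀) + ∫ y, p₂.2 y ∂ρstar) = f θ₀ →
        ∀ v : Fin m → ℝ,
          (∫ x, p₁.1 x * (fderiv ℝ (ρ x) θ₀) v) =
            ∫ x, p₂.1 x * (fderiv ℝ (ρ x) θ₀) v)) ∧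
    ((∃ g : (Fin m → ℝ) →ₗ[ℝ] ℝ, ∀ v : Fin m → ℝ,
        Tendsto (fun t : ℝ => (f (θ₀ + t • v) - f θ₀) / t) (nhdsWithin 0 (Ioi 0))
          (nhds (g v))) →
      ∀ p ∈ dualPairs Ω c,
        ((∫ x, p.1 x * ρ x θ₀) + ∫ y, p.2 y ∂ρstar) = f θ₀ →
        ∀ v : Fin m → ℝ,
          Tendsto (fun t : ℝ => (f (θ₀ + t • v) - f θ₀) / t) (nhdsWithin 0 (Ioi 0))
            (nhds (∫ x, p.1 x * (fderiv ℝ (ρ x) θ₀) v))) := by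
  have hcomp : CompactSpace Ω := isCompact_iff_compactSpace.1 hΩ
  let X := EuclideanSpace ℝ (Fin d)
  let μ : (Fin m → ℝ) → Measure X := fun θ => volume.withDensity fun x => ENNReal.ofReal (ρ x θ)
  have hμp : ∀ θ ∈ Θ, IsProbabilityMeasure (μ θ) := by
    intro θ hθ
    refine ⟨?_⟩
    rw [withDensity_apply _ MeasurableSet.univ, Measure.restrict_univ,
      ← ofReal_integral_eq_lintegral_ofReal (hρint θ hθ) (ae_of_all _ (hρprob θ hθ).1),
      (hρprob θ hθ).2.1, ENNReal.ofReal_one]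
  have hμ0 : ∀ θ ∈ Θ, μ θ Ωᶜ = 0 := by
    intro θ hθ
    rw [withDensity_apply _ hΩ.measurableSet.compl]
    rw [setLIntegral_congr_fun (g := fun _ => 0) hΩ.measurableSet.compl (fun x hx => by
      simp only; rw [(hρprob θ hθ).2.2 x hx, ENNReal.ofReal_zero])]
    simp
  have hμi : ∀ θ ∈ Θ, ∀ φ : X → ℝ, ∫ x, φ x ∂(μ θ) = ∫ x, φ x * ρ x θ := by
    intro θ hθ φ
    rw [integral_withDensity_eq_integral_toReal_smul₀
      (hρint θ hθ).aestronglyMeasurable.aemeasurable.ennreal_ofReal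
      (ae_of_all _ fun _ => ENNReal.ofReal_lt_top)]
    refine integral_congr_ae (ae_of_all _ fun x => ?_)
    simp only [smul_eq_mul]
    rw [ENNReal.toReal_ofReal ((hρprob θ hθ).1 x), mul_comm]
  have weak : ∀ θ ∈ Θ, ∀ p ∈ dualPairs Ω c,
      (∫ x, p.1 x * ρ x θ) + ∫ y, p.2 y ∂ρstar ≤ f θ := by
    intro θ hθ p hp
    have := hμp θ hθ
    rw [hf, ← hμi θ hθ]
    exact ot_weak hΩ c hc (μ θ) ρstar (hμ0 θ hθ) hρstarsupp p hp
  have strong : ∀ θ ∈ Θ, ∃ q ∈ otA (otC Ω c hc),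
      f θ ≤ (∫ x, otExt q.1 x * ρ x θ) + ∫ y, otExt q.2 y ∂ρstar := by
    intro θ hθ
    have := hμp θ hθ
    obtain ⟨q, hq, h⟩ := ot_strong hΩ c hc hcnonneg (μ θ) ρstar (hμ0 θ hθ) hρstarsupp
    refine ⟨q, hq, ?_⟩
    rw [hf, ← hμi θ hθ]
    exact h
  have der := fun v => ot_deriv Θ hΘ ρ hρint η hη hρdiff θ₀ hθ₀ v
  have D0 : ∀ v, ∀ x ∉ Ω, fderiv ℝ (ρ x) θ₀ v = 0 := by
    intro v x hx
    have : ρ x =ᶠ[nhds θ₀] fun _ => 0 := by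
      filter_upwards [hΘ.mem_nhds hθ₀] with θ hθ using (hρprob θ hθ).2.2 x hx
    rw [this.fderiv_eq]; simp
  have hpos : ∀ᶠ t : ℝ in nhdsWithin 0 (Ioi 0), (0 : ℝ) < t := self_mem_nhdsWithin
  -- the uniform first order expansion
  have expand : ∀ v, ∀ᶠ t : ℝ in nhdsWithin 0 (Ioi 0), ∀ φ : X → ℝ, ∀ M, ContinuousOn φ Ω →
      (∀ x ∈ Ω, |φ x| ≤ M) →
      |(∫ x, φ x * ρ x (θ₀ + t • v)) - (∫ x, φ x * ρ x θ₀) -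
        t * ∫ x, φ x * fderiv ℝ (ρ x) θ₀ v| ≤
      t * (M * ∫ x, |(ρ x (θ₀ + t • v) - ρ x θ₀) / t - fderiv ℝ (ρ x) θ₀ v|) := by
    intro v
    filter_upwards [hpos, (der v).2.2] with t ht hin φ M hφ hM
    exact ot_quot hΩ ht hφ hM (hρint _ hin) (hρint _ hθ₀) (der v).1
      (hρprob _ hin).2.2 (hρprob _ hθ₀).2.2 (D0 v)
  -- lower bound for any optimal pair
  have lower : ∀ p ∈ dualPairs Ω c, ((∫ x, p.1 x * ρ x θ₀) + ∫ y, p.2 y ∂ρstar) = f θ₀ →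
      ∀ v a, Tendsto (fun t : ℝ => (f (θ₀ + t • v) - f θ₀) / t) (nhdsWithin 0 (Ioi 0)) (nhds a) →
      (∫ x, p.1 x * (fderiv ℝ (ρ x) θ₀) v) ≤ a := by
    intro p hp hopt v a ha
    obtain ⟨M, hM⟩ := hΩ.exists_bound_of_continuousOn hp.1
    have lim := ((der v).2.1.const_mul M).const_sub (∫ x, p.1 x * (fderiv ℝ (ρ x) θ₀) v)
    rw [mul_zero, sub_zero] at lim
    refine le_of_tendsto_of_tendsto lim ha ?_
    filter_upwards [expand v, hpos, (der v).2.2] with t h1 ht hin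
    have h2 := (abs_le.1 (h1 p.1 M hp.1 hM)).1
    have h3 := weak _ hin p hp
    rw [le_div_iff₀' ht, mul_sub]
    linarith
  have diffEq : ∀ g : (Fin m → ℝ) →ₗ[ℝ] ℝ, (∀ v : Fin m → ℝ,
        Tendsto (fun t : ℝ => (f (θ₀ + t • v) - f θ₀) / t) (nhdsWithin 0 (Ioi 0))
          (nhds (g v))) → ∀ p ∈ dualPairs Ω c,
        ((∫ x, p.1 x * ρ x θ₀) + ∫ y, p.2 y ∂ρstar) = f θ₀ →
        ∀ v : Fin m → ℝ, (∫ x, p.1 x * (fderiv ℝ (ρ x) θ₀) v) = g v := by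
    intro g hg p hp hopt v
    refine le_antisymm (lower p hp hopt v _ (hg v)) ?_
    have := lower p hp hopt (-v) _ (hg (-v))
    simp only [map_neg, mul_neg, integral_neg] at this
    linarith
  refine ⟨⟨?_, ?_⟩, ?_⟩
  · rintro ⟨g, hg⟩ p₁ hp₁ p₂ hp₂ h₁ h₂ v
    rw [diffEq g hg p₁ hp₁ h₁ v, diffEq g hg p₂ hp₂ h₂ v]
  · intro H
    obtain ⟨q, hq, hq1⟩ := strong θ₀ hθ₀
    have hqd := ot_ext_mem c hc q hq
    have hqo : (∫ x, otExt q.1 x * ρ x θ₀) + ∫ y, otExt q.2 y ∂ρstar = f θ₀ :=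
      le_antisymm (weak θ₀ hθ₀ _ hqd) hq1
    have hint : ∀ v, Integrable (fun x => otExt q.1 x * fderiv ℝ (ρ x) θ₀ v) := fun v =>
      ot_mul_int hΩ (otExt_contOn _) (der v).1 (D0 v)
    let g : (Fin m → ℝ) →ₗ[ℝ] ℝ :=
      { toFun := fun v => ∫ x, otExt q.1 x * fderiv ℝ (ρ x) θ₀ v
        map_add' := fun v w => by
          rw [← integral_add (hint v) (hint w)]
          refine integral_congr_ae (ae_of_all _ fun x => ?_)
          simp only [map_add]; ring
        map_smul' := fun a v => by
          simp only [RingHom.id_apply, smul_eq_mul]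
          rw [← integral_const_mul]
          refine integral_congr_ae (ae_of_all _ fun x => ?_)
          simp only [map_smul, smul_eq_mul]; ring }
    refine ⟨g, fun v => ?_⟩
    have c2 : Continuous fun ψ : C(Ω, ℝ) => ∫ y, otExt ψ y ∂ρstar := by
      have := ot_mul_cont hΩ (μ := ρstar) (h := Ω.indicator fun _ => (1 : ℝ))
        ((integrable_const _).indicator hΩ.measurableSet) (fun x hx => by simp [hx])
      refine this.congr fun ψ => integral_congr_ae ?_
      have hae : ∀ᵐ y ∂ρstar, y ∈ Ω := hρstarsupp
      filter_upwards [hae] with y hy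
      simp [hy]
    have c1 : Continuous fun p : C(Ω, ℝ) × C(Ω, ℝ) =>
        (∫ x, otExt p.1 x * ρ x θ₀) + ∫ y, otExt p.2 y ∂ρstar :=
      ((ot_mul_cont hΩ (hρint _ hθ₀) (hρprob _ hθ₀).2.2).comp continuous_fst).add
        (c2.comp continuous_snd)
    refine ot_danskin (otA (otC Ω c hc)) (otA_compact _)
      (fun p => (∫ x, otExt p.1 x * ρ x θ₀) + ∫ y, otExt p.2 y ∂ρstar)
      (fun p => ∫ x, otExt p.1 x * fderiv ℝ (ρ x) θ₀ v) c1
      ((ot_mul_cont hΩ (der v).1 (D0 v)).comp continuous_fst)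
      (fun t p => (∫ x, otExt p.1 x * ρ x (θ₀ + t • v)) + ∫ y, otExt p.2 y ∂ρstar)
      (fun t => f (θ₀ + t • v))
      (fun t => ∫ x, |(ρ x (θ₀ + t • v) - ρ x θ₀) / t - fderiv ℝ (ρ x) θ₀ v|) (f θ₀)
      (3 * ‖otC Ω c hc‖) (g v) ?_ ?_ ?_ ?_ ⟨q, hq, hqo⟩ ?_ (der v).2.1
    · filter_upwards [expand v] with t h p hp
      have := h (otExt p.1) (3 * ‖otC Ω c hc‖) (otExt_contOn _) (fun x hx => by
        have e1 := otExt_apply p.1 ⟨x, hx⟩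
        simp only at e1
        rw [e1]
        exact hp.1.1.2 _)
      rwa [add_sub_add_right_eq_sub]
    · filter_upwards [(der v).2.2] with t hin using strong _ hin
    · filter_upwards [(der v).2.2] with t hin p hp using weak _ hin _ (ot_ext_mem c hc p hp)
    · intro p hp
      exact weak _ hθ₀ _ (ot_ext_mem c hc p hp)
    · intro p hp h
      exact H _ (ot_ext_mem c hc p hp) _ hqd h hqo v
  · rintro ⟨g, hg⟩ p hp h v
    rw [diffEq g hg p hp h v]
    exact hg v
end

section
/- Under A1–A3, if θ₀ ∈ Θ is such that φ₂ − φ₁ is constant ρ(·,θ₀)-almost everywhere for all pairs of Kantorovich potentials (φ₁,ψ₁), (φ₂,ψ₂) for the transport from ρ(·,θ₀) to ρ*, then f(θ) = T_c(ρ(·,θ),ρ*) is Gâteaux differentiable at θ₀ with ∇f(θ₀) = ∫_Ω φ(x) ∇_θ ρ(x,θ₀) dx. -/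
open MeasureTheory Set Filter

set_option linter.unusedSectionVars false


lemma hb_aux {E : Type*} [AddCommGroup E] [Module ℝ E] (N : E → ℝ)
    (N_hom : ∀ c : ℝ, 0 < c → ∀ x, N (c • x) = c * N x) (N_add : ∀ x y, N (x + y) ≤ N x + N y)
    (x : E) : ∃ g : E →ₗ[ℝ] ℝ, g x = N x ∧ ∀ y, g y ≤ N y := by
  have N0 : N 0 = 0 := by
    have := N_hom 2 (by norm_num) 0
    rw [smul_zero] at this; linarith
  have H : ∀ c : ℝ, c • x = 0 → (RingHom.id ℝ) c • N x = 0 := by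
    intro c hc
    rcases smul_eq_zero.1 hc with h | h
    · simp [h]
    · simp [h, N0]
  obtain ⟨g, hg1, hg2⟩ := exists_extension_of_le_sublinear
    (LinearPMap.mkSpanSingleton' x (N x) H) N N_hom N_add (by
      rintro ⟨y, hy⟩
      obtain ⟨c, rfl⟩ := Submodule.mem_span_singleton.1 hy
      rw [LinearPMap.mkSpanSingleton'_apply]
      simp only [RingHom.id_apply, smul_eq_mul]
      rcases lt_trichotomy c 0 with hc | hc | hc
      · have h1 := N_add (c • x) ((-c) • x)
        rw [← add_smul, N_hom (-c) (by linarith)] at h1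
        simp only [add_neg_cancel, zero_smul, N0] at h1
        linarith
      · simp [hc, N0]
      · rw [N_hom c hc])
  refine ⟨g, ?_, hg2⟩
  have := hg1 ⟨x, Submodule.mem_span_singleton_self x⟩
  exact this.trans (LinearPMap.mkSpanSingleton'_apply_self _ _ _ _)

section dual
variable {K : Type*} [MetricSpace K] [CompactSpace K] [MeasurableSpace K] [BorelSpace K]

lemma cm_int (φ : C(K, ℝ)) (μ : Measure K) [IsFiniteMeasure μ] : Integrable φ μ :=
  φ.continuous.integrable_of_hasCompactSupport (HasCompactSupport.of_compactSpace _)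

lemma dual_low (μ ν : Measure K) [IsProbabilityMeasure μ] [IsProbabilityMeasure ν]
    (φ ψ : C(K, ℝ)) (a : ℝ) (h : ∀ x y, a ≤ φ x + ψ y) : a ≤ ∫ x, φ x ∂μ + ∫ y, ψ y ∂ν := by
  have h1 : ∀ y, a - ψ y ≤ ∫ x, φ x ∂μ := fun y => by
    have : ∫ x, (a - ψ y) ∂μ ≤ ∫ x, φ x ∂μ :=
      integral_mono (integrable_const _) (cm_int φ μ) (fun x => by have := h x y; simp only; linarith)
    simpa using this
  have : ∫ y, (a - ∫ x, φ x ∂μ) ∂ν ≤ ∫ y, ψ y ∂ν :=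
      integral_mono (integrable_const _) (cm_int ψ ν) (fun y => by have := h1 y; simp only; linarith)
  simp at this
  linarith

lemma strong_dual_s14 [Nonempty K] (μ ν : Measure K) [IsProbabilityMeasure μ] [IsProbabilityMeasure ν]
    (c : C(K × K, ℝ)) : ∃ π : Measure (K × K), π.map Prod.fst = μ ∧ π.map Prod.snd = ν ∧
      ∀ ε > 0, ∃ φ ψ : C(K, ℝ), (∀ x y, φ x + ψ y ≤ c (x, y)) ∧
        ∫ z, c z ∂π ≤ ∫ x, φ x ∂μ + ∫ y, ψ y ∂ν + ε := by
  let A : C(K × K, ℝ) → Set ℝ := fun h => {r | ∃ φ ψ : C(K, ℝ), (∀ x y, h (x, y) ≤ φ x + ψ y) ∧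
    r = ∫ x, φ x ∂μ + ∫ y, ψ y ∂ν}
  have Abd : ∀ h, BddBelow (A h) := by
    intro h
    refine ⟨-‖h‖, ?_⟩
    rintro r ⟨φ, ψ, h1, rfl⟩
    refine dual_low μ ν φ ψ _ fun x y => le_trans ?_ (h1 x y)
    have := h.norm_coe_le_norm (x, y)
    exact (abs_le.1 this).1
  have Ane : ∀ h, (A h).Nonempty := by
    intro h
    refine ⟨_, ContinuousMap.const K ‖h‖, 0, ?_, rfl⟩
    intro x y
    have := h.norm_coe_le_norm (x, y)
    simpa using (abs_le.1 this).2
  let N : C(K × K, ℝ) → ℝ := fun h => sInf (A h)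
  have Nle : ∀ h (φ ψ : C(K, ℝ)), (∀ x y, h (x, y) ≤ φ x + ψ y) →
      N h ≤ ∫ x, φ x ∂μ + ∫ y, ψ y ∂ν := fun h φ ψ hh => csInf_le (Abd h) ⟨φ, ψ, hh, rfl⟩
  have N_hom' : ∀ c : ℝ, 0 < c → ∀ h, N (c • h) ≤ c * N h := by
    intro c hc h
    rw [← div_le_iff₀' hc]
    refine le_csInf (Ane h) ?_
    rintro r ⟨φ, ψ, h1, rfl⟩
    rw [div_le_iff₀' hc]
    refine (Nle (c • h) (c • φ) (c • ψ) ?_).trans_eq ?_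
    · intro x y
      have := mul_le_mul_of_nonneg_left (h1 x y) hc.le
      simp only [ContinuousMap.smul_apply, smul_eq_mul]; linarith
    · simp [integral_const_mul, mul_add]
  have N_hom : ∀ c : ℝ, 0 < c → ∀ h, N (c • h) = c * N h := by
    intro c hc h
    refine le_antisymm (N_hom' c hc h) ?_
    have := N_hom' c⁻¹ (inv_pos.2 hc) (c • h)
    rw [smul_smul, inv_mul_cancel₀ hc.ne', one_smul] at this
    rwa [← div_eq_inv_mul, le_div_iff₀' hc] at this
  have N_add : ∀ h k, N (h + k) ≤ N h + N k := by
    intro h k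
    have h1 : ∀ r ∈ A h, ∀ s ∈ A k, N (h + k) ≤ r + s := by
      rintro r ⟨φ, ψ, h1, rfl⟩ s ⟨φ', ψ', h2, rfl⟩
      refine (Nle (h + k) (φ + φ') (ψ + ψ') ?_).trans_eq ?_
      · intro x y
        have := h1 x y
        have := h2 x y
        simp only [ContinuousMap.add_apply]; linarith
      · simp only [ContinuousMap.add_apply]
        rw [integral_add (cm_int _ _) (cm_int _ _), integral_add (cm_int _ _) (cm_int _ _)]
        ring
    have h2 : ∀ r ∈ A h, N (h + k) - r ≤ N k := fun r hr =>
      le_csInf (Ane k) fun s hs => by linarith [h1 r hr s hs]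
    have h3 : N (h + k) - N k ≤ N h := le_csInf (Ane h) fun r hr => by linarith [h2 r hr]
    linarith
  obtain ⟨L, hL1, hL2⟩ := hb_aux N N_hom N_add (-c)
  have hpos : ∀ h : C(K × K, ℝ), 0 ≤ h → 0 ≤ L h := by
    intro h hh
    have := hL2 (-h)
    have h2 := Nle (-h) 0 0 (fun x y => by simpa using hh (x, y))
    simp at this h2
    linarith
  have hmarg' : ∀ (φ ψ : C(K, ℝ)) (h : C(K × K, ℝ)), (∀ x y, h (x, y) = φ x + ψ y) →
      L h ≤ ∫ x, φ x ∂μ + ∫ y, ψ y ∂ν := fun φ ψ h hh =>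
    (hL2 h).trans (Nle h φ ψ fun x y => (hh x y).le)
  have hmarg : ∀ (φ ψ : C(K, ℝ)) (h : C(K × K, ℝ)), (∀ x y, h (x, y) = φ x + ψ y) →
      L h = ∫ x, φ x ∂μ + ∫ y, ψ y ∂ν := by
    intro φ ψ h hh
    refine le_antisymm (hmarg' φ ψ h hh) ?_
    have := hmarg' (-φ) (-ψ) (-h) (fun x y => by simp [hh]; ring)
    simp only [map_neg, ContinuousMap.neg_apply, integral_neg] at this
    linarith
  let Λ : CompactlySupportedContinuousMap (K × K) ℝ →ₚ[ℝ] ℝ := PositiveLinearMap.mk₀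
    { toFun := fun f => L f.toContinuousMap
      map_add' := fun f g => L.map_add f.toContinuousMap g.toContinuousMap
      map_smul' := fun a f => L.map_smul a f.toContinuousMap } (fun f hf => hpos _ hf)
  let π := RealRMK.rieszMeasure Λ
  have hintg : ∀ h : C(K × K, ℝ), ∫ z, h z ∂π = L h := fun h =>
    RealRMK.integral_rieszMeasure Λ (CompactlySupportedContinuousMap.continuousMapEquiv h)
  have : IsFiniteMeasureOnCompacts π := inferInstance
  have : IsFiniteMeasure π := ⟨isCompact_univ.measure_lt_top⟩
  refine ⟨π, ?_, ?_, ?_⟩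
  · apply ext_of_forall_integral_eq_of_IsFiniteMeasure
    intro f
    rw [integral_map measurable_fst.aemeasurable f.continuous.aestronglyMeasurable]
    have := hintg (f.toContinuousMap.comp ContinuousMap.fst)
    simp only [ContinuousMap.comp_apply] at this
    refine this.trans ?_
    rw [hmarg f.toContinuousMap 0 _ (fun x y => by simp)]
    simp
  · apply ext_of_forall_integral_eq_of_IsFiniteMeasure
    intro f
    rw [integral_map measurable_snd.aemeasurable f.continuous.aestronglyMeasurable]
    have := hintg (f.toContinuousMap.comp ContinuousMap.snd)
    simp only [ContinuousMap.comp_apply] at this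
    refine this.trans ?_
    rw [hmarg 0 f.toContinuousMap _ (fun x y => by simp)]
    simp
  · intro ε hε
    obtain ⟨r, ⟨φ, ψ, h1, rfl⟩, hr⟩ := exists_lt_of_csInf_lt (Ane (-c))
      (show N (-c) < N (-c) + ε by linarith)
    refine ⟨-φ, -ψ, fun x y => ?_, ?_⟩
    · have := h1 x y
      simp only [ContinuousMap.neg_apply] at *; linarith
    · rw [hintg]
      simp only [ContinuousMap.neg_apply, integral_neg]
      rw [map_neg] at hL1
      linarith
end dual

section transf
variable {K : Type*} [MetricSpace K] [CompactSpace K] [Nonempty K]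

lemma iInf_cmp (u v : C(K, ℝ)) (d : ℝ) (h : ∀ y, u y ≤ v y + d) :
    (⨅ y, u y) ≤ (⨅ y, v y) + d := by
  have hb : BddBelow (range u) := (isCompact_range u.continuous).bddBelow
  have : (⨅ y, u y) - d ≤ ⨅ y, v y := le_ciInf fun y => by
    have := ciInf_le hb y
    linarith [h y]
  linarith

lemma cT_mod (C : C(K, C(K, ℝ))) (h : C(K, ℝ)) (x x' : K) :
    |(⨅ y, (C x - h) y) - (⨅ y, (C x' - h) y)| ≤ dist (C x) (C x') := by
  have h1 : ∀ x x', (⨅ y, (C x - h) y) ≤ (⨅ y, (C x' - h) y) + dist (C x) (C x') := by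
    intro x x'
    apply iInf_cmp
    intro y
    have := ContinuousMap.dist_apply_le_dist (f := C x) (g := C x') y
    rw [Real.dist_eq] at this
    have := (abs_le.1 this).2
    simp only [ContinuousMap.sub_apply]; linarith
  rw [abs_le]
  constructor
  · have := h1 x' x
    rw [dist_comm] at this; linarith
  · linarith [h1 x x']

/-- The c-transform. -/
noncomputable def cT (C : C(K, C(K, ℝ))) (h : C(K, ℝ)) : C(K, ℝ) where
  toFun x := ⨅ y, (C x - h) y
  continuous_toFun := by
    rw [continuous_iff_continuousAt]
    intro x
    rw [ContinuousAt, tendsto_iff_dist_tendsto_zero]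
    refine squeeze_zero (fun _ => dist_nonneg) (fun x' => cT_mod C h x' x) ?_
    exact tendsto_iff_dist_tendsto_zero.1 (C.continuous.tendsto x)

lemma cT_le (C : C(K, C(K, ℝ))) (h : C(K, ℝ)) (x y : K) : cT C h x + h y ≤ C x y := by
  have hb : BddBelow (range (C x - h)) := (isCompact_range (C x - h).continuous).bddBelow
  have := ciInf_le hb y
  simp only [ContinuousMap.sub_apply] at this
  change (⨅ y, (C x - h) y) + h y ≤ C x y
  have e : (⨅ y, (C x - h) y) = iInf (C x - h) := rfl
  rw [e]
  linarith

lemma le_cT (C : C(K, C(K, ℝ))) (h g : C(K, ℝ)) (x : K) (hh : ∀ y, g x + h y ≤ C x y) :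
    g x ≤ cT C h x := by
  refine le_ciInf fun y => ?_
  have := hh y
  simp only [ContinuousMap.sub_apply]; linarith

lemma cT_cont (C : C(K, C(K, ℝ))) : Continuous (cT C) := by
  refine LipschitzWith.continuous (K := 1) (LipschitzWith.of_dist_le_mul fun h g => ?_)
  rw [NNReal.coe_one, one_mul, ContinuousMap.dist_le dist_nonneg]
  intro x
  have h1 : ∀ h g : C(K, ℝ), cT C h x ≤ cT C g x + dist h g := by
    intro h g
    apply iInf_cmp
    intro y
    have := ContinuousMap.dist_apply_le_dist (f := h) (g := g) y
    rw [Real.dist_eq] at this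
    have := (abs_le.1 this).1
    simp only [ContinuousMap.sub_apply]; linarith
  rw [Real.dist_eq, abs_le]
  constructor
  · have := h1 g h
    rw [dist_comm] at this; linarith
  · linarith [h1 h g]

/-- Normalised functions with the modulus of continuity of the cost. -/
def SS (C : C(K, C(K, ℝ))) (x₀ : K) : Set C(K, ℝ) :=
  {φ | φ x₀ = 0 ∧ ∀ x x', |φ x - φ x'| ≤ dist (C x) (C x')}

lemma SS_compact (C : C(K, C(K, ℝ))) (x₀ : K) : IsCompact (SS C x₀) := by
  let e := ContinuousMap.isometryEquivBoundedOfCompact K ℝ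
  rw [← e.symm.toHomeomorph.isCompact_preimage]
  have hcl : IsClosed (SS C x₀) := by
    have : SS C x₀ = {φ | φ x₀ = 0} ∩ ⋂ x, ⋂ x', {φ : C(K, ℝ) | |φ x - φ x'| ≤ dist (C x) (C x')} := by
      ext φ; simp [SS]
    rw [this]
    refine IsClosed.inter (isClosed_eq (by fun_prop) (by fun_prop)) ?_
    refine isClosed_iInter fun x => isClosed_iInter fun x' => ?_
    exact isClosed_le (by fun_prop) (by fun_prop)
  refine BoundedContinuousFunction.arzela_ascoli₂ (Metric.closedBall 0 (2 * ‖C‖))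
    (isCompact_closedBall _ _) _ (hcl.preimage e.symm.toHomeomorph.continuous) ?_ ?_
  · intro f x hf
    obtain ⟨h1, h2⟩ := hf
    have h3 := h2 x x₀
    have h4 : dist (C x) (C x₀) ≤ 2 * ‖C‖ := by
      rw [dist_eq_norm]
      refine (norm_sub_le _ _).trans ?_
      have := C.norm_coe_le_norm x
      have := C.norm_coe_le_norm x₀
      linarith
    rw [h1, sub_zero] at h3
    rw [mem_closedBall_zero_iff]
    exact h3.trans h4
  · intro x
    refine Metric.equicontinuousAt_of_continuity_modulus (fun x' => dist (C x) (C x')) ?_ _ ?_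
    · have : Tendsto (fun x' => dist (C x) (C x')) (nhds x) (nhds (dist (C x) (C x))) :=
        tendsto_const_nhds.dist (C.continuous.tendsto x)
      rwa [dist_self] at this
    · exact Eventually.of_forall fun x' i => i.2.2 x x'

end transf

section dansk
variable {K : Type*} [MetricSpace K] [CompactSpace K] [MeasurableSpace K] [BorelSpace K]

lemma mul_int (lam : Measure K) (φ : C(K, ℝ)) (q : K → ℝ) (hq : Integrable q lam) :
    Integrable (fun x => φ x * q x) lam :=
  hq.bdd_mul (c := ‖φ‖) φ.continuous.aestronglyMeasurable
    (Eventually.of_forall fun x => φ.norm_coe_le_norm x)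

lemma pair_bd (lam : Measure K) (φ : C(K, ℝ)) (q : K → ℝ) (hq : Integrable q lam) :
    |∫ x, φ x * q x ∂lam| ≤ ‖φ‖ * ∫ x, |q x| ∂lam := by
  rw [← integral_const_mul]
  refine (abs_integral_le_integral_abs).trans (integral_mono (mul_int lam φ q hq).abs
    (hq.abs.const_mul _) fun x => ?_)
  simp only [abs_mul]
  exact mul_le_mul_of_nonneg_right (φ.norm_coe_le_norm x) (abs_nonneg _)

lemma pair_cont (lam : Measure K) (q : K → ℝ) (hq : Integrable q lam) :
    Continuous (fun φ : C(K, ℝ) => ∫ x, φ x * q x ∂lam) := by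
  rw [continuous_iff_continuousAt]
  intro φ
  rw [ContinuousAt, tendsto_iff_dist_tendsto_zero]
  refine squeeze_zero (g := fun ψ => ‖ψ - φ‖ * ∫ x, |q x| ∂lam) (fun _ => dist_nonneg) (fun ψ => ?_) ?_
  · rw [Real.dist_eq, ← integral_sub (mul_int _ _ _ hq) (mul_int _ _ _ hq)]
    refine Eq.trans_le ?_ (pair_bd lam (ψ - φ) q hq)
    simp [sub_mul]
  · have : Continuous fun ψ : C(K, ℝ) => ‖ψ - φ‖ * ∫ x, |q x| ∂lam := by fun_prop
    simpa using this.tendsto φ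

lemma danskin (lam : Measure K) (S : Set C(K, ℝ)) (hS : IsCompact S)
    (B : C(K, ℝ) → ℝ) (hB : Continuous B) (r : ℝ → K → ℝ) (q : K → ℝ)
    (hr0 : Integrable (r 0) lam) (hr : ∀ᶠ t in nhdsWithin (0 : ℝ) (Ioi 0), Integrable (r t) lam)
    (hq : Integrable q lam)
    (hlim : Tendsto (fun t : ℝ => ∫ x, |t⁻¹ * (r t x - r 0 x) - q x| ∂lam)
      (nhdsWithin 0 (Ioi 0)) (nhds 0))
    (F : ℝ → ℝ) (hF0 : ∀ φ ∈ S, ∫ x, φ x * r 0 x ∂lam + B φ ≤ F 0)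
    (hFe : ∃ φ ∈ S, ∫ x, φ x * r 0 x ∂lam + B φ = F 0)
    (hFt : ∀ᶠ t in nhdsWithin (0 : ℝ) (Ioi 0), ∀ φ ∈ S, ∫ x, φ x * r t x ∂lam + B φ ≤ F t)
    (hFte : ∀ᶠ t in nhdsWithin (0 : ℝ) (Ioi 0), ∃ φ ∈ S, ∫ x, φ x * r t x ∂lam + B φ = F t)
    (g : ℝ) (hg : ∀ φ ∈ S, ∫ x, φ x * r 0 x ∂lam + B φ = F 0 → ∫ x, φ x * q x ∂lam = g) :
    Tendsto (fun t => (F t - F 0) / t) (nhdsWithin 0 (Ioi 0)) (nhds g) := by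
  obtain ⟨φ₀, hφ₀, he0⟩ := hFe
  obtain ⟨M, hM⟩ : ∃ M, ∀ φ ∈ S, ‖φ‖ ≤ M := hS.isBounded.exists_norm_le
  have hM0 : 0 ≤ M := (norm_nonneg _).trans (hM φ₀ hφ₀)
  set D : ℝ → ℝ := fun t => ∫ x, |t⁻¹ * (r t x - r 0 x) - q x| ∂lam with hD
  -- main estimate
  have key : ∀ᶠ t in nhdsWithin (0 : ℝ) (Ioi 0), ∀ φ ∈ S,
      |t⁻¹ * (∫ x, φ x * r t x ∂lam - ∫ x, φ x * r 0 x ∂lam) - ∫ x, φ x * q x ∂lam| ≤ M * D t := by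
    filter_upwards [hr] with t ht φ hφ
    have hi : Integrable (fun x => t⁻¹ * (r t x - r 0 x) - q x) lam :=
      ((ht.sub hr0).const_mul _).sub hq
    have h1 := pair_bd lam φ _ hi
    have h2 : ∫ x, φ x * (t⁻¹ * (r t x - r 0 x) - q x) ∂lam =
        t⁻¹ * (∫ x, φ x * r t x ∂lam - ∫ x, φ x * r 0 x ∂lam) - ∫ x, φ x * q x ∂lam := by
      rw [← integral_sub (mul_int _ _ _ ht) (mul_int _ _ _ hr0), ← integral_const_mul,
        ← integral_sub (Integrable.const_mul (Integrable.sub' (mul_int _ _ _ ht)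
          (mul_int _ _ _ hr0)) _) (mul_int _ _ _ hq)]
      congr 1; ext x; ring
    rw [← h2]
    exact h1.trans (mul_le_mul_of_nonneg_right (hM φ hφ) (integral_nonneg fun _ => abs_nonneg _))
  have hMD : Tendsto (fun t => M * D t) (nhdsWithin 0 (Ioi 0)) (nhds 0) := by
    simpa using hlim.const_mul M
  have hch : ∀ t, ∃ ψ : C(K, ℝ), (∃ φ ∈ S, ∫ x, φ x * r t x ∂lam + B φ = F t) →
      ψ ∈ S ∧ ∫ x, ψ x * r t x ∂lam + B ψ = F t := by
    intro t
    by_cases h : ∃ φ ∈ S, ∫ x, φ x * r t x ∂lam + B φ = F t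
    · obtain ⟨φ, h1, h2⟩ := h
      exact ⟨φ, fun _ => ⟨h1, h2⟩⟩
    · exact ⟨0, fun h' => absurd h' h⟩
  choose P hP using hch
  have hP' : ∀ᶠ t in nhdsWithin (0 : ℝ) (Ioi 0),
      P t ∈ S ∧ ∫ x, P t x * r t x ∂lam + B (P t) = F t := hFte.mono fun t ht => hP t ht
  have hpos : ∀ᶠ t in nhdsWithin (0 : ℝ) (Ioi 0), 0 < t := self_mem_nhdsWithin
  set Q := ∫ x, |q x| ∂lam with hQ
  have hQ0 : 0 ≤ Q := integral_nonneg fun _ => abs_nonneg _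
  have key2 : ∀ᶠ t in nhdsWithin (0 : ℝ) (Ioi 0), ∀ φ ∈ S,
      |∫ x, φ x * r t x ∂lam - ∫ x, φ x * r 0 x ∂lam| ≤ t * (M * D t + M * Q) := by
    filter_upwards [key, hpos] with t ht h0 φ hφ
    have h1 := ht φ hφ
    have h2 := pair_bd lam φ q hq
    have h3 : ‖φ‖ * Q ≤ M * Q := mul_le_mul_of_nonneg_right (hM φ hφ) hQ0
    set a := ∫ x, φ x * r t x ∂lam - ∫ x, φ x * r 0 x ∂lam
    have h4 : |t⁻¹ * a| ≤ M * D t + M * Q := by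
      have := abs_sub_abs_le_abs_sub (t⁻¹ * a) (∫ x, φ x * q x ∂lam)
      linarith
    have h5 : |a| = t * |t⁻¹ * a| := by
      rw [abs_mul, abs_of_pos (inv_pos.2 h0)]; field_simp
    rw [h5]
    exact mul_le_mul_of_nonneg_left h4 h0.le
  have htid : Tendsto (fun t : ℝ => t) (nhdsWithin (0 : ℝ) (Ioi 0)) (nhds 0) := nhdsWithin_le_nhds
  have hsmall : Tendsto (fun t => F 0 - 2 * (t * (M * D t + M * Q)))
      (nhdsWithin (0 : ℝ) (Ioi 0)) (nhds (F 0)) := by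
    have := ((htid.mul (hMD.add_const (M * Q))).const_mul 2).const_sub (F 0)
    simpa using this
  have hlow : ∀ᶠ t in nhdsWithin (0 : ℝ) (Ioi 0), F 0 - 2 * (t * (M * D t + M * Q)) ≤
      ∫ x, P t x * r 0 x ∂lam + B (P t) := by
    filter_upwards [key2, hP', hFt] with t h1 h2 h3
    have a1 := abs_le.1 (h1 φ₀ hφ₀)
    have a2 := abs_le.1 (h1 (P t) h2.1)
    have a3 := h3 φ₀ hφ₀
    linarith [a1.1, a2.2, h2.2]
  have hcont0 : Continuous fun φ : C(K, ℝ) => ∫ x, φ x * r 0 x ∂lam + B φ :=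
    (pair_cont lam (r 0) hr0).add hB
  have hlimq : Tendsto (fun t => ∫ x, P t x * q x ∂lam) (nhdsWithin (0 : ℝ) (Ioi 0)) (nhds g) := by
    rw [tendsto_iff_ultrafilter]
    intro U hU
    obtain ⟨φ, hφS, hφ⟩ := hS.ultrafilter_le_nhds (U.map P) (by
      rw [le_principal_iff]
      exact hU (hP'.mono fun t ht => ht.1))
    have hφ' : Tendsto P U (nhds φ) := hφ
    have e1 := (hcont0.tendsto φ).comp hφ'
    have e2 : F 0 ≤ ∫ x, φ x * r 0 x ∂lam + B φ :=
      le_of_tendsto_of_tendsto (hsmall.mono_left hU) e1 (hU hlow)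
    rw [← hg φ hφS (le_antisymm (hF0 φ hφS) e2)]
    exact ((pair_cont lam q hq).tendsto φ).comp hφ'
  have hL : Tendsto (fun t => g - M * D t) (nhdsWithin (0 : ℝ) (Ioi 0)) (nhds g) := by
    simpa using hMD.const_sub g
  have hR : Tendsto (fun t => ∫ x, P t x * q x ∂lam + M * D t)
      (nhdsWithin (0 : ℝ) (Ioi 0)) (nhds g) := by
    simpa using hlimq.add hMD
  refine tendsto_of_tendsto_of_tendsto_of_le_of_le' hL hR ?_ ?_
  · filter_upwards [key, hFt, hpos] with t h1 h2 h3
    have a1 := (abs_le.1 (h1 φ₀ hφ₀)).1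
    rw [hg φ₀ hφ₀ he0] at a1
    have a2 := mul_le_mul_of_nonneg_left (show ∫ x, φ₀ x * r t x ∂lam - ∫ x, φ₀ x * r 0 x ∂lam
      ≤ F t - F 0 by linarith [h2 φ₀ hφ₀]) (inv_pos.2 h3).le
    rw [div_eq_inv_mul]
    linarith
  · filter_upwards [key, hP', hpos] with t h1 h2 h3
    have a1 := (abs_le.1 (h1 _ h2.1)).2
    have a2 := mul_le_mul_of_nonneg_left (show F t - F 0 ≤
      ∫ x, P t x * r t x ∂lam - ∫ x, P t x * r 0 x ∂lam
      by linarith [hF0 _ h2.1, h2.2]) (inv_pos.2 h3).le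
    rw [div_eq_inv_mul]
    linarith
end dansk
section bridge
variable {X : Type*} [MetricSpace X] [MeasurableSpace X] [BorelSpace X]
  [SecondCountableTopology X]

/-- Restriction of the cost, curried. -/
noncomputable def CC (Ω : Set X) (c : X × X → ℝ) (hc : Continuous c) : C(Ω, C(Ω, ℝ)) :=
  (ContinuousMap.mk (fun z : Ω × Ω => c (z.1, z.2)) (by fun_prop)).curry

/-- Restriction of the swapped cost, curried. -/
noncomputable def CC' (Ω : Set X) (c : X × X → ℝ) (hc : Continuous c) : C(Ω, C(Ω, ℝ)) :=
  (ContinuousMap.mk (fun z : Ω × Ω => c (z.2, z.1)) (by fun_prop)).curry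

/-- Extension by zero. -/
noncomputable def ex {Ω : Set X} (φ : C(Ω, ℝ)) : X → ℝ := Function.extend Subtype.val φ 0


lemma ex_apply {Ω : Set X} (φ : C(Ω, ℝ)) (k : Ω) : ex φ k = φ k :=
  Subtype.val_injective.extend_apply _ _ _


lemma ex_cont {Ω : Set X} (φ : C(Ω, ℝ)) : ContinuousOn (ex φ) Ω := by
  rw [continuousOn_iff_continuous_domRestrict]
  have : Ω.domRestrict (ex φ) = φ := by ext k; exact ex_apply φ k
  rw [this]; exact φ.continuous


lemma restr_eq {Ω : Set X} (μ : Measure X) (h0 : μ Ωᶜ = 0) :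
    μ.restrict Ω = μ := by
  apply Measure.restrict_eq_self_of_ae_mem
  exact h0


lemma intK {Ω : Set X} (hΩ : IsCompact Ω) (μ : Measure X) (h0 : μ Ωᶜ = 0) (p : X → ℝ) :
    ∫ k : Ω, p k ∂(μ.comap Subtype.val) = ∫ x, p x ∂μ := by
  rw [integral_subtype_comap hΩ.measurableSet, restr_eq μ h0]


lemma ex_dual {Ω : Set X} [CompactSpace Ω] [Nonempty Ω] (c : X × X → ℝ) (hc : Continuous c)
    (φ : C(Ω, ℝ)) : (ex φ, ex (cT (CC' Ω c hc) φ)) ∈ dualPairs Ω c := by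
  refine ⟨ex_cont _, ex_cont _, fun x hx y hy => ?_⟩
  have h1 := ex_apply φ ⟨x, hx⟩
  have h2 := ex_apply (cT (CC' Ω c hc) φ) ⟨y, hy⟩
  have h3 := cT_le (CC' Ω c hc) φ ⟨y, hy⟩ ⟨x, hx⟩
  simp only at h1 h2 ⊢
  rw [h1, h2, add_comm]
  exact h3

lemma weak {Ω : Set X} (hΩ : IsCompact Ω) (c : X × X → ℝ) (hc : Continuous c)
    (μ ν : Measure X) [IsProbabilityMeasure μ] [IsProbabilityMeasure ν]
    (hμ : μ Ωᶜ = 0) (hν : ν Ωᶜ = 0) (p : (X → ℝ) × (X → ℝ)) (hp : p ∈ dualPairs Ω c)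
    (π : Measure (X × X)) (h1 : π.map Prod.fst = μ) (h2 : π.map Prod.snd = ν) :
    ∫ x, p.1 x ∂μ + ∫ y, p.2 y ∂ν ≤ ∫ z, c z ∂π := by
  have : IsProbabilityMeasure π := ⟨by
    have : (π.map Prod.fst) univ = 1 := by rw [h1]; simp
    rwa [Measure.map_apply measurable_fst MeasurableSet.univ, preimage_univ] at this⟩
  have i1 : Integrable p.1 μ := by
    have := hp.1.integrableOn_compact (μ := μ) hΩ
    rwa [IntegrableOn, restr_eq μ hμ] at this
  have i2 : Integrable p.2 ν := by
    have := hp.2.1.integrableOn_compact (μ := ν) hΩ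
    rwa [IntegrableOn, restr_eq ν hν] at this
  have a1 : ∀ᵐ z ∂π, z.1 ∈ Ω := by
    have : ∀ᵐ x ∂(π.map Prod.fst), x ∈ Ω := by rw [h1]; exact hμ
    exact ae_of_ae_map measurable_fst.aemeasurable this
  have a2 : ∀ᵐ z ∂π, z.2 ∈ Ω := by
    have : ∀ᵐ x ∂(π.map Prod.snd), x ∈ Ω := by rw [h2]; exact hν
    exact ae_of_ae_map measurable_snd.aemeasurable this
  have ic : Integrable c π := by
    have := hc.continuousOn.integrableOn_compact (μ := π) (hΩ.prod hΩ)
    rwa [IntegrableOn, Measure.restrict_eq_self_of_ae_mem] at this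
    filter_upwards [a1, a2] with z hz1 hz2 using ⟨hz1, hz2⟩
  subst h1 h2
  have j1 : Integrable (fun z : X × X => p.1 z.1) π := i1.comp_measurable measurable_fst
  have j2 : Integrable (fun z : X × X => p.2 z.2) π := i2.comp_measurable measurable_snd
  rw [integral_map measurable_fst.aemeasurable i1.1, integral_map measurable_snd.aemeasurable i2.1,
    ← integral_add j1 j2]
  refine integral_mono_ae (j1.add j2) ic ?_
  filter_upwards [a1, a2] with z hz1 hz2 using hp.2.2 _ hz1 _ hz2

lemma duality {Ω : Set X} (hΩ : IsCompact Ω) [CompactSpace Ω] [Nonempty Ω] (x₀ : Ω)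
    (c : X × X → ℝ) (hc : Continuous c) (hc0 : ∀ z, 0 ≤ c z)
    (μ ν : Measure X) [IsProbabilityMeasure μ] [IsProbabilityMeasure ν]
    (hμ : μ Ωᶜ = 0) (hν : ν Ωᶜ = 0) :
    (∀ p ∈ dualPairs Ω c, ∫ x, p.1 x ∂μ + ∫ y, p.2 y ∂ν ≤ Tc c μ ν) ∧
    ∃ φ ∈ SS (CC Ω c hc) x₀, ∫ x, ex φ x ∂μ + ∫ y, ex (cT (CC' Ω c hc) φ) y ∂ν = Tc c μ ν := by
  let μK : Measure Ω := μ.comap Subtype.val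
  let νK : Measure Ω := ν.comap Subtype.val
  have mμ : μK.map Subtype.val = μ := by
    rw [map_comap_subtype_coe hΩ.measurableSet, restr_eq μ hμ]
  have mν : νK.map Subtype.val = ν := by
    rw [map_comap_subtype_coe hΩ.measurableSet, restr_eq ν hν]
  have : IsProbabilityMeasure μK := ⟨by
    have : (μK.map Subtype.val) univ = 1 := by rw [mμ]; simp
    rwa [Measure.map_apply measurable_subtype_coe MeasurableSet.univ, preimage_univ] at this⟩
  have : IsProbabilityMeasure νK := ⟨by
    have : (νK.map Subtype.val) univ = 1 := by rw [mν]; simp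
    rwa [Measure.map_apply measurable_subtype_coe MeasurableSet.univ, preimage_univ] at this⟩
  let cK : C(Ω × Ω, ℝ) := ContinuousMap.mk (fun z : Ω × Ω => c (z.1, z.2)) (by fun_prop)
  obtain ⟨π, hπ1, hπ2, hπ⟩ := strong_dual_s14 μK νK cK
  let i : Ω × Ω → X × X := fun z => (z.1, z.2)
  have hi : Measurable i := by fun_prop
  let π' := π.map i
  have hm1 : π'.map Prod.fst = μ := by
    rw [Measure.map_map measurable_fst hi, ← mμ, ← hπ1,
      Measure.map_map measurable_subtype_coe measurable_fst]; rfl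
  have hm2 : π'.map Prod.snd = ν := by
    rw [Measure.map_map measurable_snd hi, ← mν, ← hπ2,
      Measure.map_map measurable_subtype_coe measurable_snd]; rfl
  have hci : ∫ z, c z ∂π' = ∫ z, cK z ∂π :=
    integral_map hi.aemeasurable hc.aestronglyMeasurable
  have hle : Tc c μ ν ≤ ∫ z, cK z ∂π := by
    rw [← hci]
    refine csInf_le ⟨0, ?_⟩ ⟨π', hm1, hm2, rfl⟩
    rintro r ⟨π, -, -, rfl⟩
    exact integral_nonneg hc0
  have hweak : ∀ p ∈ dualPairs Ω c, ∫ x, p.1 x ∂μ + ∫ y, p.2 y ∂ν ≤ Tc c μ ν := by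
    intro p hp
    refine le_csInf ⟨_, π', hm1, hm2, rfl⟩ ?_
    rintro r ⟨π, h1, h2, rfl⟩
    exact weak hΩ c hc μ ν hμ hν p hp π h1 h2
  refine ⟨hweak, ?_⟩
  let V : C(Ω, ℝ) → ℝ := fun φ => ∫ x, φ x ∂μK + ∫ y, cT (CC' Ω c hc) φ y ∂νK
  have hVc : Continuous V := by
    have h1 := pair_cont μK (fun _ => 1) (integrable_const _)
    have h2 := (pair_cont νK (fun _ => 1) (integrable_const _)).comp (cT_cont (CC' Ω c hc))
    simp only [mul_one] at h1 h2
    exact h1.add h2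
  have hVe : ∀ φ, V φ = ∫ x, ex φ x ∂μ + ∫ y, ex (cT (CC' Ω c hc) φ) y ∂ν := by
    intro φ
    rw [← intK hΩ μ hμ, ← intK hΩ ν hν]
    simp only [ex_apply]
    rfl
  obtain ⟨φ, hφ, hmax⟩ := (SS_compact (CC Ω c hc) x₀).exists_isMaxOn
    ⟨0, by simp [SS]⟩ hVc.continuousOn
  refine ⟨φ, hφ, le_antisymm (hweak _ (ex_dual c hc φ)) ?_⟩
  rw [← hVe]
  refine hle.trans (le_of_forall_pos_le_add fun ε hε => ?_)
  obtain ⟨φ₁, ψ₁, h1, h2⟩ := hπ ε hε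
  refine h2.trans (add_le_add_left ?_ ε)
  let φ₂ := cT (CC Ω c hc) ψ₁
  let a := φ₂ x₀
  let φ₃ : C(Ω, ℝ) := φ₂ - ContinuousMap.const Ω a
  have hφ₃ : φ₃ ∈ SS (CC Ω c hc) x₀ := by
    refine ⟨by simp [φ₃, a], fun x x' => ?_⟩
    have := cT_mod (CC Ω c hc) ψ₁ x x'
    simp only [φ₃, ContinuousMap.sub_apply, ContinuousMap.const_apply, sub_sub_sub_cancel_right]
    exact this
  refine le_trans ?_ (hmax hφ₃)
  have b1 : ∀ x, φ₁ x - a ≤ φ₃ x := fun x => by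
    have : φ₁ x ≤ φ₂ x := le_cT (CC Ω c hc) ψ₁ φ₁ x (fun y => h1 x y)
    simp only [φ₃, ContinuousMap.sub_apply, ContinuousMap.const_apply]; linarith
  have b2 : ∀ y, ψ₁ y + a ≤ cT (CC' Ω c hc) φ₃ y := fun y => by
    refine le_cT (CC' Ω c hc) φ₃ (ψ₁ + ContinuousMap.const Ω a) y (fun x => ?_)
    have : φ₂ x + ψ₁ y ≤ CC' Ω c hc y x := cT_le (CC Ω c hc) ψ₁ x y
    simp only [φ₃, ContinuousMap.sub_apply, ContinuousMap.const_apply, ContinuousMap.add_apply]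
    linarith
  have c1 : ∫ x, (φ₁ x - a) ∂μK ≤ ∫ x, φ₃ x ∂μK :=
    integral_mono ((cm_int φ₁ μK).sub (integrable_const _)) (cm_int _ _) b1
  have c2 : ∫ x, (ψ₁ x + a) ∂νK ≤ ∫ x, cT (CC' Ω c hc) φ₃ x ∂νK :=
    integral_mono ((cm_int ψ₁ νK).add (integrable_const _)) (cm_int _ _) b2
  rw [integral_sub (cm_int _ _) (integrable_const _)] at c1
  rw [integral_add (cm_int _ _) (integrable_const _)] at c2
  simp at c1 c2
  change _ ≤ ∫ x, φ₃ x ∂μK + ∫ y, cT (CC' Ω c hc) φ₃ y ∂νK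
  linarith
end bridge

/-- Under A1–A3, if at `θ₀ ∈ Θ` the difference `φ₂ − φ₁` of any two
Kantorovich potentials for the transport from `ρ(·,θ₀)` to `ρ*` is constant
`ρ(·,θ₀)`-a.e., then `f(θ) = T_c(ρ(·,θ), ρ*)` is Gâteaux differentiable at `θ₀` with
`∇f(θ₀) = ∫_Ω φ ∇_θρ(·,θ₀)` for any Kantorovich potential `φ`. -/
theorem stmt14 (d m : ℕ)
    (Ω : Set (EuclideanSpace ℝ (Fin d))) (hΩ : IsCompact Ω)
    (Θ : Set (Fin m → ℝ)) (hΘ : IsOpen Θ)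
    (ρ : EuclideanSpace ℝ (Fin d) → (Fin m → ℝ) → ℝ)
    (hρint : ∀ θ ∈ Θ, Integrable (fun x => ρ x θ))
    (hρprob : ∀ θ ∈ Θ, (∀ x, 0 ≤ ρ x θ) ∧ (∫ x, ρ x θ) = 1 ∧ ∀ x ∉ Ω, ρ x θ = 0)
    (η : EuclideanSpace ℝ (Fin d) → ℝ) (hη : Integrable η)
    (hρdiff : ∀ x, ∀ θ ∈ Θ, DifferentiableAt ℝ (ρ x) θ ∧ ‖fderiv ℝ (ρ x) θ‖ ≤ η x)
    (c : EuclideanSpace ℝ (Fin d) × EuclideanSpace ℝ (Fin d) → ℝ)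
    (hc : Continuous c) (hcnonneg : ∀ z, 0 ≤ c z)
    (ρstar : Measure (EuclideanSpace ℝ (Fin d)))
    (hρstar : IsProbabilityMeasure ρstar) (hρstarsupp : ρstar Ωᶜ = 0)
    (f : (Fin m → ℝ) → ℝ)
    (hf : ∀ θ, f θ = Tc c (volume.withDensity fun x => ENNReal.ofReal (ρ x θ)) ρstar)
    (θ₀ : Fin m → ℝ) (hθ₀ : θ₀ ∈ Θ)
    -- the potentials are unique up to additive constants, `ρ(·,θ₀)`-a.e.
    (hconst : ∀ p₁ ∈ dualPairs Ω c, ∀ p₂ ∈ dualPairs Ω c,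
      ((∫ x, p₁.1 x * ρ x θ₀) + ∫ y, p₁.2 y ∂ρstar) = f θ₀ →
      ((∫ x, p₂.1 x * ρ x θ₀) + ∫ y, p₂.2 y ∂ρstar) = f θ₀ →
      ∃ C : ℝ, ∀ᵐ x ∂(volume.withDensity fun x => ENNReal.ofReal (ρ x θ₀)),
        p₂.1 x - p₁.1 x = C) :
    ∃ g : (Fin m → ℝ) →ₗ[ℝ] ℝ,
      (∀ v : Fin m → ℝ,
        Tendsto (fun t : ℝ => (f (θ₀ + t • v) - f θ₀) / t) (nhdsWithin 0 (Ioi 0))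
          (nhds (g v))) ∧
      (∀ p ∈ dualPairs Ω c,
        ((∫ x, p.1 x * ρ x θ₀) + ∫ y, p.2 y ∂ρstar) = f θ₀ →
        ∀ v : Fin m → ℝ, g v = ∫ x, p.1 x * (fderiv ℝ (ρ x) θ₀) v) := by
  classical
  have hmeas := hΩ.measurableSet
  have hΩc : CompactSpace Ω := isCompact_iff_compactSpace.1 hΩ
  have hne : Nonempty Ω := by
    by_contra h
    rw [nonempty_subtype] at h
    push Not at h
    have h1 := (hρprob θ₀ hθ₀).2.1
    have h2 : ∀ x, ρ x θ₀ = 0 := fun x => (hρprob θ₀ hθ₀).2.2 x (h x)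
    simp [h2] at h1
  obtain ⟨x₀⟩ := id hne
  set mu : (Fin m → ℝ) → Measure (EuclideanSpace ℝ (Fin d)) :=
    fun θ => volume.withDensity fun x => ENNReal.ofReal (ρ x θ) with hmu
  have hmuint : ∀ θ ∈ Θ, ∀ p : EuclideanSpace ℝ (Fin d) → ℝ,
      ∫ x, p x ∂(mu θ) = ∫ x, p x * ρ x θ := by
    intro θ hθ p
    rw [hmu]
    simp only
    rw [integral_withDensity_eq_integral_toReal_smul₀
      (hρint θ hθ).aestronglyMeasurable.aemeasurable.ennreal_ofReal
      (Eventually.of_forall fun x => ENNReal.ofReal_lt_top)]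
    congr 1; ext x
    rw [ENNReal.toReal_ofReal ((hρprob θ hθ).1 x), smul_eq_mul, mul_comm]
  have hmuprob : ∀ θ ∈ Θ, IsProbabilityMeasure (mu θ) := by
    intro θ hθ
    refine ⟨?_⟩
    rw [hmu]
    simp only
    rw [withDensity_apply _ MeasurableSet.univ, Measure.restrict_univ,
      ← ofReal_integral_eq_lintegral_ofReal (hρint θ hθ)
        (Eventually.of_forall (hρprob θ hθ).1), (hρprob θ hθ).2.1, ENNReal.ofReal_one]
  have hmusupp : ∀ θ ∈ Θ, mu θ Ωᶜ = 0 := by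
    intro θ hθ
    rw [hmu]
    simp only
    rw [withDensity_apply _ hmeas.compl]
    rw [setLIntegral_congr_fun (g := fun _ => 0) hmeas.compl (fun x hx => by
      simp [(hρprob θ hθ).2.2 x hx])]
    simp
  -- transfer of integrals to the compact subtype
  set lam : Measure Ω := (volume : Measure (EuclideanSpace ℝ (Fin d))).comap Subtype.val with hlam
  have htr : ∀ h : EuclideanSpace ℝ (Fin d) → ℝ, (∀ x ∉ Ω, h x = 0) →
      ∫ k : Ω, h k ∂lam = ∫ x, h x := by
    intro h hh
    rw [hlam, integral_subtype_comap hmeas, setIntegral_eq_integral_of_forall_compl_eq_zero hh]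
  have htri : ∀ h : EuclideanSpace ℝ (Fin d) → ℝ, Integrable h →
      Integrable (fun k : Ω => h k) lam := by
    intro h hh
    have h1 : Integrable h (lam.map Subtype.val) := by
      rw [hlam, map_comap_subtype_coe hmeas]; exact hh.restrict
    exact h1.comp_measurable measurable_subtype_coe
  set B : C(Ω, ℝ) → ℝ := fun φ => ∫ y, ex (cT (CC' Ω c hc) φ) y ∂ρstar with hBdef
  have hBc : Continuous B := by
    have : IsFiniteMeasure (ρstar.comap (Subtype.val : Ω → _)) := by
      refine ⟨?_⟩
      rw [(MeasurableEmbedding.subtype_coe hmeas).comap_apply]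
      exact measure_lt_top _ _
    have h2 := (pair_cont (ρstar.comap (Subtype.val : Ω → _)) (fun _ => 1)
      (integrable_const _)).comp (cT_cont (CC' Ω c hc))
    convert h2 using 1
    ext φ
    simp only [hBdef, Function.comp_apply, mul_one]
    rw [← intK hΩ ρstar hρstarsupp]
    simp only [ex_apply]
  have hpairρ : ∀ θ ∈ Θ, ∀ φ : C(Ω, ℝ), ∫ k : Ω, φ k * ρ k θ ∂lam = ∫ x, ex φ x * ρ x θ := by
    intro θ hθ φ
    rw [← htr (fun x => ex φ x * ρ x θ) (fun x hx => by simp [(hρprob θ hθ).2.2 x hx])]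
    simp only [ex_apply]
  have hup : ∀ θ ∈ Θ, ∀ φ : C(Ω, ℝ), ∫ k : Ω, φ k * ρ k θ ∂lam + B φ ≤ f θ := by
    intro θ hθ φ
    have := hmuprob θ hθ
    have h1 := (duality hΩ x₀ c hc hcnonneg (mu θ) ρstar (hmusupp θ hθ) hρstarsupp).1 _
      (ex_dual c hc φ)
    simp only at h1
    rw [hmuint θ hθ, ← hf θ] at h1
    rw [hpairρ θ hθ]
    exact h1
  have hex : ∀ θ ∈ Θ, ∃ φ ∈ SS (CC Ω c hc) x₀, ∫ k : Ω, φ k * ρ k θ ∂lam + B φ = f θ := by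
    intro θ hθ
    have := hmuprob θ hθ
    obtain ⟨φ, h1, h2⟩ :=
      (duality hΩ x₀ c hc hcnonneg (mu θ) ρstar (hmusupp θ hθ) hρstarsupp).2
    refine ⟨φ, h1, ?_⟩
    rw [hmuint θ hθ, ← hf θ] at h2
    rw [hpairρ θ hθ]
    exact h2
  -- the derivative of the density
  obtain ⟨δ, hδ, hball⟩ := Metric.isOpen_iff.1 hΘ θ₀ hθ₀
  have hev : ∀ v : Fin m → ℝ, ∀ᶠ t in nhdsWithin (0 : ℝ) (Ioi 0),
      θ₀ + t • v ∈ Metric.ball θ₀ δ := by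
    intro v
    have hcont : Continuous fun t : ℝ => θ₀ + t • v := by fun_prop
    have h1 : Tendsto (fun t : ℝ => θ₀ + t • v) (nhds 0) (nhds θ₀) := by
      simpa using hcont.tendsto 0
    exact (h1.mono_left nhdsWithin_le_nhds) (Metric.ball_mem_nhds θ₀ hδ)
  have hquot : ∀ v x, Tendsto (fun t : ℝ => t⁻¹ * (ρ x (θ₀ + t • v) - ρ x θ₀))
      (nhdsWithin 0 (Ioi 0)) (nhds (fderiv ℝ (ρ x) θ₀ v)) := by
    intro v x
    have h1 := ((hρdiff x θ₀ hθ₀).1.hasFDerivAt.hasLineDerivAt v)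
    have h2 := hasDerivAt_iff_tendsto_slope_zero.1 h1
    simp only [zero_add, zero_smul, add_zero, smul_eq_mul] at h2
    exact h2.mono_left (nhdsWithin_mono _ fun t ht => ne_of_gt ht)
  have hqbd : ∀ v, ∀ᶠ t in nhdsWithin (0 : ℝ) (Ioi 0), ∀ x,
      |t⁻¹ * (ρ x (θ₀ + t • v) - ρ x θ₀)| ≤ η x * ‖v‖ := by
    intro v
    filter_upwards [hev v, self_mem_nhdsWithin] with t ht (h0 : 0 < t) x
    have h1 := (convex_ball θ₀ δ).norm_image_sub_le_of_norm_fderiv_le (𝕜 := ℝ) (f := ρ x)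
      (C := η x) (fun θ hθ => (hρdiff x θ (hball hθ)).1) (fun θ hθ => (hρdiff x θ (hball hθ)).2)
      (Metric.mem_ball_self hδ) ht
    rw [add_sub_cancel_left, norm_smul, Real.norm_eq_abs, Real.norm_eq_abs, abs_of_pos h0] at h1
    rw [abs_mul, abs_of_pos (inv_pos.2 h0), inv_mul_le_iff₀ h0]
    linarith
  have hqbd2 : ∀ v x, |fderiv ℝ (ρ x) θ₀ v| ≤ η x * ‖v‖ := by
    intro v x
    refine ((fderiv ℝ (ρ x) θ₀).le_opNorm v).trans ?_
    exact mul_le_mul_of_nonneg_right (hρdiff x θ₀ hθ₀).2 (norm_nonneg _)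
  have hqm : ∀ v, AEStronglyMeasurable (fun x => fderiv ℝ (ρ x) θ₀ v)
      (volume : Measure (EuclideanSpace ℝ (Fin d))) := by
    intro v
    obtain ⟨t, ht⟩ := (nhdsWithin (0 : ℝ) (Ioi 0)).exists_seq_tendsto
    obtain ⟨N, hN⟩ := eventually_atTop.1 (ht.eventually (hev v))
    have ht' : Tendsto (fun n => t (n + N)) atTop (nhdsWithin (0 : ℝ) (Ioi 0)) :=
      (tendsto_add_atTop_iff_nat N).2 ht
    refine aestronglyMeasurable_of_tendsto_ae atTop
      (f := fun n x => (t (n + N))⁻¹ * (ρ x (θ₀ + t (n + N) • v) - ρ x θ₀)) (fun n => ?_)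
      (Eventually.of_forall fun x => (hquot v x).comp ht')
    exact (((hρint _ (hball (hN (n + N) (by omega)))).sub (hρint θ₀ hθ₀)).const_mul
      _).aestronglyMeasurable
  have hqi : ∀ v, Integrable (fun x => fderiv ℝ (ρ x) θ₀ v)
      (volume : Measure (EuclideanSpace ℝ (Fin d))) := fun v =>
    (hη.mul_const ‖v‖).mono' (hqm v) (Eventually.of_forall (hqbd2 v))
  have hqΩ : ∀ x ∉ Ω, fderiv ℝ (ρ x) θ₀ = 0 := by
    intro x hx
    have : ρ x =ᶠ[nhds θ₀] fun _ => 0 := by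
      filter_upwards [hΘ.mem_nhds hθ₀] with θ hθ using (hρprob θ hθ).2.2 x hx
    rw [this.fderiv_eq]; simp
  have hq0 : ∀ x, ρ x θ₀ = 0 → fderiv ℝ (ρ x) θ₀ = 0 := by
    intro x hx
    apply IsLocalMin.fderiv_eq_zero
    filter_upwards [hΘ.mem_nhds hθ₀] with θ hθ
    rw [hx]; exact (hρprob θ hθ).1 x
  have hLim : ∀ v, Tendsto (fun t : ℝ =>
      ∫ x, |t⁻¹ * (ρ x (θ₀ + t • v) - ρ x θ₀) - fderiv ℝ (ρ x) θ₀ v|)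
      (nhdsWithin 0 (Ioi 0)) (nhds 0) := by
    intro v
    have hseq : Tendsto (fun t : ℝ =>
        ∫ x, |t⁻¹ * (ρ x (θ₀ + t • v) - ρ x θ₀) - fderiv ℝ (ρ x) θ₀ v|)
        (nhdsWithin 0 (Ioi 0)) (nhds (∫ _ : EuclideanSpace ℝ (Fin d), (0 : ℝ))) := by
      refine tendsto_integral_filter_of_dominated_convergence (fun x => η x * ‖v‖ + η x * ‖v‖)
        ?_ ?_ ((hη.mul_const _).add (hη.mul_const _)) ?_
      · filter_upwards [hev v] with t ht
        exact ((((hρint _ (hball ht)).sub (hρint θ₀ hθ₀)).const_mul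
          _).sub (hqi v)).abs.aestronglyMeasurable
      · filter_upwards [hqbd v] with t ht
        refine Eventually.of_forall fun x => ?_
        rw [Real.norm_eq_abs, abs_abs]
        exact (abs_sub _ _).trans (add_le_add (ht x) (hqbd2 v x))
      · refine Eventually.of_forall fun x => ?_
        have := ((hquot v x).sub_const (fderiv ℝ (ρ x) θ₀ v)).abs
        simpa using this
    simpa using hseq
  have hqmean : ∀ v, ∫ x, fderiv ℝ (ρ x) θ₀ v = 0 := by
    intro v
    have h1 : ∀ᶠ t in nhdsWithin (0 : ℝ) (Ioi 0), |∫ x, fderiv ℝ (ρ x) θ₀ v| ≤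
        ∫ x, |t⁻¹ * (ρ x (θ₀ + t • v) - ρ x θ₀) - fderiv ℝ (ρ x) θ₀ v| := by
      filter_upwards [hev v] with t ht
      have i1 : Integrable (fun x => t⁻¹ * (ρ x (θ₀ + t • v) - ρ x θ₀)) :=
        ((hρint _ (hball ht)).sub (hρint θ₀ hθ₀)).const_mul _
      have e1 : ∫ x, (t⁻¹ * (ρ x (θ₀ + t • v) - ρ x θ₀) - fderiv ℝ (ρ x) θ₀ v) =
          - ∫ x, fderiv ℝ (ρ x) θ₀ v := by
        rw [integral_sub i1 (hqi v), integral_const_mul,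
          integral_sub (hρint _ (hball ht)) (hρint θ₀ hθ₀), (hρprob _ (hball ht)).2.1,
          (hρprob _ hθ₀).2.1]
        ring
      rw [← abs_neg, ← e1]
      exact abs_integral_le_integral_abs
    have h2 : |∫ x, fderiv ℝ (ρ x) θ₀ v| ≤ 0 :=
      le_of_tendsto_of_tendsto tendsto_const_nhds (hLim v) h1
    exact abs_nonpos_iff.1 h2
  -- independence of the potential
  have hpq : ∀ p ∈ dualPairs Ω c, ∀ v,
      Integrable (fun x => p.1 x * fderiv ℝ (ρ x) θ₀ v) := by
    intro p hp v
    have e1 : (fun x => p.1 x * fderiv ℝ (ρ x) θ₀ v) =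
        Ω.indicator (fun x => p.1 x * fderiv ℝ (ρ x) θ₀ v) := by
      ext x
      by_cases hx : x ∈ Ω
      · simp [hx]
      · simp [hx, hqΩ x hx]
    rw [e1, integrable_indicator_iff hmeas]
    exact (hqi v).integrableOn.continuousOn_mul hp.1 hΩ
  have hindep : ∀ p₁ ∈ dualPairs Ω c, ∀ p₂ ∈ dualPairs Ω c,
      ((∫ x, p₁.1 x * ρ x θ₀) + ∫ y, p₁.2 y ∂ρstar) = f θ₀ →
      ((∫ x, p₂.1 x * ρ x θ₀) + ∫ y, p₂.2 y ∂ρstar) = f θ₀ → ∀ v,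
      ∫ x, p₂.1 x * fderiv ℝ (ρ x) θ₀ v = ∫ x, p₁.1 x * fderiv ℝ (ρ x) θ₀ v := by
    intro p₁ h₁ p₂ h₂ e₁ e₂ v
    obtain ⟨C, hC⟩ := hconst p₁ h₁ p₂ h₂ e₁ e₂
    rw [ae_withDensity_iff' (hρint θ₀ hθ₀).aestronglyMeasurable.aemeasurable.ennreal_ofReal] at hC
    have h3 : ∫ x, p₂.1 x * fderiv ℝ (ρ x) θ₀ v =
        ∫ x, (p₁.1 x * fderiv ℝ (ρ x) θ₀ v + C * fderiv ℝ (ρ x) θ₀ v) := by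
      apply integral_congr_ae
      filter_upwards [hC] with x hx
      by_cases h0 : ρ x θ₀ = 0
      · simp [hq0 x h0]
      · have hpos : 0 < ρ x θ₀ := lt_of_le_of_ne ((hρprob θ₀ hθ₀).1 x) (Ne.symm h0)
        have := hx (by simpa using hpos)
        rw [← add_mul]
        congr 1; linarith
    rw [h3, integral_add (hpq p₁ h₁ v) ((hqi v).const_mul C), integral_const_mul, hqmean v]
    simp
  obtain ⟨φ₀, hφ₀S, hφ₀⟩ := hex θ₀ hθ₀
  have hφ₀' : ((∫ x, ex φ₀ x * ρ x θ₀) + ∫ y, ex (cT (CC' Ω c hc) φ₀) y ∂ρstar) = f θ₀ := by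
    rw [← hpairρ θ₀ hθ₀]; exact hφ₀
  let g : (Fin m → ℝ) →ₗ[ℝ] ℝ :=
    { toFun := fun v => ∫ x, ex φ₀ x * fderiv ℝ (ρ x) θ₀ v
      map_add' := fun v w => by
        rw [← integral_add (hpq _ (ex_dual c hc φ₀) v) (hpq _ (ex_dual c hc φ₀) w)]
        congr 1; ext x; simp [mul_add]
      map_smul' := fun a v => by
        simp only [RingHom.id_apply, smul_eq_mul]
        rw [← integral_const_mul]
        congr 1; ext x; simp; ring }
  refine ⟨g, fun v => ?_, fun p hp hpe v => ?_⟩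
  · have hD := danskin lam (SS (CC Ω c hc) x₀) (SS_compact _ _) B hBc
      (fun t k => ρ k (θ₀ + t • v)) (fun k => fderiv ℝ (ρ k) θ₀ v)
      (by simpa using htri _ (hρint θ₀ hθ₀))
      ((hev v).mono fun t ht => htri _ (hρint _ (hball ht)))
      (htri _ (hqi v))
      (by
        refine (hLim v).congr' ?_
        filter_upwards [hev v] with t ht
        simp only [zero_smul, add_zero]
        rw [← htr (fun x => |t⁻¹ * (ρ x (θ₀ + t • v) - ρ x θ₀) - fderiv ℝ (ρ x) θ₀ v|)]
        intro x hx
        simp [hqΩ x hx, (hρprob _ (hball ht)).2.2 x hx, (hρprob _ hθ₀).2.2 x hx])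
      (fun t => f (θ₀ + t • v))
      (fun φ _ => by simpa using hup θ₀ hθ₀ φ)
      ⟨φ₀, hφ₀S, by simpa using hφ₀⟩
      ((hev v).mono fun t ht φ _ => hup _ (hball ht) φ)
      ((hev v).mono fun t ht => hex _ (hball ht))
      (g v) (fun φ hφ he => by
        simp only [zero_smul, add_zero] at he
        rw [hpairρ θ₀ hθ₀] at he
        have h1 := hindep _ (ex_dual c hc φ₀) _ (ex_dual c hc φ) hφ₀' he v
        refine Eq.trans ?_ h1
        rw [← htr _ (fun x hx => by simp [hqΩ x hx])]
        simp only [ex_apply])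
    simpa using hD
  · exact hindep _ hp _ (ex_dual c hc φ₀) hpe hφ₀' v
end

section
/- Let Ω ⊆ ℝᵈ be compact, c ∈ C¹(Ω²), and let ρ, ρ* ∈ P(Ω) with supp(ρ) = cl(int(supp(ρ))). Write int(supp(ρ)) = ∪_k O_k as a union of disjoint open connected components, and let E_k be the closure of the set of points y such that (x,y) ∈ supp(π) for some x ∈ cl(O_k) and some optimal plan π ∈ Γ₀(ρ,ρ*). If all the sets cl(O_k) are mutually linked (i.e., any two can be joined by a finite chain of components whose target sets E intersect consecutively), then for any two pairs of Kantorovich potentials (φ₁,ψ₁), (φ₂,ψ₂), the difference φ₂ − φ₁ is constant ρ-almost everywhere. -/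
open MeasureTheory Set Filter

/-- The (topological) support of a measure. -/
def msupp {X : Type*} [TopologicalSpace X] [MeasurableSpace X]
    (μ : Measure X) : Set X :=
  {x | ∀ U ∈ nhds x, μ U ≠ 0}

/-- The set of optimal transport plans between `μ` and `ν` for the cost `c`. -/
def optPlans {X : Type*} [MeasurableSpace X] (c : X × X → ℝ) (μ ν : Measure X) :
    Set (Measure (X × X)) :=
  {π | π.map Prod.fst = μ ∧ π.map Prod.snd = ν ∧ (∫ z, c z ∂π) = Tc c μ ν}

open scoped Topology NNReal

lemma aux_lip {E : Type*} [NormedAddCommGroup E] [NormedSpace ℝ E] {Ω : Set E}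
    (hΩ : IsCompact Ω) {c : E × E → ℝ} (hc : ContDiffOn ℝ 1 c (Ω ×ˢ Ω)) {x₀ : E}
    (hx₀ : x₀ ∈ interior Ω) :
    ∃ r > 0, ∃ M : ℝ≥0, Metric.ball x₀ r ⊆ Ω ∧
      ∀ y ∈ Ω, LipschitzOnWith M (fun x => c (x, y)) (Metric.ball x₀ r) := by
  obtain ⟨r₀, hr₀, hb₀⟩ := Metric.isOpen_iff.1 isOpen_interior x₀ hx₀
  have hb₀' : Metric.ball x₀ r₀ ⊆ Ω := hb₀.trans interior_subset
  have key : ∃ r > 0, ∃ M : ℝ≥0, ∀ y ∈ Ω, y ∈ Ω →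
      LipschitzOnWith M (fun x => c (x, y)) (Metric.ball x₀ r) := by
    refine hΩ.induction_on (p := fun S => ∃ r > 0, ∃ M : ℝ≥0, ∀ y ∈ S, y ∈ Ω →
      LipschitzOnWith M (fun x => c (x, y)) (Metric.ball x₀ r)) ?_ ?_ ?_ ?_
    · exact ⟨1, one_pos, 0, by simp⟩
    · rintro s t hst ⟨r, hr, M, h⟩
      exact ⟨r, hr, M, fun y hy => h y (hst hy)⟩
    · rintro s t ⟨r, hr, M, h⟩ ⟨r', hr', M', h'⟩
      refine ⟨min r r', lt_min hr hr', max M M', ?_⟩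
      rintro y (hy | hy) hyΩ
      · exact ((h y hy hyΩ).mono (Metric.ball_subset_ball (min_le_left _ _))).weaken
          (le_max_left _ _)
      · exact ((h' y hy hyΩ).mono (Metric.ball_subset_ball (min_le_right _ _))).weaken
          (le_max_right _ _)
    · intro y₀ hy₀
      have hz : (x₀, y₀) ∈ Ω ×ˢ Ω := ⟨interior_subset hx₀, hy₀⟩
      have h1 : ContDiffWithinAt ℝ (0 + 1) c (Ω ×ˢ Ω) (x₀, y₀) := by simpa using hc _ hz
      obtain ⟨u, hu, -, -, f', hf', hcf'⟩ :=
        (contDiffWithinAt_succ_iff_hasFDerivWithinAt' (by simp)).1 h1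
      rw [insert_eq_of_mem hz] at hu
      have hcont := hcf'.continuousWithinAt
      have hbd : ∀ᶠ z in 𝓝[Ω ×ˢ Ω] (x₀, y₀), ‖f' z‖ < ‖f' (x₀, y₀)‖ + 1 :=
        hcont.norm.eventually_lt_const (by linarith)
      have hboth := hbd.and hu
      rw [Filter.Eventually, Metric.mem_nhdsWithin_iff] at hboth
      obtain ⟨ε, hε, hεs⟩ := hboth
      refine ⟨Metric.ball y₀ ε, mem_nhdsWithin_of_mem_nhds (Metric.ball_mem_nhds _ hε),
        min ε r₀, lt_min hε hr₀, ‖f' (x₀, y₀)‖₊ + 1, ?_⟩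
      intro y hy hyΩ
      have hmem : ∀ x ∈ Metric.ball x₀ (min ε r₀), x ∈ Ω ∧ (‖f' (x, y)‖ < ‖f' (x₀, y₀)‖ + 1 ∧
          (x, y) ∈ u) := by
        intro x hx
        have hxΩ : x ∈ Ω := hb₀' (Metric.ball_subset_ball (min_le_right _ _) hx)
        refine ⟨hxΩ, hεs ⟨?_, hxΩ, hyΩ⟩⟩
        rw [← ball_prod_same]
        exact ⟨Metric.ball_subset_ball (min_le_left _ _) hx, hy⟩
      refine Convex.lipschitzOnWith_of_nnnorm_hasFDerivWithin_le (𝕜 := ℝ)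
        (f' := fun x => (f' (x, y)).comp (ContinuousLinearMap.inl ℝ E E)) ?_ ?_
        (convex_ball _ _)
      · intro x hx
        have := hf' _ (hmem x hx).2.2
        refine HasFDerivWithinAt.comp (t := Ω ×ˢ Ω) x this
          (hasFDerivAt_prodMk_left x y).hasFDerivWithinAt ?_
        intro x' hx'
        exact ⟨(hmem x' hx').1, hyΩ⟩
      · intro x hx
        rw [← NNReal.coe_le_coe]
        change ‖(f' (x, y)).comp (ContinuousLinearMap.inl ℝ E E)‖ ≤ ‖f' (x₀, y₀)‖ + 1
        calc _ ≤ ‖f' (x, y)‖ * ‖ContinuousLinearMap.inl ℝ E E‖ :=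
              ContinuousLinearMap.opNorm_comp_le _ _
          _ ≤ ‖f' (x, y)‖ * 1 := by
              gcongr
              exact ContinuousLinearMap.norm_inl_le_one _ _ _
          _ ≤ _ := by linarith [(hmem x hx).2.1]
  obtain ⟨r, hr, M, h⟩ := key
  refine ⟨min r r₀, lt_min hr hr₀, M, ?_, ?_⟩
  · exact (Metric.ball_subset_ball (min_le_right _ _)).trans hb₀'
  · intro y hy
    exact (h y hy hy).mono (Metric.ball_subset_ball (min_le_left _ _))

lemma aux_ball {E : Type*} [NormedAddCommGroup E] [NormedSpace ℝ E] {c : E → E → ℝ}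
    {φ₁ φ₂ ψ₁ ψ₂ : E → ℝ} {Ω : Set E} {x₀ : E} {r : ℝ} {M : ℝ≥0}
    (hd : ∀ y ∈ Ω, ∀ x ∈ Metric.ball x₀ r, DifferentiableAt ℝ (fun x => c x y) x)
    (hL : ∀ y ∈ Ω, LipschitzOnWith M (fun x => c x y) (Metric.ball x₀ r))
    (h₁ : ∀ x ∈ Metric.ball x₀ r, ∀ y ∈ Ω, φ₁ x + ψ₁ y ≤ c x y)
    (h₂ : ∀ x ∈ Metric.ball x₀ r, ∀ y ∈ Ω, φ₂ x + ψ₂ y ≤ c x y)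
    (hct : ∀ x ∈ Metric.ball x₀ r, ∃ y ∈ Ω, φ₁ x + ψ₁ y = c x y ∧ φ₂ x + ψ₂ y = c x y)
    {x : E} (hx : x ∈ Metric.ball x₀ r) : φ₂ x - φ₁ x = φ₂ x₀ - φ₁ x₀ := by
  have hr : 0 < r := dist_nonneg.trans_lt hx
  set v := x - x₀
  let γ : ℝ → E := fun t => x₀ + t • v
  have hγd : ∀ t, DifferentiableAt ℝ γ t := fun t => by fun_prop
  have hγL : LipschitzWith ‖v‖₊ γ := by
    refine LipschitzWith.of_dist_le_mul fun s t => ?_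
    simp only [γ, dist_eq_norm, coe_nnnorm]
    rw [mul_comm, add_sub_add_left_eq_sub, ← sub_smul, norm_smul]
  have hγm : ∀ t ∈ uIcc (0:ℝ) 1, γ t ∈ Metric.ball x₀ r := by
    intro t ht
    rw [uIcc_of_le zero_le_one] at ht
    have : γ t ∈ segment ℝ x₀ x := by
      rw [segment_eq_image']
      exact ⟨t, ht, rfl⟩
    exact (convex_ball x₀ r).segment_subset (Metric.mem_ball_self hr) hx this
  have gen : ∀ φ ψ : E → ℝ, (∀ x ∈ Metric.ball x₀ r, ∀ y ∈ Ω, φ x + ψ y ≤ c x y) →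
      (∀ x ∈ Metric.ball x₀ r, ∃ y ∈ Ω, φ x + ψ y = c x y) →
      AbsolutelyContinuousOnInterval (fun t => φ (γ t)) 0 1 := by
    intro φ ψ h hc'
    have hl : LipschitzOnWith M φ (Metric.ball x₀ r) := by
      refine LipschitzOnWith.of_le_add_mul _ fun a ha b hb => ?_
      obtain ⟨y, hy, hyb⟩ := hc' b hb
      have h1 := h a ha y hy
      have h2 := (hL y hy).dist_le_mul a ha b hb
      rw [Real.dist_eq] at h2
      have h3 := le_abs_self (c a y - c b y)
      linarith
    exact (hl.comp hγL.lipschitzOnWith hγm).absolutelyContinuousOnInterval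
  have a₁ := gen φ₁ ψ₁ h₁ fun x hx => by
    obtain ⟨y, hy, h, -⟩ := hct x hx
    exact ⟨y, hy, h⟩
  have a₂ := gen φ₂ ψ₂ h₂ fun x hx => by
    obtain ⟨y, hy, -, h⟩ := hct x hx
    exact ⟨y, hy, h⟩
  have hder : ∀ᵐ t : ℝ, t ∈ uIcc (0:ℝ) 1 → HasDerivAt (fun t => φ₂ (γ t) - φ₁ (γ t)) 0 t := by
    filter_upwards [a₁.ae_differentiableAt, a₂.ae_differentiableAt] with t ht₁ ht₂ ht
    obtain ⟨y, hy, e₁, e₂⟩ := hct _ (hγm t ht)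
    have hcd : DifferentiableAt ℝ (fun s => c (γ s) y) t :=
      DifferentiableAt.comp t (hd y hy _ (hγm t ht)) (hγd t)
    have hev : ∀ᶠ s in 𝓝 t, γ s ∈ Metric.ball x₀ r :=
      (hγd t).continuousAt.eventually_mem (Metric.isOpen_ball.mem_nhds (hγm t ht))
    have dd : ∀ φ ψ : E → ℝ, (∀ x ∈ Metric.ball x₀ r, ∀ y ∈ Ω, φ x + ψ y ≤ c x y) →
        φ (γ t) + ψ y = c (γ t) y → DifferentiableAt ℝ (fun t => φ (γ t)) t →
        HasDerivAt (fun t => φ (γ t)) (deriv (fun s => c (γ s) y) t) t := by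
      intro φ ψ h e hdf
      have hmin : IsLocalMin ((fun s => c (γ s) y) - (fun t => φ (γ t))) t := by
        filter_upwards [hev] with s hs
        have := h _ hs y hy
        simp only [Pi.sub_apply]
        linarith
      have h0 := hmin.deriv_eq_zero
      rw [deriv_sub hcd hdf] at h0
      rw [sub_eq_zero.1 h0]
      exact hdf.hasDerivAt
    have := (dd φ₂ ψ₂ h₂ e₂ (ht₂ ht)).sub (dd φ₁ ψ₁ h₁ e₁ (ht₁ ht))
    rw [sub_self] at this
    exact this
  obtain ⟨C, hC⟩ := (a₂.sub a₁).const_of_ae_hasDerivAt_zero hder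
  have e0 := hC (x := 0) (by simp)
  have e1 := hC (x := 1) (by simp)
  simp [γ, v] at e0 e1
  linarith


lemma aux_msupp_subset {X : Type*} [TopologicalSpace X] [MeasurableSpace X] {μ : Measure X}
    {F : Set X} (hF : IsClosed F) (h : μ Fᶜ = 0) : msupp μ ⊆ F := by
  intro x hx
  by_contra hxF
  exact hx _ (hF.isOpen_compl.mem_nhds hxF) h

lemma aux_msupp_compl {X : Type*} [TopologicalSpace X] [SecondCountableTopology X]
    [MeasurableSpace X] (μ : Measure X) : μ (msupp μ)ᶜ = 0 := by
  refine measure_null_of_locally_null _ fun x hx => ?_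
  simp only [msupp, mem_compl_iff, mem_ofPred_eq, not_forall, not_not] at hx
  obtain ⟨U, hU, h0⟩ := hx
  exact ⟨U, mem_nhdsWithin_of_mem_nhds hU, h0⟩

section
variable {E : Type*} [NormedAddCommGroup E] [MeasurableSpace E] [BorelSpace E]
  [SecondCountableTopology E]

lemma aux_integrable {X : Type*} [TopologicalSpace X] [T2Space X] [MeasurableSpace X]
    [BorelSpace X] [SecondCountableTopology X]
    {K : Set X} (hK : IsCompact K) {μ : Measure X} [IsFiniteMeasure μ] (h : μ Kᶜ = 0)
    {f : X → ℝ} (hf : ContinuousOn f K) : Integrable f μ := by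
  have := hf.integrableOn_compact (μ := μ) hK
  rwa [IntegrableOn, Measure.restrict_eq_self_of_ae_mem] at this
  exact h

lemma aux_prod {Ω : Set E} (hΩ : IsCompact Ω) {μ ν : Measure E} (hμ : μ Ωᶜ = 0) (hν : ν Ωᶜ = 0)
    {π : Measure (E × E)} (h1 : π.map Prod.fst = μ) (h2 : π.map Prod.snd = ν) :
    π (Ω ×ˢ Ω)ᶜ = 0 := by
  rw [← h1, Measure.map_apply measurable_fst hΩ.measurableSet.compl] at hμ
  rw [← h2, Measure.map_apply measurable_snd hΩ.measurableSet.compl] at hν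
  refine measure_mono_null ?_ (measure_union_null hμ hν)
  intro z hz
  simp only [mem_compl_iff, mem_prod, not_and_or] at hz
  exact hz

lemma aux_gap {Ω : Set E} (hΩ : IsCompact Ω) {c : E × E → ℝ} (hc : ContinuousOn c (Ω ×ˢ Ω))
    {μ ν : Measure E} [hpμ : IsProbabilityMeasure μ] [IsProbabilityMeasure ν]
    (hμ : μ Ωᶜ = 0) (hν : ν Ωᶜ = 0)
    {π : Measure (E × E)} (h1 : π.map Prod.fst = μ) (h2 : π.map Prod.snd = ν)
    {p : (E → ℝ) × (E → ℝ)} (hp : p ∈ dualPairs Ω c) :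
    Integrable (fun z => c z - p.1 z.1 - p.2 z.2) π ∧
    ∫ z, (c z - p.1 z.1 - p.2 z.2) ∂π = ∫ z, c z ∂π - ((∫ x, p.1 x ∂μ) + ∫ y, p.2 y ∂ν) := by
  have hπ : IsFiniteMeasure π := by
    constructor
    have := hpμ.measure_univ
    rw [← h1, Measure.map_apply measurable_fst MeasurableSet.univ, preimage_univ] at this
    simp [this]
  have i1 : Integrable p.1 μ := aux_integrable hΩ hμ hp.1
  have i2 : Integrable p.2 ν := aux_integrable hΩ hν hp.2.1
  have ic : Integrable c π := aux_integrable (hΩ.prod hΩ) (aux_prod hΩ hμ hν h1 h2) hc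
  subst h1
  subst h2
  have j1 : Integrable (fun z : E × E => p.1 z.1) π := i1.comp_measurable measurable_fst
  have j2 : Integrable (fun z : E × E => p.2 z.2) π := i2.comp_measurable measurable_snd
  refine ⟨(ic.sub j1).sub j2, ?_⟩
  have k1 : Integrable (fun z : E × E => c z - p.1 z.1) π := ic.sub j1
  rw [integral_sub k1 j2, integral_sub ic j1,
    integral_map measurable_fst.aemeasurable i1.1, integral_map measurable_snd.aemeasurable i2.1]
  ring

lemma aux_gap_cont {Ω : Set E} {c : E × E → ℝ} (hc : ContinuousOn c (Ω ×ˢ Ω))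
    {p : (E → ℝ) × (E → ℝ)} (hp : p ∈ dualPairs Ω c) :
    ContinuousOn (fun z : E × E => c z - p.1 z.1 - p.2 z.2) (Ω ×ˢ Ω) :=
  (hc.sub (hp.1.comp continuousOn_fst fun _ hz => hz.1)).sub
    (hp.2.1.comp continuousOn_snd fun _ hz => hz.2)

lemma aux_contact {Ω : Set E} (hΩ : IsCompact Ω) {c : E × E → ℝ} (hc : ContinuousOn c (Ω ×ˢ Ω))
    {μ ν : Measure E} [hpμ : IsProbabilityMeasure μ] [hpν : IsProbabilityMeasure ν]
    (hμ : μ Ωᶜ = 0) (hν : ν Ωᶜ = 0)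
    {p₁ p₂ : (E → ℝ) × (E → ℝ)} (hp₁ : p₁ ∈ dualPairs Ω c) (hp₂ : p₂ ∈ dualPairs Ω c)
    (o₁ : ((∫ x, p₁.1 x ∂μ) + ∫ y, p₁.2 y ∂ν) = Tc c μ ν)
    (o₂ : ((∫ x, p₂.1 x ∂μ) + ∫ y, p₂.2 y ∂ν) = Tc c μ ν)
    {x : E} (hx : x ∈ msupp μ) :
    ∃ y ∈ Ω, p₁.1 x + p₁.2 y = c (x, y) ∧ p₂.1 x + p₂.2 y = c (x, y) := by
  have hxΩ : x ∈ Ω := aux_msupp_subset hΩ.isClosed hμ hx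
  by_contra! hcon
  let G : E × E → ℝ := fun z => (c z - p₁.1 z.1 - p₁.2 z.2) + (c z - p₂.1 z.1 - p₂.2 z.2)
  have hG : ContinuousOn G (Ω ×ˢ Ω) := (aux_gap_cont hc hp₁).add (aux_gap_cont hc hp₂)
  have hG0 : ∀ z ∈ Ω ×ˢ Ω, 0 ≤ G z := by
    rintro ⟨a, b⟩ ⟨ha, hb⟩
    have e1 := hp₁.2.2 a ha b hb
    have e2 := hp₂.2.2 a ha b hb
    simp only [G]
    linarith
  have hGx : ContinuousOn (fun y => G (x, y)) Ω :=
    hG.comp (by fun_prop) fun y hy => ⟨hxΩ, hy⟩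
  obtain ⟨y₀, hy₀, hmin⟩ := hΩ.exists_isMinOn ⟨x, hxΩ⟩ hGx
  have hm : 0 < G (x, y₀) := by
    have e1 := hp₁.2.2 x hxΩ y₀ hy₀
    have e2 := hp₂.2.2 x hxΩ y₀ hy₀
    have e3 := hcon y₀ hy₀
    by_contra hn
    simp only [G] at hn
    exact e3 (by linarith) (by linarith)
  set m := G (x, y₀) with hmdef
  let K : Set (E × E) := (Ω ×ˢ Ω) ∩ G ⁻¹' Iic (m / 2)
  have hKc : IsClosed K :=
    hG.preimage_isClosed_of_isClosed (hΩ.prod hΩ).isClosed isClosed_Iic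
  have hK : IsCompact K := (hΩ.prod hΩ).of_isClosed_subset hKc inter_subset_left
  let U : Set E := (Prod.fst '' K)ᶜ
  have hU : IsOpen U := (hK.image continuous_fst).isClosed.isOpen_compl
  have hxU : x ∈ U := by
    rintro ⟨⟨a, b⟩, ⟨⟨ha, hb⟩, hle⟩, rfl⟩
    have h1 : m ≤ G (a, b) := hmin hb
    have h2 : G (a, b) ≤ m / 2 := hle
    linarith
  have hμU : 0 < μ.real U :=
    ENNReal.toReal_pos (hx U (hU.mem_nhds hxU)) (measure_ne_top _ _)
  have hall : ∀ r ∈ {r : ℝ | ∃ π : Measure (E × E),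
      π.map Prod.fst = μ ∧ π.map Prod.snd = ν ∧ r = ∫ z, c z ∂π},
      Tc c μ ν + m / 4 * μ.real U ≤ r := by
    rintro r ⟨π, h1, h2, rfl⟩
    obtain ⟨g1, e1⟩ := aux_gap hΩ hc hμ hν h1 h2 hp₁
    obtain ⟨g2, e2⟩ := aux_gap hΩ hc hμ hν h1 h2 hp₂
    have hπ : IsFiniteMeasure π := by
      constructor
      have := hpμ.measure_univ
      rw [← h1, Measure.map_apply measurable_fst MeasurableSet.univ, preimage_univ] at this
      simp [this]
    have hms : MeasurableSet (Prod.fst ⁻¹' U : Set (E × E)) := measurable_fst hU.measurableSet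
    have hreal : π.real (Prod.fst ⁻¹' U) = μ.real U := by
      rw [← h1, map_measureReal_apply measurable_fst hU.measurableSet]
    have hle : ∫ z, (Prod.fst ⁻¹' U : Set (E × E)).indicator (fun _ => m / 2) z ∂π
        ≤ ∫ z, G z ∂π := by
      refine integral_mono_ae ((integrable_const _).indicator hms) (g1.add g2) ?_
      have hae : ∀ᵐ z ∂π, z ∈ Ω ×ˢ Ω := aux_prod hΩ hμ hν h1 h2
      filter_upwards [hae] with z hz
      by_cases hzU : z ∈ (Prod.fst ⁻¹' U : Set (E × E))
      · rw [indicator_of_mem hzU]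
        by_contra hn
        exact hzU ⟨z, ⟨hz, (not_le.1 hn).le⟩, rfl⟩
      · rw [indicator_of_notMem hzU]
        exact hG0 z hz
    rw [integral_indicator_const _ hms, hreal, smul_eq_mul] at hle
    have : ∫ z, G z ∂π = _ := integral_add g1 g2
    rw [this, e1, e2, o₁, o₂] at hle
    linarith
  have hne : {r : ℝ | ∃ π : Measure (E × E),
      π.map Prod.fst = μ ∧ π.map Prod.snd = ν ∧ r = ∫ z, c z ∂π}.Nonempty :=
    ⟨_, μ.prod ν, by simp, by simp, rfl⟩
  have := le_csInf hne hall
  change _ ≤ Tc c μ ν at this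
  have : 0 < m / 4 * μ.real U := by positivity
  linarith

lemma aux_msupp_contact {Ω : Set E} (hΩ : IsCompact Ω) {c : E × E → ℝ}
    (hc : ContinuousOn c (Ω ×ˢ Ω))
    {μ ν : Measure E} [hpμ : IsProbabilityMeasure μ] [hpν : IsProbabilityMeasure ν]
    (hμ : μ Ωᶜ = 0) (hν : ν Ωᶜ = 0)
    {p : (E → ℝ) × (E → ℝ)} (hp : p ∈ dualPairs Ω c)
    (o : ((∫ x, p.1 x ∂μ) + ∫ y, p.2 y ∂ν) = Tc c μ ν)
    {π : Measure (E × E)} (hπ : π ∈ optPlans c μ ν) {x y : E} (hz : (x, y) ∈ msupp π) :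
    x ∈ Ω ∧ y ∈ Ω ∧ p.1 x + p.2 y = c (x, y) := by
  obtain ⟨h1, h2, h3⟩ := hπ
  obtain ⟨g, e⟩ := aux_gap hΩ hc hμ hν h1 h2 hp
  rw [h3, o, sub_self] at e
  have hae : ∀ᵐ z ∂π, z ∈ Ω ×ˢ Ω := aux_prod hΩ hμ hν h1 h2
  have hnn : 0 ≤ᵐ[π] fun z => c z - p.1 z.1 - p.2 z.2 := by
    filter_upwards [hae] with z hz
    have := hp.2.2 z.1 hz.1 z.2 hz.2
    simp only [Pi.zero_apply, Prod.mk.eta] at this ⊢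
    linarith
  have h0 := (integral_eq_zero_iff_of_nonneg_ae hnn g).1 e
  have hF := (aux_gap_cont hc hp).preimage_isClosed_of_isClosed (hΩ.prod hΩ).isClosed
    (isClosed_singleton (x := (0 : ℝ)))
  have := aux_msupp_subset (μ := π) hF (by
    refine mem_ae_iff.1 ?_
    filter_upwards [hae, h0] with z hz hz0
    exact ⟨hz, hz0⟩) hz
  obtain ⟨⟨ha, hb⟩, hab⟩ := this
  refine ⟨ha, hb, ?_⟩
  simp only [mem_preimage, mem_singleton_iff] at hab
  linarith

end

lemma aux_preconn {E : Type*} [PseudoMetricSpace E] {O : Set E} (hO : IsPreconnected O)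
    {g : E → ℝ} (h : ∀ x ∈ O, ∀ᶠ x' in 𝓝 x, g x' = g x)
    {a b : E} (ha : a ∈ O) (hb : b ∈ O) : g a = g b := by
  have : PreconnectedSpace O := isPreconnected_iff_preconnectedSpace.1 hO
  have hl : IsLocallyConstant (fun x : O => g x) := by
    rw [IsLocallyConstant.iff_eventually_eq]
    intro x
    exact continuous_subtype_val.continuousAt.eventually (h x x.2)
  exact hl.apply_eq_of_isPreconnected isPreconnected_univ (x := ⟨a, ha⟩) (y := ⟨b, hb⟩)
    trivial trivial

/-- Let `Ω ⊆ ℝᵈ` be compact, `c ∈ C¹(Ω²)` and `ρ, ρ* ∈ P(Ω)` with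
`supp(ρ) = cl(int(supp(ρ)))`.  Write `int(supp(ρ)) = ∪ₖ Oₖ` as a disjoint union of
open connected components, and let `Eₖ` be the closure of the set of targets of
`cl(Oₖ)` under optimal plans.  If all `cl(Oₖ)` are mutually linked (joined by finite
chains of components with consecutively intersecting target sets), then any two pairs
of Kantorovich potentials differ (in the first component) by a constant, `ρ`-a.e. -/
theorem stmt15 (d : ℕ)
    (Ω : Set (EuclideanSpace ℝ (Fin d))) (hΩ : IsCompact Ω)
    (c : EuclideanSpace ℝ (Fin d) × EuclideanSpace ℝ (Fin d) → ℝ)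
    (hc : ContDiffOn ℝ 1 c (Ω ×ˢ Ω))
    (μ ρstar : Measure (EuclideanSpace ℝ (Fin d)))
    (hμ : IsProbabilityMeasure μ) (hμΩ : μ Ωᶜ = 0)
    (hρstar : IsProbabilityMeasure ρstar) (hρstarΩ : ρstar Ωᶜ = 0)
    (hsupp : msupp μ = closure (interior (msupp μ)))
    (ι : Type) (O : ι → Set (EuclideanSpace ℝ (Fin d)))
    (hOopen : ∀ k, IsOpen (O k)) (hOconn : ∀ k, IsConnected (O k))
    (hOdisj : Pairwise (Function.onFun Disjoint O))
    (hOunion : (⋃ k, O k) = interior (msupp μ))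
    (Eset : ι → Set (EuclideanSpace ℝ (Fin d)))
    (hEset : ∀ k, Eset k = closure {y | ∃ x ∈ closure (O k),
      ∃ π ∈ optPlans c μ ρstar, (x, y) ∈ msupp π})
    (hlinked : ∀ k l : ι,
      Relation.ReflTransGen (fun i j => (Eset i ∩ Eset j).Nonempty) k l) :
    ∀ p₁ ∈ dualPairs Ω c, ∀ p₂ ∈ dualPairs Ω c,
      ((∫ x, p₁.1 x ∂μ) + ∫ y, p₁.2 y ∂ρstar) = Tc c μ ρstar →
      ((∫ x, p₂.1 x ∂μ) + ∫ y, p₂.2 y ∂ρstar) = Tc c μ ρstar →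
      ∃ C : ℝ, ∀ᵐ x ∂μ, p₂.1 x - p₁.1 x = C := by
  intro p₁ hp₁ p₂ hp₂ o₁ o₂
  have hcc : ContinuousOn c (Ω ×ˢ Ω) := hc.continuousOn
  have hsub : msupp μ ⊆ Ω := aux_msupp_subset hΩ.isClosed hμΩ
  have hOs : ∀ k, O k ⊆ interior (msupp μ) := fun k => hOunion ▸ subset_iUnion O k
  have hOi : ∀ k, O k ⊆ interior Ω := fun k => (hOs k).trans (interior_mono hsub)
  have hclO : ∀ k, closure (O k) ⊆ Ω := fun k =>
    closure_minimal ((hOi k).trans interior_subset) hΩ.isClosed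
  have hgc : ContinuousOn (fun x => p₂.1 x - p₁.1 x) Ω := hp₂.1.sub hp₁.1
  -- local constancy
  have hloc : ∀ x ∈ interior (msupp μ), ∀ᶠ x' in 𝓝 x,
      p₂.1 x' - p₁.1 x' = p₂.1 x - p₁.1 x := by
    intro x hx
    obtain ⟨r₁, hr₁, M, hb, hL⟩ := aux_lip hΩ hc (interior_mono hsub hx)
    obtain ⟨r₂, hr₂, hb₂⟩ := Metric.isOpen_iff.1 isOpen_interior x hx
    have hs1 : Metric.ball x (min r₁ r₂) ⊆ Metric.ball x r₁ :=
      Metric.ball_subset_ball (min_le_left _ _)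
    have hs2 : Metric.ball x (min r₁ r₂) ⊆ interior (msupp μ) :=
      (Metric.ball_subset_ball (min_le_right _ _)).trans hb₂
    filter_upwards [Metric.ball_mem_nhds x (lt_min hr₁ hr₂)] with x' hx'
    refine aux_ball (c := fun x y => c (x, y)) (ψ₁ := p₁.2) (ψ₂ := p₂.2) (Ω := Ω) (M := M)
      ?_ ?_ ?_ ?_ ?_ hx'
    · intro y hy z hz
      have hd := hc.differentiableOn one_ne_zero (z, y) ⟨hb (hs1 hz), hy⟩
      have : DifferentiableWithinAt ℝ (fun x => c (x, y)) Ω z :=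
        DifferentiableWithinAt.comp (t := Ω ×ˢ Ω) z hd (by fun_prop) fun w hw => ⟨hw, hy⟩
      exact this.differentiableAt (mem_interior_iff_mem_nhds.1 (interior_mono hsub (hs2 hz)))
    · exact fun y hy => (hL y hy).mono hs1
    · exact fun z hz y hy => hp₁.2.2 z (hb (hs1 hz)) y hy
    · exact fun z hz y hy => hp₂.2.2 z (hb (hs1 hz)) y hy
    · exact fun z hz => aux_contact hΩ hcc hμΩ hρstarΩ hp₁ hp₂ o₁ o₂ (interior_subset (hs2 hz))
  -- constancy on components
  choose pt hpt using fun k => (hOconn k).nonempty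
  have hcl : ∀ k, ∀ x ∈ closure (O k),
      p₂.1 x - p₁.1 x = p₂.1 (pt k) - p₁.1 (pt k) := by
    intro k
    have h1 : EqOn (fun x => p₂.1 x - p₁.1 x) (fun _ => p₂.1 (pt k) - p₁.1 (pt k)) (O k) :=
      fun x hx => aux_preconn (g := fun x => p₂.1 x - p₁.1 x) (hOconn k).isPreconnected
        (fun z hz => hloc z (hOs k hz)) hx (hpt k)
    exact h1.of_subset_closure (hgc.mono (hclO k)) continuousOn_const subset_closure le_rfl
  -- targets
  have hE : ∀ k, ∀ y ∈ Eset k,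
      p₂.2 y - p₁.2 y = - (p₂.1 (pt k) - p₁.1 (pt k)) := by
    intro k
    rw [hEset k]
    set S := {y | ∃ x ∈ closure (O k), ∃ π ∈ optPlans c μ ρstar, (x, y) ∈ msupp π}
    have hS : S ⊆ Ω := by
      rintro y ⟨x, hx, π, hπ, hz⟩
      exact (aux_msupp_contact hΩ hcc hμΩ hρstarΩ hp₁ o₁ hπ hz).2.1
    have h1 : EqOn (fun y => p₂.2 y - p₁.2 y) (fun _ => -(p₂.1 (pt k) - p₁.1 (pt k))) S := by
      rintro y ⟨x, hx, π, hπ, hz⟩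
      have e1 := (aux_msupp_contact hΩ hcc hμΩ hρstarΩ hp₁ o₁ hπ hz).2.2
      have e2 := (aux_msupp_contact hΩ hcc hμΩ hρstarΩ hp₂ o₂ hπ hz).2.2
      have e3 := hcl k x hx
      simp only
      linarith
    exact h1.of_subset_closure ((hp₂.2.1.sub hp₁.2.1).mono (closure_minimal hS hΩ.isClosed))
      continuousOn_const subset_closure le_rfl
  have hlink : ∀ k l, p₂.1 (pt k) - p₁.1 (pt k) = p₂.1 (pt l) - p₁.1 (pt l) := by
    intro k l
    induction hlinked k l with
    | refl => rfl
    | tail _ hij ih =>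
      obtain ⟨y, hyi, hyj⟩ := hij
      have e1 := hE _ y hyi
      have e2 := hE _ y hyj
      linarith
  have hae : ∀ᵐ x ∂μ, x ∈ msupp μ := aux_msupp_compl μ
  rcases isEmpty_or_nonempty ι with hι | ⟨⟨k⟩⟩
  · refine ⟨0, ?_⟩
    filter_upwards [hae] with x hx
    rw [hsupp, ← hOunion] at hx
    simp at hx
  · refine ⟨p₂.1 (pt k) - p₁.1 (pt k), ?_⟩
    have h1 : EqOn (fun x => p₂.1 x - p₁.1 x) (fun _ => p₂.1 (pt k) - p₁.1 (pt k))
        (interior (msupp μ)) := by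
      intro x hx
      rw [← hOunion] at hx
      obtain ⟨j, hj⟩ := mem_iUnion.1 hx
      exact (hcl j x (subset_closure hj)).trans (hlink j k)
    have h2 : EqOn (fun x => p₂.1 x - p₁.1 x) (fun _ => p₂.1 (pt k) - p₁.1 (pt k))
        (msupp μ) :=
      h1.of_subset_closure (hgc.mono hsub) continuousOn_const interior_subset hsupp.le
    filter_upwards [hae] with x hx
    exact h2 hx
end
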